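/- Every group G embeds into a group H such that: (1) H is simple, complete and co-Hopfian; (2) the image of G is malnormal in H. -/

import Mathlib

namespace EmbThm
universe u v

section Amalg
variable {P : Type u} [Group P] {ι : Type v}

/-- alternating reduced products -/
inductive RP (E : Subgroup P) (A : ι → Subgroup P) : ι → ι → ℕ → P → Prop
  | single {i : ι} {x : P} : x ∈ A i → x ∉ E → RP E A i i 1 x
  | cons {i j k : ι} {n : ℕ} {x y : P} : x ∈ A i → x ∉ E → i ≠ j → RP E A j k n y →
      RP E A i k (n+1) (x * y)

structure IsAmalg (E : Subgroup P) (A : ι → Subgroup P) (Q : Subgroup P) : Prop where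
  le : ∀ i, E ≤ A i
  leQ : ∀ i, A i ≤ Q
  gen : ∀ K : Subgroup P, E ≤ K → (∀ i, A i ≤ K) → Q ≤ K
  red : ∀ i j n x, RP E A i j n x → x ∉ E

variable {E : Subgroup P} {A : ι → Subgroup P} {Q : Subgroup P}

theorem RP.mul {i j k l : ι} {n m : ℕ} {x y : P} (hx : RP E A i j n x) (hy : RP E A k l m y)
    (h : j ≠ k) : RP E A i l (n+m) (x*y) := by
  induction hx with
  | single h1 h2 => rw [add_comm]; exact RP.cons h1 h2 h hy
  | cons h1 h2 h3 _ ih =>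
    rw [mul_assoc, add_right_comm]; exact RP.cons h1 h2 h3 (ih h)

theorem RP.inv {i j : ι} {n : ℕ} {x : P} (hx : RP E A i j n x) : RP E A j i n x⁻¹ := by
  induction hx with
  | single h1 h2 => exact RP.single (inv_mem h1) (by simpa using h2)
  | cons h1 h2 h3 _ ih =>
    rw [mul_inv_rev]
    exact RP.mul ih (RP.single (inv_mem h1) (by simpa using h2)) h3.symm

theorem RP.pos {i j : ι} {n : ℕ} {x : P} (hx : RP E A i j n x) : 1 ≤ n := by
  cases hx <;> omega

theorem RP.mulE (hE : ∀ i, E ≤ A i) {i j : ι} {n : ℕ} {x : P} (hx : RP E A i j n x) {e : P}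
    (he : e ∈ E) : RP E A i j n (e * x) := by
  cases hx with
  | single h1 h2 => exact RP.single (mul_mem (hE _ he) h1) (by rwa [Subgroup.mul_mem_cancel_left _ he])
  | cons h1 h2 h3 h4 =>
    rw [← mul_assoc]
    exact RP.cons (mul_mem (hE _ he) h1) (by rwa [Subgroup.mul_mem_cancel_left _ he]) h3 h4

theorem RP.mulE' (hE : ∀ i, E ≤ A i) {i j : ι} {n : ℕ} {x : P} (hx : RP E A i j n x) {e : P}
    (he : e ∈ E) : RP E A i j n (x * e) := by
  have := (hx.inv.mulE hE (inv_mem he)).inv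
  simpa using this

theorem RP.snoc_cases {i j : ι} {n : ℕ} {x : P} (hx : RP E A i j n x) :
    (n = 1 ∧ i = j ∧ x ∈ A j ∧ x ∉ E) ∨ ∃ k m y a, x = y * a ∧ n = m + 1 ∧ RP E A i k m y ∧
      k ≠ j ∧ a ∈ A j ∧ a ∉ E := by
  have := hx.inv
  generalize hz : x⁻¹ = z at this
  cases this with
  | single h1 h2 =>
    left; rw [← hz] at h1 h2; exact ⟨rfl, rfl, by simpa using h1, by simpa using h2⟩
  | @cons _ k _ m a y h1 h2 h3 h4 =>
    right
    refine ⟨k, m, y⁻¹, a⁻¹, ?_, rfl, h4.inv, h3.symm, inv_mem h1, by simpa using h2⟩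
    rw [← mul_inv_rev, ← hz, inv_inv]

theorem RP.mem {i j : ι} {n : ℕ} {x : P} (hA : ∀ i, A i ≤ Q) (hx : RP E A i j n x) : x ∈ Q := by
  induction hx with
  | single h1 h2 => exact hA _ h1
  | cons h1 h2 h3 _ ih => exact mul_mem (hA _ h1) ih

namespace IsAmalg
variable (H : IsAmalg E A Q)
include H

theorem inter {i j : ι} (h : i ≠ j) {x : P} (hi : x ∈ A i) (hj : x ∈ A j) : x ∈ E := by
  by_contra hx
  have := H.red _ _ _ _ (RP.cons (inv_mem hi) (by simpa using hx) h (RP.single hj hx))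
  simp at this

theorem not_mem {i j k : ι} {n : ℕ} {x : P} (hx : RP E A i j n x) (hn : 2 ≤ n) : x ∉ A k := by
  intro hk
  have key : ∀ {i j k : ι} {n : ℕ} {x : P}, RP E A i j n x → k ≠ i → x ∉ A k := by
    intro i j k n x hx hki hk
    have := H.red _ _ _ _ (RP.cons (inv_mem hk) (by simpa using H.red _ _ _ _ hx) hki hx)
    simp at this
  by_cases hki : k = i
  · subst hki
    cases hx with
    | single => omega
    | cons h1 h2 h3 h4 =>
      exact key h4 h3 ((Subgroup.mul_mem_cancel_left _ h1).1 hk)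
  · exact key hx hki hk

theorem not_mem' {i j k : ι} {n : ℕ} {x : P} (hx : RP E A i j n x) (hn : k ≠ i) : x ∉ A k := by
  intro hk
  have := H.red _ _ _ _ (RP.cons (inv_mem hk) (by simpa using H.red _ _ _ _ hx) hn hx)
  simp at this

theorem dich {x : P} (hx : x ∈ Q) : x ∈ E ∨ ∃ i j n, RP E A i j n x := by
  classical
  let D : Set P := {x | x ∈ E ∨ ∃ i j n, RP E A i j n x}
  let K : Subgroup P :=
    { carrier := {a | (∀ x ∈ D, a * x ∈ D) ∧ (∀ x ∈ D, a⁻¹ * x ∈ D)}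
      mul_mem' := by
        rintro a b ⟨h1, h2⟩ ⟨h3, h4⟩
        refine ⟨fun x hx => ?_, fun x hx => ?_⟩
        · rw [mul_assoc]; exact h1 _ (h3 _ hx)
        · rw [mul_inv_rev, mul_assoc]; exact h4 _ (h2 _ hx)
      one_mem' := by simp
      inv_mem' := by
        rintro a ⟨h1, h2⟩
        exact ⟨h2, by simpa using h1⟩ }
  have hE : ∀ a ∈ E, ∀ x ∈ D, a * x ∈ D := by
    rintro a ha x (hx | ⟨i, j, n, hx⟩)
    · exact Or.inl (mul_mem ha hx)
    · exact Or.inr ⟨_, _, _, hx.mulE H.le ha⟩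
  have hA : ∀ k, ∀ a ∈ A k, ∀ x ∈ D, a * x ∈ D := by
    intro k a ha x hxD
    by_cases haE : a ∈ E
    · exact hE a haE x hxD
    rcases hxD with hx | ⟨i, j, n, hx⟩
    · right
      exact ⟨_, _, _, RP.single (mul_mem ha (H.le k hx)) (by rwa [Subgroup.mul_mem_cancel_right _ hx])⟩
    · by_cases hki : k = i
      · subst hki
        cases hx with
        | single h1 h2 =>
          by_cases h : a * x ∈ E
          · exact Or.inl h
          · exact Or.inr ⟨_, _, _, RP.single (mul_mem ha h1) h⟩
        | @cons _ _ _ _ b y h1 h2 h3 h4 =>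
          rw [← mul_assoc]
          by_cases h : a * b ∈ E
          · exact Or.inr ⟨_, _, _, h4.mulE H.le h⟩
          · exact Or.inr ⟨_, _, _, RP.cons (mul_mem ha h1) h h3 h4⟩
      · exact Or.inr ⟨_, _, _, RP.cons ha haE hki hx⟩
  have := H.gen K (fun a ha => ⟨hE a ha, hE _ (inv_mem ha)⟩)
    (fun k a ha => ⟨hA k a ha, hA k _ (inv_mem ha)⟩) hx
  have h2 := this.1 1 (Or.inl (one_mem _))
  rwa [mul_one] at h2

theorem pow_RP {i j : ι} {n : ℕ} {x : P} (hx : RP E A i j n x) (hij : i ≠ j) (m : ℕ) :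
    RP E A i j ((m+1)*n) (x^(m+1)) := by
  induction m with
  | zero => simpa using hx
  | succ m ih =>
    rw [pow_succ, add_mul _ 1, one_mul]
    exact ih.mul hx hij.symm

theorem tors [Nonempty ι] {x : P} (hx : x ∈ Q) (hfin : IsOfFinOrder x) :
    ∃ h ∈ Q, ∃ i, h * x * h⁻¹ ∈ A i := by
  rcases H.dich hx with h | ⟨i, j, n, h⟩
  · exact ⟨1, one_mem _, Classical.arbitrary ι, by simpa using H.le _ h⟩
  induction n using Nat.strong_induction_on generalizing i j x with
  | _ n ih =>
    by_cases hij : i = j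
    · subst hij
      cases h with
      | single h1 h2 => exact ⟨1, one_mem _, i, by simpa using h1⟩
      | @cons _ k _ m a y h1 h2 h3 h4 =>
        have hfin' : IsOfFinOrder (y * a) := by
          have : y * a = a⁻¹ * (a * y) * a⁻¹⁻¹ := by group
          rw [this]
          obtain ⟨n, hn, h⟩ := isOfFinOrder_iff_pow_eq_one.1 hfin
          exact isOfFinOrder_iff_pow_eq_one.2 ⟨n, hn, by rw [conj_pow, h]; simp⟩
        have hyQ : y ∈ Q := h4.mem H.leQ
        have hyaQ : y * a ∈ Q := mul_mem hyQ (H.leQ _ h1)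
        have haQ := H.leQ _ h1
        have fin : ∀ h ∈ Q, ∀ i, h * (y * a) * h⁻¹ ∈ A i → ∃ h ∈ Q, ∃ i, h * (a * y) * h⁻¹ ∈ A i := by
          intro h hhQ i hh
          refine ⟨h * a⁻¹, mul_mem hhQ (inv_mem haQ), i, ?_⟩
          convert hh using 1; group
        rcases h4.snoc_cases with ⟨_, h, _⟩ | ⟨k', m', y', b, rfl, rfl, hy', hk', hb, hbE⟩
        · exact absurd h.symm h3
        · by_cases hba : b * a ∈ E
          · have := hy'.mulE' H.le hba
            rw [← mul_assoc] at this
            obtain ⟨h, hhQ, i, hh⟩ := ih m' (by omega) (x := y' * b * a) hyaQ hfin' _ _ this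
            exact fin h hhQ i hh
          · have := hy'.mul (RP.single (mul_mem hb h1) hba) hk'
            rw [← mul_assoc] at this
            obtain ⟨h, hhQ, i, hh⟩ := ih (m'+1) (by omega) (x := y' * b * a) hyaQ hfin' _ _ this
            exact fin h hhQ i hh
    · exfalso
      obtain ⟨m, hm, h1⟩ := isOfFinOrder_iff_pow_eq_one.1 hfin
      have := H.pow_RP h hij (m-1)
      rw [Nat.sub_add_cancel hm, h1] at this
      exact H.red _ _ _ _ this (one_mem _)

/-- `x ∈ A i` not conjugate into `E` in `A i` -/
theorem fac {i j : ι} {x h : P} (hx : x ∈ A i) (hx' : ∀ a ∈ A i, a * x * a⁻¹ ∉ E) (hQ : h ∈ Q)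
    (hh : h * x * h⁻¹ ∈ A j) : i = j ∧ h ∈ A i := by
  have key : ∀ a ∈ A i, a * x * a⁻¹ ∈ A j → i = j ∧ a ∈ A i := by
    intro a ha hj
    refine ⟨?_, ha⟩
    by_contra hij
    exact hx' a ha (H.inter hij (mul_mem (mul_mem ha hx) (inv_mem ha)) hj)
  rcases H.dich hQ with hE | ⟨k, l, n, hr⟩
  · exact key h (H.le _ hE) hh
  have hxE : x ∉ E := by simpa using hx' 1 (one_mem _)
  by_cases hl : l = i
  · subst hl
    rcases hr.snoc_cases with ⟨_, h1, h2, _⟩ | ⟨k', m', y', b, rfl, rfl, hy', hk', hb, hbE⟩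
    · exact key h h2 hh
    · exfalso
      have := (hy'.mul (RP.single (mul_mem (mul_mem hb hx) (inv_mem hb)) (hx' b hb)) hk').mul hy'.inv hk'.symm
      refine H.not_mem (k := j) this (by have := hy'.pos; omega) ?_
      convert hh using 1; group
  · exfalso
    have := (hr.mul (RP.single hx hxE) hl).mul hr.inv (Ne.symm hl)
    exact H.not_mem (k := j) this (by have := hr.pos; omega) hh

theorem base (hm : ∀ i, ∀ a ∈ A i, ∀ e ∈ E, e ≠ 1 → a * e * a⁻¹ ∈ E → a ∈ E) {h e : P} (hQ : h ∈ Q)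
    (he : e ∈ E) (he1 : e ≠ 1) (hh : h * e * h⁻¹ ∈ E) : h ∈ E := by
  rcases H.dich hQ with hE | ⟨k, l, n, hr⟩
  · exact hE
  exfalso
  rcases hr.snoc_cases with ⟨_, rfl, h2, h3⟩ | ⟨k', m', y', b, rfl, rfl, hy', hk', hb, hbE⟩
  · exact h3 (hm _ h h2 e he he1 hh)
  · have h1 : b * e * b⁻¹ ∉ E := fun h => hbE (hm _ b hb e he he1 h)
    have := (hy'.mul (RP.single (mul_mem (mul_mem hb (H.le _ he)) (inv_mem hb)) h1) hk').mul hy'.inv hk'.symm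
    refine H.red _ _ _ _ this ?_
    convert hh using 1; group

/-- a vertex group which is abelian, with `E` malnormal in the others, is malnormal -/
theorem abel {i₀ : ι} (hab : ∀ a ∈ A i₀, ∀ b ∈ A i₀, a * b = b * a)
    (hm : ∀ i, i ≠ i₀ → ∀ a ∈ A i, ∀ e ∈ E, e ≠ 1 → a * e * a⁻¹ ∈ E → a ∈ E) {h x : P} (hQ : h ∈ Q)
    (hx : x ∈ A i₀) (hx1 : x ≠ 1) (hh : h * x * h⁻¹ ∈ A i₀) : h ∈ A i₀ := by
  have conj : ∀ a ∈ A i₀, a * x * a⁻¹ = x := fun a ha => by rw [hab a ha x hx]; group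
  by_cases hxE : x ∈ E
  · -- peel
    have main : ∀ k l n h, RP E A k l n h → l ≠ i₀ → h * x * h⁻¹ ∉ A i₀ := by
      intro k l n h hr hl hh
      rcases hr.snoc_cases with ⟨_, rfl, h2, h3⟩ | ⟨k', m', y', b, rfl, rfl, hy', hk', hb, hbE⟩
      · exact h3 (hm _ hl h h2 x hxE hx1 (H.inter hl (mul_mem (mul_mem h2 (H.le _ hxE)) (inv_mem h2)) hh))
      · have h1 : b * x * b⁻¹ ∉ E := fun h => hbE (hm _ hl b hb x hxE hx1 h)
        have := (hy'.mul (RP.single (mul_mem (mul_mem hb (H.le _ hxE)) (inv_mem hb)) h1) hk').mul hy'.inv hk'.symm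
        refine H.not_mem (k := i₀) this (by have := hy'.pos; omega) ?_
        convert hh using 1; group
    rcases H.dich hQ with hE | ⟨k, l, n, hr⟩
    · exact H.le _ hE
    by_cases hl : l = i₀
    · subst hl
      rcases hr.snoc_cases with ⟨_, rfl, h2, h3⟩ | ⟨k', m', y', b, rfl, rfl, hy', hk', hb, hbE⟩
      · exact h2
      · exfalso
        refine main _ _ _ _ hy' hk' ?_
        have : y' * b * x * (y' * b)⁻¹ = y' * (b * x * b⁻¹) * y'⁻¹ := by group
        rw [this, conj b hb] at hh
        exact hh
    · exact absurd hh (main _ _ _ _ hr hl)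
  · exact (H.fac hx (fun a ha => by rwa [conj a ha]) hQ hh).2

end IsAmalg

theorem RP.of_map {P' : Type*} [Group P'] (f : P →* P') (hf : Function.Injective f) {i j : ι} {n : ℕ}
    {z : P'} (hz : RP (E.map f) (fun i => (A i).map f) i j n z) : ∃ x, f x = z ∧ RP E A i j n x := by
  induction hz with
  | single h1 h2 =>
    obtain ⟨x, hx, rfl⟩ := h1
    exact ⟨x, rfl, RP.single hx (fun h => h2 ⟨x, h, rfl⟩)⟩
  | cons h1 h2 h3 _ ih =>
    obtain ⟨x, hx, rfl⟩ := h1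
    obtain ⟨y, rfl, hy⟩ := ih
    exact ⟨x * y, map_mul _ _ _, RP.cons hx (fun h => h2 ⟨x, h, rfl⟩) h3 hy⟩

theorem IsAmalg.map {P' : Type*} [Group P'] (H : IsAmalg E A Q) (f : P →* P')
    (hf : Function.Injective f) : IsAmalg (E.map f) (fun i => (A i).map f) (Q.map f) where
  le i := Subgroup.map_mono (H.le i)
  leQ i := Subgroup.map_mono (H.leQ i)
  gen K h1 h2 := by
    rw [Subgroup.map_le_iff_le_comap] at h1 ⊢
    exact H.gen _ h1 (fun i => Subgroup.map_le_iff_le_comap.1 (h2 i))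
  red i j n x hx := by
    obtain ⟨y, rfl, hy⟩ := hx.of_map f hf
    rintro ⟨y', h1, h2⟩
    rw [hf h2] at h1
    exact H.red _ _ _ _ hy h1

end Amalg

end EmbThm

namespace EmbThm
universe u v
section Exists
open Monoid

section
variable {ι : Type v} {K : Type u} {M : ι → Type u} [Group K] [∀ i, Group (M i)] (φ : ∀ i, K →* M i)

theorem RP.word {i j : ι} {n : ℕ} {x : PushoutI φ}
    (hx : RP (PushoutI.base φ).range (fun i => (PushoutI.of (φ := φ) i).range) i j n x) :
    ∃ w : CoprodI.Word M, PushoutI.ofCoprodI w.prod = x ∧ PushoutI.Reduced φ w ∧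
      w.fstIdx = some i := by
  have aux : ∀ i (y : M i), PushoutI.of (φ := φ) i y ∉ (PushoutI.base φ).range →
      y ∉ (φ i).range ∧ y ≠ 1 := by
    intro i y hy
    refine ⟨?_, ?_⟩
    · rintro ⟨z, rfl⟩
      exact hy ⟨z, (PushoutI.of_apply_eq_base φ i z).symm⟩
    · rintro rfl
      exact hy (by simp)
  have hne : ∀ i, (CoprodI.Word.empty : CoprodI.Word M).fstIdx ≠ some i := by
    intro i; simp [CoprodI.Word.fstIdx, CoprodI.Word.empty]
  induction hx with
  | @single i x h1 h2 =>
    obtain ⟨y, rfl⟩ := h1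
    obtain ⟨h3, h4⟩ := aux _ y h2
    refine ⟨CoprodI.Word.cons y .empty (hne i) h4, ?_, ?_, ?_⟩
    · rw [CoprodI.Word.prod_cons]; simp
    · intro g hg
      simp [CoprodI.Word.cons, CoprodI.Word.empty] at hg
      subst hg
      exact h3
    · exact CoprodI.Word.fstIdx_cons _ _ _ _
  | @cons i j k n x y h1 h2 h3 _ ih =>
    obtain ⟨y, rfl⟩ := h1
    obtain ⟨h4, h5⟩ := aux _ y h2
    obtain ⟨w, rfl, hw, hf⟩ := ih
    refine ⟨CoprodI.Word.cons y w (by rw [hf]; simpa using h3.symm) h5, ?_, ?_, ?_⟩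
    · rw [CoprodI.Word.prod_cons]; simp
    · intro g hg
      simp only [CoprodI.Word.cons, List.mem_cons] at hg
      rcases hg with rfl | hg
      · exact h4
      · exact hw g hg
    · exact CoprodI.Word.fstIdx_cons _ _ _ _

theorem exists_amalg (hφ : ∀ i, Function.Injective (φ i)) : ∃ (P : Type (max u v)) (_ : Group P) (b : K →* P)
    (f : ∀ i, M i →* P), Function.Injective b ∧ (∀ i, Function.Injective (f i)) ∧
    (∀ i x, f i (φ i x) = b x) ∧ IsAmalg b.range (fun i => (f i).range) ⊤ := by
  refine ⟨PushoutI φ, inferInstance, PushoutI.base φ, PushoutI.of, PushoutI.base_injective hφ, 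
    PushoutI.of_injective hφ, PushoutI.of_apply_eq_base φ, ?_, ?_, ?_, ?_⟩
  · rintro i _ ⟨x, rfl⟩
    exact ⟨φ i x, PushoutI.of_apply_eq_base φ i x⟩
  · intros; exact le_top
  · intro L h1 h2 x _
    induction x using PushoutI.induction_on with
    | of i g => exact h2 i ⟨g, rfl⟩
    | base h => exact h1 ⟨h, rfl⟩
    | mul x y hx hy => exact mul_mem (hx trivial) (hy trivial)
  · intro i j n x hx hm
    obtain ⟨w, rfl, hw, hf⟩ := hx.word
    have := hw.eq_empty_of_mem_range hφ hm
    subst this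
    simp [CoprodI.Word.fstIdx, CoprodI.Word.empty] at hf
end

theorem exists_amalg2 {K M N : Type u} [Group K] [Group M] [Group N] (f : K →* M) (g : K →* N)
    (hf : Function.Injective f) (hg : Function.Injective g) :
    ∃ (P : Type u) (_ : Group P) (a : M →* P) (b : N →* P), Function.Injective a ∧ Function.Injective b ∧
    (∀ x, a (f x) = b (g x)) ∧
    IsAmalg (a.comp f).range (fun t : Bool => bif t then a.range else b.range) ⊤ := by
  let F : Bool → Type u := fun t => match t with | false => N | true => M
  let inst : ∀ t, Group (F t) := fun t => by
    cases t
    · exact (inferInstance : Group N)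
    · exact (inferInstance : Group M)
  let φ : ∀ t, K →* F t := fun t => by
    cases t
    · exact g
    · exact f
  obtain ⟨P, hP, b, h, h1, h2, h3, h4⟩ := exists_amalg φ (by intro t; cases t; exacts [hg, hf])
  refine ⟨P, hP, h true, h false, h2 true, h2 false, fun x => (h3 true x).trans (h3 false x).symm, ?_⟩
  let a' : M →* P := h true
  let b' : N →* P := h false
  have e1 : (MonoidHom.comp a' f).range = b.range := by
    have : MonoidHom.comp a' f = b := by ext x; exact h3 true x
    rw [this]
  have e2 : (fun t : Bool => bif t then a'.range else b'.range) = fun t => (h t).range := by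
    funext t; cases t <;> rfl
  change IsAmalg (a'.comp f).range (fun t : Bool => bif t then a'.range else b'.range) ⊤
  rw [e1, e2]
  exact h4
end Exists
end EmbThm

namespace EmbThm
universe u v
section HNN
variable {H : Type u} [Group H]

def rp (r : H) (e : Bool) : H := bif e then r else r⁻¹
def SS (A B : Subgroup H) (e : Bool) : Subgroup H := bif e then A else B

theorem rp_not (r : H) (e : Bool) : rp r (!e) = (rp r e)⁻¹ := by cases e <;> simp [rp]

/-- reduced HNN words beginning and ending with a stable letter -/
inductive HR (T A B : Subgroup H) (r : H) : Bool → Bool → ℕ → H → Prop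
  | single (e : Bool) : HR T A B r e e 1 (rp r e)
  | cons {e e' d : Bool} {n : ℕ} {t x : H} : t ∈ T → (t ∈ SS A B e → e = e') → HR T A B r e' d n x →
      HR T A B r e d (n+1) (rp r e * t * x)

structure IsHNN (T A B : Subgroup H) (r : H) : Prop where
  leA : A ≤ T
  leB : B ≤ T
  conjA : ∀ a ∈ A, r * a * r⁻¹ ∈ B
  conjB : ∀ b ∈ B, r⁻¹ * b * r ∈ A
  gen : ∀ K : Subgroup H, T ≤ K → r ∈ K → K = ⊤
  red : ∀ e d n x, HR T A B r e d n x → x ∉ T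

variable {T A B : Subgroup H} {r : H}

theorem HR.mul {e d e' d' : Bool} {n m : ℕ} {x y t : H} (hx : HR T A B r e d n x)
    (hy : HR T A B r e' d' m y) (ht : t ∈ T) (h : t ∈ SS A B d → d = e') :
    HR T A B r e d' (n+m) (x*t*y) := by
  induction hx with
  | single e => rw [add_comm]; exact HR.cons ht h hy
  | cons h1 h2 _ ih =>
    have := HR.cons h1 h2 (ih h)
    rw [add_right_comm]; simpa only [mul_assoc] using this

theorem HR.inv {e d : Bool} {n : ℕ} {x : H} (hx : HR T A B r e d n x) :
    HR T A B r (!d) (!e) n x⁻¹ := by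
  induction hx with
  | single e => rw [← rp_not]; exact HR.single _
  | @cons e e' d n t x h1 h2 _ ih =>
    have := HR.mul (t := t⁻¹) ih (HR.single (!e)) (inv_mem h1) (by
      rw [inv_mem_iff]
      cases e <;> cases e' <;> simp at h2 ⊢ <;> exact h2)
    rw [rp_not] at this
    simpa only [mul_inv_rev, mul_assoc] using this

theorem HR.pos {e d : Bool} {n : ℕ} {x : H} (hx : HR T A B r e d n x) : 1 ≤ n := by
  cases hx <;> omega

theorem HR.snoc_cases {e d : Bool} {n : ℕ} {x : H} (hx : HR T A B r e d n x) :
    (n = 1 ∧ e = d ∧ x = rp r d) ∨ ∃ d' m y t, x = y * t * rp r d ∧ n = m + 1 ∧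
      HR T A B r e d' m y ∧ t ∈ T ∧ (t ∈ SS A B d' → d' = d) := by
  induction hx with
  | single e => exact Or.inl ⟨rfl, rfl, rfl⟩
  | @cons e e' d n t x h1 h2 _ ih =>
    right
    rcases ih with ⟨rfl, rfl, rfl⟩ | ⟨d', m, y, t', rfl, rfl, hy, ht', h3⟩
    · exact ⟨e, 1, rp r e, t, rfl, rfl, HR.single _, h1, h2⟩
    · exact ⟨d', m+1, rp r e * t * y, t', by simp only [mul_assoc], rfl, HR.cons h1 h2 hy, ht', h3⟩

namespace IsHNN
variable (X : IsHNN T A B r)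
include X

theorem leS (e : Bool) : SS A B e ≤ T := by cases e; exacts [X.leB, X.leA]

theorem conjS {e : Bool} {a : H} (ha : a ∈ SS A B e) : rp r e * a * (rp r e)⁻¹ ∈ SS A B (!e) := by
  cases e
  · simpa [rp, SS] using X.conjB a ha
  · simpa [rp, SS] using X.conjA a ha

theorem dich (h : H) : h ∈ T ∨ ∃ e d n t x t', t ∈ T ∧ t' ∈ T ∧ h = t * x * t' ∧ HR T A B r e d n x := by
  let D : Set H := {h | h ∈ T ∨ ∃ e d n t x t', t ∈ T ∧ t' ∈ T ∧ h = t * x * t' ∧ HR T A B r e d n x}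
  let K : Subgroup H :=
    { carrier := {a | (∀ x ∈ D, a * x ∈ D) ∧ (∀ x ∈ D, a⁻¹ * x ∈ D)}
      mul_mem' := by
        rintro a b ⟨h1, h2⟩ ⟨h3, h4⟩
        refine ⟨fun x hx => ?_, fun x hx => ?_⟩
        · rw [mul_assoc]; exact h1 _ (h3 _ hx)
        · rw [mul_inv_rev, mul_assoc]; exact h4 _ (h2 _ hx)
      one_mem' := by simp
      inv_mem' := by
        rintro a ⟨h1, h2⟩
        exact ⟨h2, by simpa using h1⟩ }
  have hT : ∀ a ∈ T, ∀ x ∈ D, a * x ∈ D := by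
    rintro a ha x (hx | ⟨e, d, n, t, y, t', ht, ht', rfl, hy⟩)
    · exact Or.inl (mul_mem ha hx)
    · exact Or.inr ⟨e, d, n, a * t, y, t', mul_mem ha ht, ht', by simp only [mul_assoc], hy⟩
  have hr : ∀ e, ∀ x ∈ D, rp r e * x ∈ D := by
    rintro e x (hx | ⟨e', d, n, t, y, t', ht, ht', rfl, hy⟩)
    · exact Or.inr ⟨e, e, 1, 1, rp r e, x, one_mem _, hx, by simp, HR.single _⟩
    · by_cases hc : t ∈ SS A B e → e = e'
      · exact Or.inr ⟨e, d, _, 1, _, t', one_mem _, ht', by simp only [one_mul, mul_assoc], HR.cons ht hc hy⟩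
      · push Not at hc
        obtain ⟨h1, h2⟩ := hc
        have h3 := X.leS _ (X.conjS h1)
        obtain rfl : e' = !e := by cases e <;> cases e' <;> simp_all
        cases hy with
        | single =>
          left
          rw [rp_not]
          have := mul_mem h3 ht'
          simpa only [mul_assoc] using this
        | @cons _ e2 _ n s z hs hs' hz =>
          right
          refine ⟨_, _, _, (rp r e * t * (rp r e)⁻¹) * s, z, t', mul_mem h3 hs, ht', ?_, hz⟩
          rw [rp_not]; simp only [mul_assoc]
  have := X.gen K (fun a ha => ⟨hT a ha, hT _ (inv_mem ha)⟩) ⟨hr true, hr false⟩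
  have h1 : h ∈ K := by rw [this]; trivial
  have h2 := h1.1 1 (Or.inl (one_mem _))
  rwa [mul_one] at h2

theorem tors {h : H} (hfin : IsOfFinOrder h) : ∃ k, k * h * k⁻¹ ∈ T := by
  have conjfin : ∀ {a b : H}, (∃ c, c * a * c⁻¹ = b) → IsOfFinOrder a → IsOfFinOrder b := by
    rintro a b ⟨c, rfl⟩ ha
    obtain ⟨n, hn, h⟩ := isOfFinOrder_iff_pow_eq_one.1 ha
    exact isOfFinOrder_iff_pow_eq_one.2 ⟨n, hn, by rw [conj_pow, h]; simp⟩
  have main : ∀ n e d x t, HR T A B r e d n x → t ∈ T → IsOfFinOrder (x * t) →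
      ∃ k, k * (x * t) * k⁻¹ ∈ T := by
    intro n
    induction n using Nat.strong_induction_on with
    | _ n ih =>
      intro e d x t hx ht hf
      by_cases hc : t ∈ SS A B d → d = e
      · exfalso
        have pw : ∀ m, ∃ n y, HR T A B r e d n y ∧ (x*t)^(m+1) = y * t := by
          intro m
          induction m with
          | zero => exact ⟨n, x, hx, by simp⟩
          | succ m ihm =>
            obtain ⟨n', y, hy, he⟩ := ihm
            refine ⟨_, _, hy.mul hx ht hc, ?_⟩
            rw [pow_succ, he]; simp only [mul_assoc]
        obtain ⟨m, hm, h1⟩ := isOfFinOrder_iff_pow_eq_one.1 hf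
        obtain ⟨n', y, hy, he⟩ := pw (m-1)
        rw [Nat.sub_add_cancel hm, h1] at he
        refine X.red _ _ _ _ hy ?_
        have : y = t⁻¹ := eq_inv_of_mul_eq_one_left he.symm
        rw [this]; exact inv_mem ht
      · push Not at hc
        obtain ⟨h1, h2⟩ := hc
        have hed : e = !d := by cases e <;> cases d <;> simp_all
        have h3 := X.leS _ (X.conjS h1)
        have key : ∀ z, (∃ c, c * (x * t) * c⁻¹ = z) → (∃ k, k * z * k⁻¹ ∈ T) → ∃ k, k * (x * t) * k⁻¹ ∈ T := by
          rintro z ⟨c, rfl⟩ ⟨k, hk⟩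
          refine ⟨k * c, ?_⟩
          convert hk using 1; group
        cases hx with
        | single => simp at h2
        | @cons _ e2 _ n s z hs hs' hz =>
          subst hed
          rcases hz.snoc_cases with ⟨rfl, rfl, rfl⟩ | ⟨d', m, y, s', rfl, rfl, hy, hs'', h4⟩
          · refine key (s * (rp r e2 * t * (rp r e2)⁻¹)) ⟨(rp r (!e2))⁻¹, ?_⟩ ⟨1, ?_⟩
            · rw [rp_not]; group
            · simpa using mul_mem hs h3
          · have e1 : ∃ c, c * (rp r (!d) * s * (y * s' * rp r d) * t) * c⁻¹ =
              y * (s' * (rp r d * t * (rp r d)⁻¹) * s) := ⟨s⁻¹ * (rp r (!d))⁻¹, by rw [rp_not]; group⟩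
            refine key _ e1 (ih m (by omega) _ _ _ _ hy (mul_mem (mul_mem hs'' h3) hs) (conjfin e1 hf))
  rcases X.dich h with h1 | ⟨e, d, n, t, x, t', ht, ht', rfl, hx⟩
  · exact ⟨1, by simpa using h1⟩
  · have e1 : ∃ c, c * (t * x * t') * c⁻¹ = x * (t' * t) := ⟨t⁻¹, by group⟩
    obtain ⟨k, hk⟩ := main n e d x (t' * t) hx (mul_mem ht' ht) (conjfin e1 hfin)
    refine ⟨k * t⁻¹, ?_⟩
    convert hk using 1; group

theorem mal_aux {κ : Type*} {S : κ → H} (hS : ∀ k, S k ∈ T) {e d : Bool} {n : ℕ} {x : H}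
    (hx : HR T A B r e d n x) (hh : ∀ k, x * S k * x⁻¹ ∈ T) (k : κ) : S k ∈ SS A B d := by
  by_contra hk
  exact X.red _ _ _ _ (hx.mul hx.inv (hS k) (fun h => absurd h hk)) (hh k)

theorem mal {κ : Type*} {S : κ → H} (hS : ∀ k, S k ∈ T) {h : H}
    (hh : ∀ k, h * S k * h⁻¹ ∈ T) (hT : h ∉ T) :
    ∃ t ∈ T, (∀ k, t * S k * t⁻¹ ∈ A) ∨ (∀ k, t * S k * t⁻¹ ∈ B) := by
  rcases X.dich h with h1 | ⟨e, d, n, t, x, t', ht, ht', rfl, hx⟩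
  · exact absurd h1 hT
  refine ⟨t', ht', ?_⟩
  have := X.mal_aux (S := fun k => t' * S k * t'⁻¹) (fun k => mul_mem (mul_mem ht' (hS k)) (inv_mem ht')) hx
    (fun k => by
      have := mul_mem (mul_mem (inv_mem ht) (hh k)) ht
      convert this using 1; group)
  cases d
  · exact Or.inr this
  · exact Or.inl this

theorem anchor {κ : Type*} {D D' : κ → H} (hD : ∀ k, D k ∈ T)
    (hD' : ∀ k, r * D k * r⁻¹ = D' k)
    (c1 : ∀ t ∈ T, (∀ k, t * D k * t⁻¹ ∈ A) → t ∈ A)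
    (c2 : ∀ t ∈ T, ¬ ∀ k, t * D k * t⁻¹ ∈ B)
    (c3 : ∀ t ∈ T, (∀ k, t * D' k * t⁻¹ ∈ B) → t ∈ B)
    (c4 : ∀ t ∈ T, ¬ ∀ k, t * D' k * t⁻¹ ∈ A) {h : H}
    (hh : ∀ k, h * D k * h⁻¹ ∈ T) : h ∈ T ∨ ∃ t ∈ T, h = t * r := by
  rcases X.dich h with h1 | ⟨e, d, n, t, x, t', ht, ht', rfl, hx⟩
  · exact Or.inl h1
  right
  have hh' : ∀ k, x * (t' * D k * t'⁻¹) * x⁻¹ ∈ T := fun k => by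
      have := mul_mem (mul_mem (inv_mem ht) (hh k)) ht
      convert this using 1; group
  have h1 := X.mal_aux (S := fun k => t' * D k * t'⁻¹)
    (fun k => mul_mem (mul_mem ht' (hD k)) (inv_mem ht')) hx hh'
  cases d
  · exact absurd h1 (c2 t' ht')
  have h2 := c1 t' ht' h1
  have h3 := X.conjA _ h2
  rcases hx.snoc_cases with ⟨_, _, hxr⟩ | ⟨d', m, y, s, rfl, rfl, hy, hs, h4⟩
  · rw [hxr]
    refine ⟨t * (r * t' * r⁻¹), mul_mem ht (X.leB h3), ?_⟩
    simp only [rp, cond_true]; group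
  · exfalso
    have hsT : s * (r * t' * r⁻¹) ∈ T := mul_mem hs (X.leB h3)
    have e1 : ∀ k, y * s * rp r true * (t' * D k * t'⁻¹) * (y * s * rp r true)⁻¹ =
        y * (s * (r * t' * r⁻¹) * D' k * (s * (r * t' * r⁻¹))⁻¹) * y⁻¹ := by
      intro k; rw [← hD']; simp only [rp, cond_true]; group
    have hD'T : ∀ k, s * (r * t' * r⁻¹) * D' k * (s * (r * t' * r⁻¹))⁻¹ ∈ T := by
      intro k
      have : s * (r * t' * r⁻¹) * D' k * (s * (r * t' * r⁻¹))⁻¹ = s * (r * (t' * D k * t'⁻¹) * r⁻¹) * s⁻¹ := by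
        rw [← hD']; group
      rw [this]
      exact mul_mem (mul_mem hs (X.leB (X.conjA _ (h1 k)))) (inv_mem hs)
    have h5 := X.mal_aux hD'T hy (fun k => by rw [← e1]; exact hh' k)
    cases d'
    · have h6 := c3 _ hsT h5
      rw [Subgroup.mul_mem_cancel_right _ h3] at h6
      exact absurd (h4 h6) (by simp)
    · exact c4 _ hsT h5
end IsHNN

section ex
variable {Z : Type u} [Group Z] {A B : Subgroup Z} (φ : A ≃* B)
open HNNExtension
theorem HR.word {e d : Bool} {n : ℕ} {x : HNNExtension Z A B φ}
    (hx : HR (of (φ := φ)).range (A.map of) (B.map of) t e d n x) :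
    ∃ l : List (ℤˣ × Z), l ≠ [] ∧ (l.map (fun x => (t : HNNExtension Z A B φ) ^ (x.1 : ℤ) * of x.2)).prod = x ∧
      l.IsChain (fun a b => a.2 ∈ toSubgroup A B a.1 → a.1 = b.1) ∧
      (l.head?.map Prod.fst) = some (bif e then 1 else -1) := by
  have hrp : ∀ e, rp (t : HNNExtension Z A B φ) e = t ^ (((bif e then 1 else -1 : ℤˣ) : ℤˣ) : ℤ) := by
    intro e; cases e <;> simp [rp]
  induction hx with
  | single e => exact ⟨[(bif e then 1 else -1, 1)], by simp, by simp [hrp], by simp, by simp⟩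
  | @cons e e' d n s x h1 h2 _ ih =>
    obtain ⟨s, rfl⟩ := h1
    obtain ⟨l, h3, rfl, h4, h5⟩ := ih
    refine ⟨(bif e then 1 else -1, s) :: l, by simp, by simp [hrp], ?_, by simp⟩
    rw [List.isChain_cons]
    refine ⟨?_, h4⟩
    intro y hy hs
    rw [Option.mem_def] at hy
    rw [hy] at h5
    simp only [Option.map_some, Option.some_inj] at h5
    simp only at hs ⊢
    rw [h5, h2]
    cases e
    · exact ⟨s, hs, rfl⟩
    · exact ⟨s, hs, rfl⟩

theorem isHNN : IsHNN (of (φ := φ)).range (A.map of) (B.map of) t where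
  leA := by rintro _ ⟨a, _, rfl⟩; exact ⟨a, rfl⟩
  leB := by rintro _ ⟨a, _, rfl⟩; exact ⟨a, rfl⟩
  conjA := by
    rintro _ ⟨a, ha, rfl⟩
    exact ⟨φ ⟨a, ha⟩, (φ ⟨a, ha⟩).2, equiv_eq_conj ⟨a, ha⟩⟩
  conjB := by
    rintro _ ⟨a, ha, rfl⟩
    exact ⟨φ.symm ⟨a, ha⟩, (φ.symm ⟨a, ha⟩).2, equiv_symm_eq_conj ⟨a, ha⟩⟩
  gen K h1 h2 := by
    rw [eq_top_iff]
    intro x _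
    induction x using HNNExtension.induction_on with
    | of g => exact h1 ⟨g, rfl⟩
    | t => exact h2
    | mul x y hx hy => exact mul_mem (hx trivial) (hy trivial)
    | inv x hx => exact inv_mem (hx trivial)
  red e d n x hx hT := by
    obtain ⟨l, h1, rfl, h2, _⟩ := hx.word
    exact h1 (ReducedWord.toList_eq_nil_of_mem_of_range φ ⟨1, l, h2⟩ (by simpa [NormalWord.ReducedWord.prod] using hT))

theorem exists_hnn : ∃ (H : Type u) (_ : Group H) (f : Z →* H) (r : H), Function.Injective f ∧
    IsHNN f.range (A.map f) (B.map f) r ∧ ∀ a : A, r * f a * r⁻¹ = f (φ a) :=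
  ⟨HNNExtension Z A B φ, inferInstance, of, t, of_injective φ, isHNN φ, fun a => (equiv_eq_conj a).symm⟩
end ex
end HNN
end EmbThm

namespace EmbThm
universe u v
section Free
open FreeGroup (toWord_mul mk_toWord toWord_mk toWord_eq_nil_iff isReduced_toWord norm_mk_le)

theorem toWord_map {α β : Type*} [DecidableEq α] [DecidableEq β] (f : α → β) (hf : Function.Injective f)
    (n : FreeGroup α) :
    (FreeGroup.map f n).toWord = n.toWord.map (fun a => (f a.1, a.2)) := by
  have h : FreeGroup.IsReduced (n.toWord.map (fun a => (f a.1, a.2))) := by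
    have := isReduced_toWord (x := n)
    unfold FreeGroup.IsReduced at this ⊢
    rw [List.isChain_map]
    refine this.imp ?_
    intro a b h h2
    exact h (hf h2)
  conv_lhs => rw [← mk_toWord (x := n), FreeGroup.map.mk, toWord_mk]
  exact h.reduce_eq

theorem fixed_word {α : Type*} (f : α → α) (hf : Function.Injective f) (h : ∀ a, f a ≠ a)
    {n : FreeGroup α} (hn : FreeGroup.map f n = n) : n = 1 := by
  classical
  have := toWord_map f hf n
  rw [hn] at this
  rw [← toWord_eq_nil_iff]
  cases hw : n.toWord with
  | nil => rfl
  | cons a l =>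
    rw [hw] at this
    simp at this
    exact absurd (congrArg Prod.fst this.1).symm (h a.1)

section retr
variable {α : Type*}
open Classical in
/-- retraction to a sub-basis -/
noncomputable def retr (Y : Set α) : FreeGroup α →* FreeGroup α :=
  FreeGroup.lift (fun a => if a ∈ Y then FreeGroup.of a else 1)

abbrev FS (Y : Set α) : Subgroup (FreeGroup α) := Subgroup.closure (FreeGroup.of '' Y)

theorem of_mem_FS {Y : Set α} {i : α} (hi : i ∈ Y) : FreeGroup.of i ∈ FS Y :=
  Subgroup.subset_closure ⟨i, hi, rfl⟩

theorem retr_fix {Y : Set α} {x : FreeGroup α} (hx : x ∈ FS Y) : retr Y x = x := by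
  have : FS Y ≤ MonoidHom.eqLocus (retr Y) (MonoidHom.id _) := by
    rw [Subgroup.closure_le]
    rintro _ ⟨a, ha, rfl⟩
    show retr Y (FreeGroup.of a) = FreeGroup.of a
    simp [retr, ha]
  exact this hx

theorem retr_mem (Y : Set α) (x : FreeGroup α) : retr Y x ∈ FS Y := by
  have : (⊤ : Subgroup _) ≤ (FS Y).comap (retr Y) := by
    rw [← FreeGroup.closure_range_of, Subgroup.closure_le]
    rintro _ ⟨a, rfl⟩
    by_cases ha : a ∈ Y
    · have h0 : FreeGroup.of a ∈ FS Y := Subgroup.subset_closure ⟨a, ha, rfl⟩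
      simpa [retr, ha] using h0
    · simp [retr, ha]
  exact this trivial

theorem FS_disj {X Y : Set α} (h : Disjoint X Y) {x : FreeGroup α} (hX : x ∈ FS X) (hY : x ∈ FS Y) :
    x = 1 := by
  have : FS Y ≤ (retr X).ker := by
    rw [Subgroup.closure_le]
    rintro _ ⟨a, ha, rfl⟩
    have : a ∉ X := fun h' => Set.disjoint_left.1 h h' ha
    simp [retr, this, MonoidHom.mem_ker]
  rw [← retr_fix hX]
  exact this hY

theorem FS_conj_mem {Y : Set α} {g : FreeGroup α} {i : α} (h : g * FreeGroup.of i * g⁻¹ ∈ FS Y) : i ∈ Y := by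
  classical
  by_contra hi
  let f : FreeGroup α →* Multiplicative ℤ := FreeGroup.lift (fun a => if a = i then Multiplicative.ofAdd 1 else 1)
  have : FS Y ≤ f.ker := by
    rw [Subgroup.closure_le]
    rintro _ ⟨a, ha, rfl⟩
    have : a ≠ i := by rintro rfl; exact hi ha
    simp [f, this, MonoidHom.mem_ker]
  have h1 := this h
  rw [MonoidHom.mem_ker, map_mul, map_mul, mul_comm, map_inv, inv_mul_cancel_left] at h1
  simp [f] at h1
end retr

section T
variable {P : Type u} [Group P] {J : Type v}

/-- left multiplication on the first coordinate -/
def lmul (p : P) : (P × J) ≃ (P × J) := Equiv.prodCongr (Equiv.mulLeft p) (Equiv.refl J)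

def act (P : Type u) [Group P] (J : Type v) : P →* MulAut (FreeGroup (P × J)) where
  toFun p := FreeGroup.freeGroupCongr (lmul p)
  map_one' := by
    refine MulEquiv.ext fun a => ?_
    induction a using FreeGroup.induction_on with
    | C1 => simp
    | of a => rcases a with ⟨p, j⟩; simp [lmul]
    | inv_of a h => rw [map_inv, map_inv, h]
    | mul x y hx hy => rw [map_mul, map_mul, hx, hy]
  map_mul' p q := by
    refine MulEquiv.ext fun a => ?_
    induction a using FreeGroup.induction_on with
    | C1 => simp
    | of a => rcases a with ⟨p', j⟩; simp [lmul, mul_assoc]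
    | inv_of a h => rw [map_inv, map_inv, h]
    | mul x y hx hy => rw [map_mul, map_mul, hx, hy]

theorem act_of (p q : P) (j : J) : act P J p (FreeGroup.of (q, j)) = FreeGroup.of (p * q, j) := by
  simp [act, lmul]

theorem act_eq (p : P) (n : FreeGroup (P × J)) : act P J p n = FreeGroup.map (lmul p) n := rfl

/-- the free product of `P` with the free group on `J` -/
abbrev TT (P : Type u) [Group P] (J : Type v) := FreeGroup (P × J) ⋊[act P J] P

open SemidirectProduct

def ip : P →* TT P J := inr
def sj (j : J) : TT P J := inl (FreeGroup.of (1, j))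

theorem ip_inj : Function.Injective (ip : P →* TT P J) := inr_injective

theorem ip_conj (p : P) (n : FreeGroup (P × J)) : ip p * (inl n : TT P J) * (ip p)⁻¹ = inl (act P J p n) := by
  rw [ip, inl_aut]; simp

theorem inl_of (p : P) (j : J) : (inl (FreeGroup.of (p, j)) : TT P J) = ip p * sj j * (ip p)⁻¹ := by
  rw [sj, ip_conj, act_of, mul_one]

theorem act_fixed {x : P} (hx : x ≠ 1) {n : FreeGroup (P × J)} (hn : act P J x n = n) : n = 1 := by
  rw [act_eq] at hn
  refine fixed_word _ (lmul x).injective ?_ hn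
  rintro ⟨p, j⟩ h
  simp [lmul] at h
  exact hx h

def liftT {X : Type*} [Group X] (f : P →* X) (g : J → X) : TT P J →* X :=
  SemidirectProduct.lift (FreeGroup.lift (fun a : P × J => f a.1 * g a.2 * (f a.1)⁻¹)) f (by
    intro p
    ext a
    rcases a with ⟨q, j⟩
    simp [act_of, mul_assoc])

@[simp] theorem liftT_ip {X : Type*} [Group X] (f : P →* X) (g : J → X) (p : P) : liftT f g (ip p) = f p := by
  simp [liftT, ip]
@[simp] theorem liftT_sj {X : Type*} [Group X] (f : P →* X) (g : J → X) (j : J) : liftT f g (sj j) = g j := by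
  simp [liftT, sj]

theorem TT_ext {X : Type*} [Group X] {f g : TT P J →* X} (h1 : ∀ p, f (ip p) = g (ip p))
    (h2 : ∀ j, f (sj j) = g (sj j)) : f = g := by
  apply SemidirectProduct.hom_ext
  · ext a
    rcases a with ⟨p, j⟩
    simp [inl_of, h1, h2]
  · ext p; exact h1 p

theorem TT_gen (K : Subgroup (TT P J)) (h1 : ∀ p, ip p ∈ K) (h2 : ∀ j, sj j ∈ K) : K = ⊤ := by
  rw [eq_top_iff]
  rintro x -
  rw [← inl_left_mul_inr_right x]
  refine mul_mem ?_ (h1 _)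
  have : (⊤ : Subgroup _) ≤ K.comap inl := by
    rw [← FreeGroup.closure_range_of, Subgroup.closure_le]
    rintro _ ⟨⟨p, j⟩, rfl⟩
    show inl _ ∈ K
    rw [inl_of]
    exact mul_mem (mul_mem (h1 _) (h2 _)) (inv_mem (h1 _))
  exact this (Subgroup.mem_top x.left)

/-- the subgroup `F(Ω) ⋊ V` -/
def WW (V : Subgroup P) (O : Set (P × J)) (hO : ∀ v ∈ V, ∀ p j, (p, j) ∈ O → (v * p, j) ∈ O) :
    Subgroup (TT P J) where
  carrier := {t | t.left ∈ FS O ∧ t.right ∈ V}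
  one_mem' := ⟨one_mem _, one_mem _⟩
  mul_mem' := by
    have hinv : ∀ v ∈ V, ∀ n ∈ FS O, act P J v n ∈ FS O := by
      intro v hv
      have : FS O ≤ (FS O).comap (act P J v).toMonoidHom := by
        rw [Subgroup.closure_le]
        rintro _ ⟨⟨p, j⟩, ha, rfl⟩
        refine Subgroup.subset_closure ⟨_, hO v hv _ _ ha, (act_of _ _ _).symm⟩
      exact this
    rintro a b ⟨h1, h2⟩ ⟨h3, h4⟩
    exact ⟨mul_mem h1 (hinv _ h2 _ h3), mul_mem h2 h4⟩
  inv_mem' := by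
    have hinv : ∀ v ∈ V, ∀ n ∈ FS O, act P J v n ∈ FS O := by
      intro v hv
      have : FS O ≤ (FS O).comap (act P J v).toMonoidHom := by
        rw [Subgroup.closure_le]
        rintro _ ⟨⟨p, j⟩, ha, rfl⟩
        refine Subgroup.subset_closure ⟨_, hO v hv _ _ ha, (act_of _ _ _).symm⟩
      exact this
    rintro a ⟨h1, h2⟩
    exact ⟨hinv _ (inv_mem h2) _ (inv_mem h1), inv_mem h2⟩

theorem WW_conj (V : Subgroup P) (O : Set (P × J)) (hO : ∀ v ∈ V, ∀ p j, (p, j) ∈ O → (v * p, j) ∈ O)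
    {t : TT P J} {x : P} (hx : x ≠ 1) (ht : t * ip x * t⁻¹ ∈ WW V O hO) :
    ∃ w ∈ WW V O hO, ∃ p, t = w * ip p := by
  obtain ⟨h1, h2⟩ := ht
  set y := t.right * x * t.right⁻¹ with hy
  have h2' : y ∈ V := by simpa [ip] using h2
  have hy1 : y ≠ 1 := by
    rw [hy]; intro h; exact hx (by simpa using h)
  have h1' : t.left * (act P J y t.left)⁻¹ ∈ FS O := by
    convert h1 using 1
    rw [hy]
    simp [ip, mul_assoc]
  have hcomm : ∀ n, retr O (act P J y n) = act P J y (retr O n) := by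
    intro n
    have : (retr O).comp (act P J y).toMonoidHom = (act P J y).toMonoidHom.comp (retr O) := by
      ext ⟨p, j⟩
      have : (y * p, j) ∈ O ↔ (p, j) ∈ O := by
        refine ⟨fun h => ?_, hO y h2' p j⟩
        have := hO y⁻¹ (inv_mem h2') _ _ h
        simpa using this
      by_cases hp : (p, j) ∈ O
      · simp [act_of, retr, this, hp]
      · simp [act_of, retr, this, hp]
    exact DFunLike.congr_fun this n
  have h3 := retr_fix h1'
  rw [map_mul, map_inv, hcomm] at h3
  have h4 : (retr O t.left)⁻¹ * t.left = 1 := by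
    refine act_fixed hy1 ?_
    rw [map_mul, map_inv]
    have : retr O t.left = t.left * (act P J y t.left)⁻¹ * act P J y (retr O t.left) := by
      rw [← h3]; group
    conv_rhs => rw [this]
    group
  have h5 : t.left ∈ FS O := by
    have : t.left = retr O t.left := by
      rw [inv_mul_eq_one] at h4; exact h4.symm
    rw [this]; exact retr_mem _ _
  exact ⟨inl t.left, ⟨h5, one_mem _⟩, t.right, (inl_left_mul_inr_right t).symm⟩

theorem ip_mem_WW (V : Subgroup P) (O : Set (P × J)) (hO : ∀ v ∈ V, ∀ p j, (p, j) ∈ O → (v * p, j) ∈ O)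
    (p : P) : ip p ∈ WW V O hO ↔ p ∈ V :=
  ⟨fun h => h.2, fun h => ⟨one_mem _, h⟩⟩

theorem TT_mal {t : TT P J} {x : P} (hx : x ≠ 1) (ht : t * ip x * t⁻¹ ∈ (ip : P →* TT P J).range) :
    t ∈ (ip : P →* TT P J).range := by
  obtain ⟨q, hq⟩ := ht
  obtain ⟨w, hw, p, rfl⟩ := WW_conj (⊤ : Subgroup P) (∅ : Set (P × J)) (by simp) hx (t := t)
    (by rw [← hq, ip_mem_WW]; trivial)
  have : w.left = 1 := by have := hw.1; simpa [FS] using this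
  refine ⟨w.right * p, ?_⟩
  rw [← inl_left_mul_inr_right w, this]
  simp [ip]

/-- finite order elements of the free product -/
theorem TT_tors {t : TT P J} (ht : IsOfFinOrder t) : ∃ k, k * t * k⁻¹ ∈ (ip : P →* TT P J).range := by
  classical
  have main : ∀ N, ∀ t : TT P J, t.left.toWord.length = N → IsOfFinOrder t →
      ∃ k, k * t * k⁻¹ ∈ (ip : P →* TT P J).range := by
    intro N
    induction N using Nat.strong_induction_on with
    | _ N ih =>
    intro t htN ht
    obtain ⟨m, hm, hpow⟩ := isOfFinOrder_iff_pow_eq_one.1 ht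
    cases hw : t.left.toWord with
    | nil =>
      refine ⟨1, t.right, ?_⟩
      rw [toWord_eq_nil_iff] at hw
      rw [← inl_left_mul_inr_right t, hw]
      simp [ip]
    | cons a l =>
      -- the last letter
      by_cases hc : ∀ b ∈ t.left.toWord.getLast?, b.1 = lmul t.right a.1 → b.2 = a.2
      · exfalso
        have key : ∀ m, ((t^(m+1)).left.toWord).head? = some a := by
          intro m
          induction m with
          | zero => simp [hw]
          | succ m ihm =>
            rw [pow_succ', mul_left, toWord_mul, act_eq, toWord_map _ (lmul t.right).injective]
            have hred : FreeGroup.IsReduced (t.left.toWord ++ List.map (fun a => ((lmul t.right) a.1, a.2)) (t^(m+1)).left.toWord) := by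
              unfold FreeGroup.IsReduced
              rw [List.isChain_append]
              refine ⟨isReduced_toWord, ?_, ?_⟩
              · have := isReduced_toWord (x := act P J t.right (t^(m+1)).left)
                rwa [act_eq, toWord_map _ (lmul t.right).injective] at this
              · intro x hx y hy
                rw [List.head?_map, ihm] at hy
                simp at hy
                subst hy
                exact hc x hx
            rw [hred.reduce_eq, hw]
            simp
        have := key (m-1)
        rw [Nat.sub_add_cancel hm, hpow] at this
        simp at this
      · push Not at hc
        obtain ⟨b, hb, hb1, hb2⟩ := hc
        have hl : l ≠ [] := by
          rintro rfl
          rw [hw] at hb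
          simp at hb
          exact hb2 (by rw [hb])
        obtain ⟨u, rfl⟩ : ∃ u, l = u ++ [b] := by
          rw [hw, List.getLast?_cons] at hb
          refine ⟨l.dropLast, ?_⟩
          have h1 : l.getLast hl = b := by
            rw [List.getLast?_eq_some_getLast hl] at hb
            simpa using hb
          rw [← h1, List.dropLast_append_getLast]
        have hb' : b = (lmul t.right a.1, !a.2) := by
          apply Prod.ext hb1
          cases h1 : b.2 <;> cases h2 : a.2 <;> simp_all
        set g : FreeGroup (P × J) := FreeGroup.mk [a] with hg
        have hleft : t.left = g * FreeGroup.mk u * (act P J t.right g)⁻¹ := by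
          rw [← mk_toWord (x := t.left), hw, hb', act_eq, hg]
          simp [FreeGroup.map.mk, FreeGroup.inv_mk, FreeGroup.invRev, FreeGroup.mul_mk]
        have hconj : (inl g)⁻¹ * t * (inl g)⁻¹⁻¹ = (inl (FreeGroup.mk u) * inr t.right : TT P J) := by
          have e1 : t = inl t.left * inr t.right := (inl_left_mul_inr_right t).symm
          have e2 : (inl (act P J t.right g) : TT P J) = inr t.right * inl g * (inr t.right)⁻¹ := (ip_conj _ _).symm
          rw [inv_inv]
          conv_lhs => rw [e1, hleft]
          rw [map_mul, map_mul, map_inv, e2]; group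
        have hlen : ((inl (FreeGroup.mk u) * inr t.right : TT P J)).left.toWord.length < N := by
          rw [← htN, hw]
          have : (inl (FreeGroup.mk u) * inr t.right : TT P J).left = FreeGroup.mk u := by simp
          rw [this]
          refine lt_of_le_of_lt (norm_mk_le) ?_
          simp
        obtain ⟨k, hk⟩ := ih _ hlen _ rfl (by
          rw [← hconj]
          exact isOfFinOrder_iff_pow_eq_one.2 ⟨m, hm, by rw [conj_pow, hpow]; simp⟩)
        refine ⟨k * (inl g)⁻¹, ?_⟩
        rw [← hconj] at hk
        convert hk using 1; group
  exact main _ t rfl ht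
end T

theorem FS_conj {α : Type*} {Y : Set α} {g : FreeGroup α} {i : α}
    (h : g * FreeGroup.of i * g⁻¹ ∈ FS Y) : g ∈ FS Y := by
  classical
  have hi := FS_conj_mem h
  let L : FreeGroup α →* TT (Multiplicative ℤ) α :=
    FreeGroup.lift (fun j => if j = i then ip (Multiplicative.ofAdd 1) else sj j)
  let M : TT (Multiplicative ℤ) α →* FreeGroup α := liftT (zpowersHom _ (FreeGroup.of i)) (fun j => FreeGroup.of j)
  have hML : ∀ x, M (L x) = x := by
    intro x
    have : M.comp L = MonoidHom.id _ := by
      ext j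
      by_cases hj : j = i
      · simp [L, M, hj]
      · simp [L, M, hj]
    exact DFunLike.congr_fun this x
  let W := WW (⊤ : Subgroup (Multiplicative ℤ)) ({a | a.2 ∈ Y} : Set (Multiplicative ℤ × α)) (by simp)
  have hLW : FS Y ≤ W.comap L := by
    rw [Subgroup.closure_le]
    rintro _ ⟨a, ha, rfl⟩
    by_cases hj : a = i
    · simp [L, hj, W, ip_mem_WW]
    · have : sj a ∈ W := ⟨Subgroup.subset_closure ⟨(1, a), ha, rfl⟩, trivial⟩
      simpa [L, hj] using this
  have hMW : W ≤ (FS Y).comap M := by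
    intro t ht
    rw [← SemidirectProduct.inl_left_mul_inr_right t]
    refine mul_mem ?_ ?_
    · have : FS ({a | a.2 ∈ Y} : Set (Multiplicative ℤ × α)) ≤ ((FS Y).comap M).comap SemidirectProduct.inl := by
        rw [Subgroup.closure_le]
        rintro _ ⟨⟨p, j⟩, ha, rfl⟩
        show SemidirectProduct.inl (FreeGroup.of (p, j)) ∈ (FS Y).comap M
        rw [inl_of, Subgroup.mem_comap, map_mul, map_mul, map_inv]
        have h1 : M (ip p) ∈ FS Y := by
          simp only [M, liftT_ip]
          exact zpow_mem (of_mem_FS hi) _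
        refine mul_mem (mul_mem h1 ?_) (inv_mem h1)
        simp only [M, liftT_sj]
        exact Subgroup.subset_closure ⟨j, ha, rfl⟩
      exact this ht.1
    · show M (ip t.right) ∈ FS Y
      simp only [M, liftT_ip]
      exact zpow_mem (of_mem_FS hi) _
  have h1 : L g * ip (Multiplicative.ofAdd 1) * (L g)⁻¹ ∈ W := by
    have := hLW h
    simpa [L] using this
  obtain ⟨w, hw, p, h2⟩ := WW_conj _ _ _ (by decide) h1
  have h3 : L g ∈ W := by
    rw [h2]; exact mul_mem hw ((ip_mem_WW _ _ _ _).2 trivial)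
  have := hMW h3
  rwa [Subgroup.mem_comap, hML] at this

end Free
end EmbThm

namespace EmbThm
universe u v
section Stage
variable {B : Type u} [Group B] {ix : Type u}

/-- the free subgroup on the indices `X` -/
abbrev RX {P : Type*} [Group P] (D : FreeGroup ix →* P) (X : Set ix) : Subgroup P := (FS X).map D

structure Good {P : Type*} [Group P] (Gs : Subgroup B) (D : FreeGroup ix →* B) (ι : B →* P) (X : Set ix) : Prop where
  inj : Function.Injective ι
  injD : Function.Injective D
  tors : ∀ h : P, IsOfFinOrder h → ∃ k, k * h * k⁻¹ ∈ ι.range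
  tmal : ∀ b : B, IsOfFinOrder b → b ≠ 1 → ∀ h, h * ι b * h⁻¹ ∈ ι.range → h ∈ ι.range
  gmal : ∀ g ∈ Gs, g ≠ 1 → ∀ h, h * ι g * h⁻¹ ∈ Gs.map ι → h ∈ Gs.map ι
  gsep : ∀ g ∈ Gs, g ≠ 1 → ∀ t, t * ι g * t⁻¹ ∉ RX (ι.comp D) X
  pm : ∀ u : Fin 3 → ix, Function.Injective u → (∀ k, u k ∈ X) → ∀ t,
    (∀ k, t * ι (D (FreeGroup.of (u k))) * t⁻¹ ∈ RX (ι.comp D) X) → t ∈ RX (ι.comp D) X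

def Prot {P : Type*} [Group P] (D : FreeGroup ix →* P) (X : Set ix) (S : Fin 3 → P) : Prop :=
  (∀ t, (∀ k, t * S k * t⁻¹ = S k) → t = 1) ∧ ∀ t, ¬ ∀ k, t * S k * t⁻¹ ∈ RX D X

theorem RX_mono {P : Type*} [Group P] (D : FreeGroup ix →* P) {X Y : Set ix} (h : X ⊆ Y) : RX D X ≤ RX D Y :=
  Subgroup.map_mono (Subgroup.closure_mono (Set.image_mono h))

theorem Prot.mono {P : Type*} [Group P] {D : FreeGroup ix →* P} {X Y : Set ix} {S : Fin 3 → P}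
    (h : Prot D X S) (hXY : Y ⊆ X) : Prot D Y S :=
  ⟨h.1, fun t ht => h.2 t fun k => RX_mono D hXY (ht k)⟩

theorem Prot.ne {P : Type*} [Group P] {D : FreeGroup ix →* P} {X : Set ix} {S : Fin 3 → P}
    (h : Prot D X S) : ∃ k, S k ≠ 1 := by
  by_contra hc
  push Not at hc
  exact h.2 1 fun k => by rw [hc]; simp

variable {Gs : Subgroup B} {D : FreeGroup ix →* B} {P : Type v} [Group P] {ι : B →* P} {X : Set ix}

theorem mem_RX_of {Y : Set ix} (hD : Function.Injective D) (hι : Function.Injective ι) {g : FreeGroup ix}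
    (h : ι (D g) ∈ RX (ι.comp D) Y) : g ∈ FS Y := by
  obtain ⟨x, hx, e⟩ := h
  have := hD (hι e)
  rwa [← this]

theorem Good.pm' (h : Good Gs D ι X) {Y : Set ix} (hY : Y ⊆ X) {u : Fin 3 → ix} (hu : Function.Injective u)
    (huX : ∀ k, u k ∈ X) {t : P} (ht : ∀ k, t * ι (D (FreeGroup.of (u k))) * t⁻¹ ∈ RX (ι.comp D) Y) :
    t ∈ RX (ι.comp D) Y ∧ ∀ k, u k ∈ Y := by
  obtain ⟨g, hg, rfl⟩ := h.pm u hu huX t fun k => RX_mono _ hY (ht k)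
  have : ∀ k, g * FreeGroup.of (u k) * g⁻¹ ∈ FS Y := by
    intro k
    apply mem_RX_of h.injD h.inj
    simpa using ht k
  exact ⟨⟨g, FS_conj (this 0), rfl⟩, fun k => FS_conj_mem (this k)⟩

theorem Good.mono (h : Good Gs D ι X) {Y : Set ix} (hY : Y ⊆ X) : Good Gs D ι Y where
  inj := h.inj
  injD := h.injD
  tors := h.tors
  tmal := h.tmal
  gmal := h.gmal
  gsep g hg hg1 t ht := h.gsep g hg hg1 t (RX_mono _ hY ht)
  pm u hu huY t ht := (h.pm' hY hu (fun k => hY (huY k)) ht).1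

theorem Good.one_ne (h : Good Gs D ι X) (i : ix) : ι (D (FreeGroup.of i)) ≠ 1 := by
  intro e
  have : D (FreeGroup.of i) = 1 := h.inj (by rw [e, map_one])
  have : FreeGroup.of i = 1 := h.injD (by rw [this, map_one])
  exact FreeGroup.of_ne_one i this

/-- no power of a triple of letters is centralised -/
theorem Good.cent (h : Good Gs D ι X) {u : Fin 3 → ix} (hu : Function.Injective u)
    (huX : ∀ k, u k ∈ X) {t : P} (ht : ∀ k, t * ι (D (FreeGroup.of (u k))) * t⁻¹ = ι (D (FreeGroup.of (u k)))) :
    t = 1 := by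
  obtain ⟨g, hg, rfl⟩ := h.pm u hu huX t fun k => by
    rw [ht]; exact ⟨_, of_mem_FS (huX k), rfl⟩
  have : ∀ k, g * FreeGroup.of (u k) * g⁻¹ = FreeGroup.of (u k) := by
    intro k
    apply h.injD; apply h.inj
    simpa using ht k
  have h2 : ∀ k, g ∈ FS {u k} := fun k => FS_conj (i := u k) (by rw [this]; exact of_mem_FS rfl)
  have : g = 1 := FS_disj (X := {u 0}) (Y := {u 1}) (by
    rw [Set.disjoint_singleton]; intro e; have := hu e; simp at this) (h2 0) (h2 1)
  simp [this]

section TTstep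
variable {J : Type*}

theorem RX_ip (Y : Set ix) : RX (((ip : P →* TT P J).comp ι).comp D) Y = (RX (ι.comp D) Y).map ip := by
  rw [Subgroup.map_map]; rfl

theorem ip_mem_map {K : Subgroup P} {p : P} : (ip p : TT P J) ∈ K.map ip ↔ p ∈ K := by
  constructor
  · rintro ⟨q, hq, e⟩
    rw [← ip_inj e]; exact hq
  · intro h; exact ⟨p, h, rfl⟩

theorem TT_red {κ : Type*} {S : κ → P} {k₀ : κ} (h0 : S k₀ ≠ 1) {K : Subgroup P} {t : TT P J}
    (ht : ∀ k, t * ip (S k) * t⁻¹ ∈ K.map ip) : ∃ p, t = ip p ∧ ∀ k, p * S k * p⁻¹ ∈ K := by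
  obtain ⟨p, rfl⟩ := TT_mal h0 (t := t) (by obtain ⟨q, _, e⟩ := ht k₀; exact ⟨q, e⟩)
  refine ⟨p, rfl, fun k => ?_⟩
  have := ht k
  rwa [← map_mul, ← map_inv, ← map_mul, ip_mem_map] at this

theorem Good.TT (h : Good Gs D ι X) : Good Gs D ((ip : P →* TT P J).comp ι) X where
  inj := ip_inj.comp h.inj
  injD := h.injD
  tors t ht := by
    obtain ⟨k, p, hp⟩ := TT_tors ht
    have : IsOfFinOrder p := by
      have h1 : IsOfFinOrder (k * t * k⁻¹) := by
        obtain ⟨n, hn, h⟩ := isOfFinOrder_iff_pow_eq_one.1 ht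
        exact isOfFinOrder_iff_pow_eq_one.2 ⟨n, hn, by rw [conj_pow, h]; simp⟩
      rw [← hp] at h1
      exact ip_inj.isOfFinOrder_iff.1 h1
    obtain ⟨q, b, hb⟩ := h.tors p this
    refine ⟨ip q * k, b, ?_⟩
    simp only [MonoidHom.comp_apply, hb, map_mul, map_inv, hp]
    group
  tmal b hb hb1 t ht := by
    have hne : ι b ≠ 1 := fun e => hb1 (h.inj (by rw [e, map_one]))
    rw [MonoidHom.range_comp] at ht ⊢
    obtain ⟨p, rfl, hp⟩ := TT_red (S := fun _ : Unit => ι b) (k₀ := ()) hne (fun _ => ht)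
    exact ⟨p, h.tmal b hb hb1 p (hp ()), rfl⟩
  gmal g hg hg1 t ht := by
    have hne : ι g ≠ 1 := fun e => hg1 (h.inj (by rw [e, map_one]))
    rw [← Subgroup.map_map] at ht ⊢
    obtain ⟨p, rfl, hp⟩ := TT_red (S := fun _ : Unit => ι g) (k₀ := ()) hne (fun _ => ht)
    exact ⟨p, h.gmal g hg hg1 p (hp ()), rfl⟩
  gsep g hg hg1 t ht := by
    have hne : ι g ≠ 1 := fun e => hg1 (h.inj (by rw [e, map_one]))
    rw [RX_ip] at ht
    obtain ⟨p, rfl, hp⟩ := TT_red (S := fun _ : Unit => ι g) (k₀ := ()) hne (fun _ => ht)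
    exact h.gsep g hg hg1 p (hp ())
  pm u hu huX t ht := by
    rw [RX_ip] at ht ⊢
    obtain ⟨p, rfl, hp⟩ := TT_red (S := fun k => ι (D (FreeGroup.of (u k)))) (k₀ := 0) (h.one_ne _) ht
    exact ⟨p, h.pm u hu huX p hp, rfl⟩

theorem Prot.TT {S : Fin 3 → P} (h : Prot (ι.comp D) X S) :
    Prot (((ip : P →* TT P J).comp ι).comp D) X (fun k => ip (S k)) := by
  obtain ⟨k₀, hk⟩ := h.ne
  constructor
  · intro t ht
    obtain ⟨p, rfl, hp⟩ := TT_red (K := ⊤) hk (fun k => by rw [ht]; exact ⟨_, trivial, rfl⟩)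
    have : p = 1 := h.1 p fun k => ip_inj (J := J) (by simpa using ht k)
    rw [this, map_one]
  · intro t ht
    rw [RX_ip] at ht
    obtain ⟨p, rfl, hp⟩ := TT_red hk ht
    exact h.2 p hp
end TTstep

section HNNstep
variable {P' : Type*} [Group P'] {f : P →* P'} {U W : Subgroup P} {r : P'}

theorem mem_map_inj (hf : Function.Injective f) {K : Subgroup P} {p : P} : f p ∈ K.map f ↔ p ∈ K := by
  constructor
  · rintro ⟨q, hq, e⟩
    rw [← hf e]; exact hq
  · intro h; exact ⟨p, h, rfl⟩

theorem hnn_mal (hf : Function.Injective f) (hH : IsHNN f.range (U.map f) (W.map f) r) {κ : Type*} {S : κ → P}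
    (hU : ∀ t, ¬ ∀ k, t * S k * t⁻¹ ∈ U) (hW : ∀ t, ¬ ∀ k, t * S k * t⁻¹ ∈ W) {h : P'} {K : Subgroup P}
    (hh : ∀ k, h * f (S k) * h⁻¹ ∈ K.map f) : ∃ t, h = f t ∧ ∀ k, t * S k * t⁻¹ ∈ K := by
  have hr : ∀ K : Subgroup P, ∀ t, (∀ k, f t * f (S k) * (f t)⁻¹ ∈ K.map f) → ∀ k, t * S k * t⁻¹ ∈ K := by
    intro K t ht k
    have := ht k
    rwa [← map_mul, ← map_inv, ← map_mul, mem_map_inj hf] at this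
  have : h ∈ f.range := by
    by_contra hc
    obtain ⟨_, ⟨t, rfl⟩, h1 | h1⟩ := hH.mal (S := fun k => f (S k)) (fun k => ⟨_, rfl⟩)
      (fun k => by obtain ⟨q, _, e⟩ := hh k; exact ⟨q, e⟩) hc
    · exact hU t (hr U t h1)
    · exact hW t (hr W t h1)
  obtain ⟨t, rfl⟩ := this
  exact ⟨t, rfl, hr K t hh⟩

/-- hypotheses for one HNN step -/
structure Step (Gs : Subgroup B) (D : FreeGroup ix →* B) (ι : B →* P) (X Y₀ Y₁ : Set ix) (W : Subgroup P) : Prop where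
  good : Good Gs D ι X
  sub0 : Y₀ ⊆ X
  sub1 : Y₁ ⊆ X
  disj : Disjoint Y₀ Y₁
  wtf : ∀ w ∈ W, IsOfFinOrder w → w = 1
  wA : ∀ g ∈ Gs, g ≠ 1 → ∀ t, t * ι g * t⁻¹ ∉ W
  wB : ∀ u : Fin 3 → ix, Function.Injective u → (∀ k, u k ∈ X \ Y₀) → ∀ t, ¬ ∀ k, t * ι (D (FreeGroup.of (u k))) * t⁻¹ ∈ W

theorem RX_tf {Y : Set ix} (hD : Function.Injective D) (hι : Function.Injective ι) {w : P} (hw : w ∈ RX (ι.comp D) Y)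
    (hfin : IsOfFinOrder w) : w = 1 := by
  obtain ⟨x, _, rfl⟩ := hw
  have : IsOfFinOrder x := (Function.Injective.isOfFinOrder_iff (f := ι.comp D) (hι.comp hD)).1 hfin
  rw [(isOfFinOrder_iff_eq_one _).1 this, map_one]

theorem fin_conj {Q : Type*} [Group Q] {x : Q} (h : IsOfFinOrder x) (t : Q) : IsOfFinOrder (t * x * t⁻¹) := by
  obtain ⟨n, hn, h⟩ := isOfFinOrder_iff_pow_eq_one.1 h
  exact isOfFinOrder_iff_pow_eq_one.2 ⟨n, hn, by rw [conj_pow, h]; simp⟩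

theorem conj_ne {Q : Type*} [Group Q] {x : Q} (h : x ≠ 1) (t : Q) : t * x * t⁻¹ ≠ 1 := by
  simpa using h

theorem RX_f (Y : Set ix) : RX ((f.comp ι).comp D) Y = (RX (ι.comp D) Y).map f := by
  rw [Subgroup.map_map]; rfl

variable {Y₀ Y₁ : Set ix}

theorem Step.goodZ (h : Step Gs D ι X Y₀ Y₁ W) (hf : Function.Injective f)
    (hH : IsHNN f.range ((RX (ι.comp D) Y₁).map f) (W.map f) r) : Good Gs D (f.comp ι) (X \ (Y₀ ∪ Y₁)) where
  inj := hf.comp h.good.inj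
  injD := h.good.injD
  tors t ht := by
    obtain ⟨k, p, hp⟩ := hH.tors ht
    have : IsOfFinOrder p := by
      have h1 := fin_conj ht k
      rw [← hp] at h1
      exact hf.isOfFinOrder_iff.1 h1
    obtain ⟨q, b, hb⟩ := h.good.tors p this
    refine ⟨f q * k, b, ?_⟩
    simp only [MonoidHom.comp_apply, hb, map_mul, map_inv, hp]
    group
  tmal b hb hb1 t ht := by
    have hne : ι b ≠ 1 := fun e => hb1 (h.good.inj (by rw [e, map_one]))
    have hbf : IsOfFinOrder (ι b) := h.good.inj.isOfFinOrder_iff.2 hb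
    rw [MonoidHom.range_comp] at ht ⊢
    obtain ⟨p, rfl, hp⟩ := hnn_mal hf hH (S := fun _ : Unit => ι b)
      (fun t ht => conj_ne hne t (RX_tf h.good.injD h.good.inj (ht ()) (fin_conj hbf t)))
      (fun t ht => conj_ne hne t (h.wtf _ (ht ()) (fin_conj hbf t))) (fun _ => ht)
    exact ⟨p, h.good.tmal b hb hb1 p (hp ()), rfl⟩
  gmal g hg hg1 t ht := by
    rw [← Subgroup.map_map] at ht ⊢
    obtain ⟨p, rfl, hp⟩ := hnn_mal hf hH (S := fun _ : Unit => ι g)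
      (fun t ht => h.good.gsep g hg hg1 t (RX_mono _ h.sub1 (ht ())))
      (fun t ht => h.wA g hg hg1 t (ht ())) (fun _ => ht)
    exact ⟨p, h.good.gmal g hg hg1 p (hp ()), rfl⟩
  gsep g hg hg1 t ht := by
    rw [RX_f] at ht
    obtain ⟨p, rfl, hp⟩ := hnn_mal hf hH (S := fun _ : Unit => ι g)
      (fun t ht => h.good.gsep g hg hg1 t (RX_mono _ h.sub1 (ht ())))
      (fun t ht => h.wA g hg hg1 t (ht ())) (fun _ => ht)
    exact h.good.gsep g hg hg1 p (RX_mono _ Set.sdiff_subset (hp ()))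
  pm u hu huX t ht := by
    rw [RX_f] at ht ⊢
    obtain ⟨p, rfl, hp⟩ := hnn_mal hf hH (S := fun k => ι (D (FreeGroup.of (u k))))
      (fun t ht => (huX 0).2 (Or.inr ((h.good.pm' h.sub1 hu (fun k => (huX k).1) ht).2 0)))
      (fun t ht => h.wB u hu (fun k => ⟨(huX k).1, fun hh => (huX k).2 (Or.inl hh)⟩) t ht) ht
    exact ⟨p, (h.good.pm' Set.sdiff_subset hu (fun k => (huX k).1) hp).1, rfl⟩

theorem Step.prot (h : Step Gs D ι X Y₀ Y₁ W) (hf : Function.Injective f)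
    (hH : IsHNN f.range ((RX (ι.comp D) Y₁).map f) (W.map f) r) {S : Fin 3 → P} (hS : Prot (ι.comp D) X S)
    (hSW : ∀ t, ¬ ∀ k, t * S k * t⁻¹ ∈ W) : Prot ((f.comp ι).comp D) (X \ (Y₀ ∪ Y₁)) (fun k => f (S k)) := by
  constructor
  · intro t ht
    obtain ⟨p, rfl, hp⟩ := hnn_mal hf hH (K := ⊤) (fun t ht => hS.2 t fun k => RX_mono _ h.sub1 (ht k)) hSW
      (fun k => by rw [ht]; exact ⟨_, trivial, rfl⟩)
    have : p = 1 := hS.1 p fun k => hf (by simpa using ht k)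
    rw [this, map_one]
  · intro t ht
    rw [RX_f] at ht
    obtain ⟨p, rfl, hp⟩ := hnn_mal hf hH (fun t ht => hS.2 t fun k => RX_mono _ h.sub1 (ht k)) hSW ht
    exact hS.2 p fun k => RX_mono _ Set.sdiff_subset (hp k)

/-- the anchors -/
theorem Step.anchor (h : Step Gs D ι X Y₀ Y₁ W) (hf : Function.Injective f)
    (hH : IsHNN f.range ((RX (ι.comp D) Y₁).map f) (W.map f) r) {u w : Fin 3 → ix}
    (hu : Function.Injective u) (hw : Function.Injective w)
    (huY : ∀ k, u k ∈ Y₁) (hwY : ∀ k, w k ∈ Y₀)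
    (hr : ∀ k, r * f (ι (D (FreeGroup.of (u k)))) * r⁻¹ = f (ι (D (FreeGroup.of (w k)))))
    (hC : ∀ t, (∀ k, t * ι (D (FreeGroup.of (w k))) * t⁻¹ ∈ W) → t ∈ W) {t : P'} {K : Subgroup P}
    (ht : ∀ k, t * f (ι (D (FreeGroup.of (u k)))) * t⁻¹ ∈ K.map f) :
    (∃ p, t = f p ∧ ∀ k, p * ι (D (FreeGroup.of (u k))) * p⁻¹ ∈ K) ∨
    (∃ p, t = f p * r ∧ ∀ k, p * ι (D (FreeGroup.of (w k))) * p⁻¹ ∈ K) := by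
  have conv : ∀ (K : Subgroup P) (S : Fin 3 → ix) t, (∀ k, f t * f (ι (D (FreeGroup.of (S k)))) * (f t)⁻¹ ∈ K.map f) →
      ∀ k, t * ι (D (FreeGroup.of (S k))) * t⁻¹ ∈ K := by
    intro K S t ht k
    have := ht k
    rwa [← map_mul, ← map_inv, ← map_mul, mem_map_inj hf] at this
  have hdis : ∀ {i}, i ∈ Y₀ → i ∈ Y₁ → False := fun h0 h1 => Set.disjoint_left.1 h.disj h0 h1
  have key : t ∈ f.range ∨ ∃ p ∈ f.range, t = p * r := by
    refine hH.anchor (D := fun k => f (ι (D (FreeGroup.of (u k))))) (fun k => ⟨_, rfl⟩) hr ?_ ?_ ?_ ?_ (h := t) ?_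
    · rintro _ ⟨p, rfl⟩ hp
      exact ⟨p, (h.good.pm' h.sub1 hu (fun k => h.sub1 (huY k)) (conv _ u p hp)).1, rfl⟩
    · rintro _ ⟨p, rfl⟩ hp
      exact h.wB u hu (fun k => ⟨h.sub1 (huY k), fun h' => hdis h' (huY k)⟩) p (conv _ u p hp)
    · rintro _ ⟨p, rfl⟩ hp
      exact ⟨p, hC p (conv _ w p hp), rfl⟩
    · rintro _ ⟨p, rfl⟩ hp
      exact hdis (hwY 0) ((h.good.pm' h.sub1 hw (fun k => h.sub0 (hwY k)) (conv _ w p hp)).2 0)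
    · intro k
      obtain ⟨q, _, e⟩ := ht k
      exact ⟨q, e⟩
  rcases key with h1 | h1
  · obtain ⟨p, rfl⟩ := h1
    exact Or.inl ⟨p, rfl, conv K u p ht⟩
  · obtain ⟨_, ⟨p, rfl⟩, rfl⟩ := h1
    refine Or.inr ⟨p, rfl, conv K w p fun k => ?_⟩
    have := ht k
    rw [← hr]
    convert this using 1; group

theorem Step.prot_anchor (h : Step Gs D ι X Y₀ Y₁ W) (hf : Function.Injective f)
    (hH : IsHNN f.range ((RX (ι.comp D) Y₁).map f) (W.map f) r) {u w : Fin 3 → ix}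
    (hu : Function.Injective u) (hw : Function.Injective w)
    (huY : ∀ k, u k ∈ Y₁) (hwY : ∀ k, w k ∈ Y₀)
    (hr : ∀ k, r * f (ι (D (FreeGroup.of (u k)))) * r⁻¹ = f (ι (D (FreeGroup.of (w k)))))
    (hC : ∀ t, (∀ k, t * ι (D (FreeGroup.of (w k))) * t⁻¹ ∈ W) → t ∈ W) :
    Prot ((f.comp ι).comp D) (X \ (Y₀ ∪ Y₁)) (fun k => f (ι (D (FreeGroup.of (u k))))) := by
  have hdis : ∀ {i}, i ∈ Y₀ → i ∈ Y₁ → False := fun h0 h1 => Set.disjoint_left.1 h.disj h0 h1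
  constructor
  · intro t ht
    rcases h.anchor hf hH hu hw huY hwY hr hC (K := RX (ι.comp D) Y₁) (t := t) (fun k => by
      rw [ht]; exact ⟨_, ⟨_, of_mem_FS (huY k), rfl⟩, rfl⟩) with ⟨p, rfl, hp⟩ | ⟨p, rfl, hp⟩
    · have : p = 1 := h.good.cent hu (fun k => h.sub1 (huY k)) fun k => hf (by simpa using ht k)
      rw [this, map_one]
    · exact (hdis (hwY 0) ((h.good.pm' h.sub1 hw (fun k => h.sub0 (hwY k)) hp).2 0)).elim
  · intro t ht
    rw [RX_f] at ht
    rcases h.anchor hf hH hu hw huY hwY hr hC ht with ⟨p, rfl, hp⟩ | ⟨p, rfl, hp⟩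
    · exact ((h.good.pm' Set.sdiff_subset hu (fun k => h.sub1 (huY k)) hp).2 0).2 (Or.inr (huY 0))
    · exact ((h.good.pm' Set.sdiff_subset hw (fun k => h.sub0 (hwY k)) hp).2 0).2 (Or.inl (hwY 0))
end HNNstep
end Stage
end EmbThm

namespace EmbThm
universe u v
section Wb
variable {P : Type u} [Group P] {J : Type v}
open SemidirectProduct

structure WP (V : Subgroup P) (W : Subgroup (TT P J)) : Prop where
  conj : ∀ x : P, x ≠ 1 → ∀ t, t * ip x * t⁻¹ ∈ W → ∃ y ∈ W, ∃ p, t = y * ip p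
  mem : ∀ p, ip p ∈ W ↔ p ∈ V

theorem WP.fam {V : Subgroup P} {W : Subgroup (TT P J)} (h : WP V W) {κ : Type*} {S : κ → P} {k₀ : κ} (h0 : S k₀ ≠ 1)
    {t : TT P J} (ht : ∀ k, t * ip (S k) * t⁻¹ ∈ W) : ∃ y ∈ W, ∃ p, t = y * ip p ∧ ∀ k, p * S k * p⁻¹ ∈ V := by
  obtain ⟨y, hy, p, rfl⟩ := h.conj _ h0 t (ht k₀)
  refine ⟨y, hy, p, rfl, fun k => ?_⟩
  rw [← h.mem]
  have := mul_mem (mul_mem (inv_mem hy) (ht k)) hy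
  convert this using 1
  simp only [map_mul, map_inv]; group

theorem WP.of_map {V : Subgroup P} {W : Subgroup (TT P J)} (h : WP V W) (α : TT P J ≃* TT P J) (hα : ∀ p, α (ip p) = ip p) :
    WP V (W.map α.toMonoidHom) where
  conj x hx t ht := by
    obtain ⟨s, rfl⟩ := α.surjective t
    obtain ⟨w, hw, e⟩ := ht
    have e' : α w = α (s * ip x * s⁻¹) := by
      simpa [hα] using e
    have := α.injective e'
    obtain ⟨y, hy, p, rfl⟩ := h.conj x hx s (this ▸ hw)
    exact ⟨α y, ⟨y, hy, rfl⟩, p, by rw [map_mul, hα]⟩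
  mem p := by
    rw [← h.mem]
    constructor
    · rintro ⟨w, hw, e⟩
      have : w = ip p := α.injective (by rw [hα]; exact e)
      rwa [← this]
    · intro hp
      exact ⟨_, hp, hα p⟩

section basis
variable {K : Type*} {L : Type*} (ψ : FreeGroup K →* P) (al : L → P) (jl : L → J)

def mm : FreeGroup K × L → P × J := fun x => (ψ x.1 * al x.2, jl x.2)

def Th : TT (FreeGroup K) L →* TT P J :=
  liftT (ip.comp ψ) (fun l => ip (al l) * sj (jl l) * (ip (al l))⁻¹)

theorem Th_inl (n : FreeGroup (FreeGroup K × L)) : Th ψ al jl (inl n) = inl (FreeGroup.map (mm ψ al jl) n) := by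
  have : (Th ψ al jl).comp inl = inl.comp (FreeGroup.map (mm ψ al jl)) := by
    refine FreeGroup.ext_hom _ _ ?_
    rintro ⟨q, l⟩
    simp [inl_of, Th, mm, mul_assoc]
  exact DFunLike.congr_fun this n

theorem Th_eq (t : TT (FreeGroup K) L) : Th ψ al jl t = inl (FreeGroup.map (mm ψ al jl) t.left) * ip (ψ t.right) := by
  conv_lhs => rw [← inl_left_mul_inr_right t]
  rw [map_mul, Th_inl]
  congr 1
  exact liftT_ip _ _ _

def La : FreeGroup (K ⊕ L) →* TT (FreeGroup K) L :=
  FreeGroup.lift (Sum.elim (fun k => ip (FreeGroup.of k)) (fun l => sj l))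

def e0 : FreeGroup (K ⊕ L) →* TT P J := (Th ψ al jl).comp La

theorem e0_inl (k : K) : e0 ψ al jl (FreeGroup.of (Sum.inl k)) = ip (ψ (FreeGroup.of k)) := by
  simp [e0, La, Th]
theorem e0_inr (l : L) : e0 ψ al jl (FreeGroup.of (Sum.inr l)) = ip (al l) * sj (jl l) * (ip (al l))⁻¹ := by
  simp [e0, La, Th]

theorem La_inj : Function.Injective (La : FreeGroup (K ⊕ L) →* _) := by
  let M : TT (FreeGroup K) L →* FreeGroup (K ⊕ L) :=
    liftT (FreeGroup.map Sum.inl) (fun l => FreeGroup.of (Sum.inr l))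
  have : M.comp La = MonoidHom.id _ := by
    ext (k | l)
    · simp [M, La]
    · simp [M, La]
  exact Function.LeftInverse.injective (g := M) fun x => DFunLike.congr_fun this x

theorem La_surj : (La : FreeGroup (K ⊕ L) →* _).range = ⊤ := by
  apply TT_gen
  · intro p
    have : (⊤ : Subgroup (FreeGroup K)) ≤ (La : FreeGroup (K ⊕ L) →* _).range.comap ip := by
      rw [← FreeGroup.closure_range_of, Subgroup.closure_le]
      rintro _ ⟨k, rfl⟩
      exact ⟨FreeGroup.of (Sum.inl k), by simp [La]⟩
    exact this trivial
  · intro l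
    exact ⟨FreeGroup.of (Sum.inr l), by simp [La]⟩

variable {ψ al jl}

theorem e0_inj (hψ : Function.Injective ψ) (hm : Function.Injective (mm ψ al jl)) : Function.Injective (e0 ψ al jl) := by
  refine Function.Injective.comp (g := Th ψ al jl) ?_ La_inj
  rw [injective_iff_map_eq_one]
  intro t ht
  rw [Th_eq] at ht
  have h1 := congrArg SemidirectProduct.left ht
  have h2 := congrArg SemidirectProduct.right ht
  simp [ip] at h1 h2
  have h1' : t.left = 1 := FreeGroup.map_injective hm (by rw [h1, map_one])
  have h2' : t.right = 1 := hψ (by rw [h2, map_one])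
  exact SemidirectProduct.ext h1' h2'

theorem e0_WP (hψ : Function.Injective ψ) : WP ψ.range (e0 ψ al jl).range := by
  have hO : ∀ v ∈ ψ.range, ∀ p j, (p, j) ∈ Set.range (mm ψ al jl) → (v * p, j) ∈ Set.range (mm ψ al jl) := by
    rintro _ ⟨q, rfl⟩ p j ⟨⟨q', l⟩, e⟩
    refine ⟨(q * q', l), ?_⟩
    simp [mm] at e ⊢
    rw [← e.1, mul_assoc]
    exact ⟨rfl, e.2⟩
  have heq : (e0 ψ al jl).range = WW ψ.range (Set.range (mm ψ al jl)) hO := by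
    rw [e0, MonoidHom.range_comp, La_surj]
    ext t
    constructor
    · rintro ⟨s, -, rfl⟩
      rw [Th_eq]
      refine ⟨?_, ?_⟩
      · simp only [ip, mul_left, left_inl, right_inl, left_inr, map_one, mul_one]
        have : (⊤ : Subgroup _) ≤ (FS (Set.range (mm ψ al jl))).comap (FreeGroup.map (mm ψ al jl)) := by
          rw [← FreeGroup.closure_range_of, Subgroup.closure_le]
          rintro _ ⟨k, rfl⟩
          simp only [Subgroup.coe_comap, Set.mem_preimage, FreeGroup.map.of]
          exact of_mem_FS ⟨k, rfl⟩
        exact this trivial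
      · simp only [ip, mul_right, right_inl, right_inr, one_mul]
        exact ⟨_, rfl⟩
    · rintro ⟨h1, q, h2⟩
      have : FS (Set.range (mm ψ al jl)) ≤ (FreeGroup.map (mm ψ al jl)).range := by
        rw [Subgroup.closure_le]
        rintro _ ⟨_, ⟨k, rfl⟩, rfl⟩
        exact ⟨FreeGroup.of k, by simp⟩
      obtain ⟨n, hn⟩ := this h1
      refine ⟨⟨n, q⟩, trivial, ?_⟩
      rw [Th_eq, hn, h2]
      exact inl_left_mul_inr_right t
  rw [heq]
  exact ⟨fun x hx t ht => WW_conj _ _ _ hx ht, fun p => ip_mem_WW _ _ _ _⟩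
end basis

/-- twist automorphism -/
def tw (a : J → P) : TT P J →* TT P J := liftT ip (fun j => ip (a j) * sj j)

theorem tw_tw (a b : J → P) (h : ∀ j, b j * a j = 1) (t : TT P J) : tw a (tw b t) = t := by
  have : (tw a).comp (tw b) = MonoidHom.id _ := by
    apply TT_ext
    · intro p; simp [tw]
    · intro j; simp only [tw, MonoidHom.comp_apply, liftT_sj, map_mul, liftT_ip, MonoidHom.id_apply]
      rw [← mul_assoc, ← map_mul, h, map_one, one_mul]
  exact DFunLike.congr_fun this t

def twE (a : J → P) : TT P J ≃* TT P J where
  toFun := tw a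
  invFun := tw (fun j => (a j)⁻¹)
  left_inv t := tw_tw _ _ (by simp) t
  right_inv t := tw_tw _ _ (by simp) t
  map_mul' := map_mul _

theorem twE_ip (a : J → P) (p : P) : twE a (ip p) = ip p := by simp [twE, tw]
theorem twE_sj (a : J → P) (j : J) : twE a (sj j) = ip (a j) * sj j := by simp [twE, tw]

/-- Nielsen transformation -/
def ni {K : Type*} {p : P → Prop} (b : Bool) : FreeGroup (K ⊕ (P ⊕ {h // p h})) →* FreeGroup (K ⊕ (P ⊕ {h : P // p h})) :=
  FreeGroup.lift (Sum.elim (fun k => FreeGroup.of (Sum.inl k)) (Sum.elim (fun h => FreeGroup.of (Sum.inr (Sum.inl h)))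
    (fun h => FreeGroup.of (Sum.inr (Sum.inr h)) *
      (bif b then (FreeGroup.of (Sum.inr (Sum.inl h.1)))⁻¹ else FreeGroup.of (Sum.inr (Sum.inl h.1))))))

theorem ni_ni {K : Type*} {p : P → Prop} (b : Bool) (x : FreeGroup (K ⊕ (P ⊕ {h // p h}))) : ni b (ni (!b) x) = x := by
  have : (ni b).comp (ni (K := K) (p := p) (!b)) = MonoidHom.id _ := by
    ext (k | h | h) <;> cases b <;> simp [ni]
  exact DFunLike.congr_fun this x

section two
variable {K : Type*} (ψ : FreeGroup K →* P)

/-- letters of the edge group -/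
abbrev LL := P ⊕ {h : P // h ∉ ψ.range}
def alL : LL ψ → P := Sum.elim (fun _ => 1) (fun h => h.1)
def jlL : LL ψ → P := Sum.elim (fun h => h) (fun h => h.1)

theorem mm_inj (hψ : Function.Injective ψ) : Function.Injective (mm ψ (alL ψ) (jlL ψ)) := by
  rintro ⟨q, h | h⟩ ⟨q', h' | h'⟩ e <;> simp [mm, alL, jlL] at e
  · obtain ⟨e1, rfl⟩ := e; rw [hψ e1]
  · obtain ⟨e1, rfl⟩ := e
    exfalso; apply h'.2
    exact ⟨q'⁻¹ * q, by rw [map_mul, map_inv, e1]; group⟩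
  · obtain ⟨e1, rfl⟩ := e
    exfalso; apply h.2
    exact ⟨q⁻¹ * q', by rw [map_mul, map_inv, ← e1]; group⟩
  · obtain ⟨e1, e2⟩ := e
    have := Subtype.ext e2
    subst this
    rw [hψ (mul_right_cancel e1)]

def w1 : FreeGroup (K ⊕ LL ψ) →* TT P P := (e0 ψ (alL ψ) (jlL ψ)).comp (ni true)
def w2 : FreeGroup (K ⊕ LL ψ) →* TT P P := (twE (fun h => h)).toMonoidHom.comp (e0 ψ (alL ψ) (jlL ψ))

variable {ψ}
theorem w1_inj (hψ : Function.Injective ψ) : Function.Injective (w1 ψ) :=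
  (e0_inj hψ (mm_inj ψ hψ)).comp (Function.LeftInverse.injective (g := ni false) fun x => ni_ni false x)
theorem w2_inj (hψ : Function.Injective ψ) : Function.Injective (w2 ψ) :=
  (twE _).injective.comp (e0_inj hψ (mm_inj ψ hψ))
theorem w1_WP (hψ : Function.Injective ψ) : WP ψ.range (w1 ψ).range := by
  have : (w1 ψ).range = (e0 ψ (alL ψ) (jlL ψ)).range := by
    rw [w1, MonoidHom.range_comp, MonoidHom.range_eq_top.2 (Function.RightInverse.surjective (g := ni false) fun x => ni_ni true x),
      ← MonoidHom.range_eq_map]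
  rw [this]; exact e0_WP hψ
theorem w2_WP (hψ : Function.Injective ψ) : WP ψ.range (w2 ψ).range := by
  rw [w2, MonoidHom.range_comp]
  exact (e0_WP hψ).of_map _ (twE_ip _)

theorem w1_k (k : K) : w1 ψ (FreeGroup.of (Sum.inl k)) = ip (ψ (FreeGroup.of k)) := by
  simp [w1, ni, e0_inl]
theorem w1_s (h : P) : w1 ψ (FreeGroup.of (Sum.inr (Sum.inl h))) = sj h := by
  simp [w1, ni, e0_inr, alL, jlL]
theorem w1_c (h : {h : P // h ∉ ψ.range}) :
    w1 ψ (FreeGroup.of (Sum.inr (Sum.inr h))) = ip h.1 * sj h.1 * (ip h.1)⁻¹ * (sj h.1)⁻¹ := by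
  simp [w1, ni, e0_inr, alL, jlL]
theorem w2_k (k : K) : w2 ψ (FreeGroup.of (Sum.inl k)) = ip (ψ (FreeGroup.of k)) := by
  simp [w2, e0_inl, twE_ip]
theorem w2_s (h : P) : w2 ψ (FreeGroup.of (Sum.inr (Sum.inl h))) = ip h * sj h := by
  simp [w2, e0_inr, alL, jlL, twE_sj]
end two
end Wb
end EmbThm

namespace EmbThm
universe u v
section Sg
open Cardinal

theorem TT_card {P J : Type u} [Group P] {κ : Cardinal.{u}} (hκ : ℵ₀ ≤ κ) (hP : #P ≤ κ) (hJ : #J ≤ κ) :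
    #(TT P J) ≤ κ := by
  have h1 : #(TT P J) ≤ #(FreeGroup (P × J) × P) :=
    mk_le_of_injective (f := fun t => (t.left, t.right)) fun a b h => by
      simp at h; exact SemidirectProduct.ext h.1 h.2
  refine h1.trans ?_
  rw [mk_prod, lift_id, lift_id]
  refine mul_le_of_le hκ ?_ hP
  cases isEmpty_or_nonempty J with
  | inl h =>
    have : Subsingleton (FreeGroup (P × J)) := inferInstance
    exact (le_one_iff_subsingleton.2 this).trans (one_le_aleph0.trans hκ)
  | inr h =>
    rw [mk_freeGroup]
    refine max_le ?_ hκ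
    rw [mk_prod, lift_id, lift_id]
    exact mul_le_of_le hκ hP hJ

theorem hnn_card {Z Z' : Type u} [Group Z] [Group Z'] {f : Z →* Z'} {U W : Subgroup Z'} {r : Z'}
    (h : IsHNN f.range U W r) {κ : Cardinal.{u}} (hκ : ℵ₀ ≤ κ) (hP : #Z ≤ κ) : #Z' ≤ κ := by
  let g : FreeGroup (Option Z) →* Z' := FreeGroup.lift (fun o => o.elim r f)
  have : g.range = ⊤ := h.gen _ (by rintro _ ⟨z, rfl⟩; exact ⟨FreeGroup.of (some z), by simp [g]⟩)
    ⟨FreeGroup.of none, by simp [g]⟩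
  refine (mk_le_of_surjective (MonoidHom.range_eq_top.1 this)).trans ?_
  rw [mk_freeGroup, mk_option]
  exact max_le (add_le_of_le hκ hP (one_le_aleph0.trans hκ)) hκ

variable {B : Type u} [Group B] {ix : Type u}

theorem range_RX {P : Type*} [Group P] {K : Type*} (D : FreeGroup ix →* P) (e : K → ix) :
    (D.comp (FreeGroup.map e)).range = RX D (Set.range e) := by
  rw [MonoidHom.range_comp]
  congr 1
  apply le_antisymm
  · rw [MonoidHom.range_eq_map, ← FreeGroup.closure_range_of, Subgroup.map_le_iff_le_comap, Subgroup.closure_le]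
    rintro _ ⟨k, rfl⟩
    simp only [Subgroup.coe_comap, Set.mem_preimage, FreeGroup.map.of]
    exact of_mem_FS ⟨k, rfl⟩
  · rw [Subgroup.closure_le]
    rintro _ ⟨_, ⟨k, rfl⟩, rfl⟩
    exact ⟨FreeGroup.of k, by simp⟩

theorem hnn_of {Z : Type u} [Group Z] {K : Type*} (D : FreeGroup ix →* Z) (hD : Function.Injective D) (e : K → ix)
    (he : Function.Injective e) (w : FreeGroup K →* Z) (hw : Function.Injective w) :
    ∃ (Z' : Type u) (_ : Group Z') (f : Z →* Z') (r : Z'), Function.Injective f ∧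
      IsHNN f.range ((RX D (Set.range e)).map f) (w.range.map f) r ∧
      ∀ x : FreeGroup K, r * f (D (FreeGroup.map e x)) * r⁻¹ = f (w x) := by
  have h1 : Function.Injective (D.comp (FreeGroup.map e)) := hD.comp (FreeGroup.map_injective he)
  let φ : (D.comp (FreeGroup.map e)).range ≃* w.range :=
    (MonoidHom.ofInjective h1).symm.trans (MonoidHom.ofInjective hw)
  obtain ⟨Z', i, f, r, hf, hH, hr⟩ := exists_hnn φ
  refine ⟨Z', i, f, r, hf, by rw [← range_RX]; exact hH, fun x => ?_⟩
  have := hr (MonoidHom.ofInjective h1 x)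
  simpa [φ, MonoidHom.ofInjective_apply] using this

variable {Gs : Subgroup B} {D : FreeGroup ix →* B} {P : Type u} [Group P] {ι : B →* P} {X : Set ix}

section wp
variable {J : Type*} {v : Fin 3 → ix} {W : Subgroup (TT P J)}

theorem wp_A (h : Good Gs D ι X) (hW : WP (RX (ι.comp D) (Set.range v)) W) (hvX : ∀ k, v k ∈ X) :
    ∀ g ∈ Gs, g ≠ 1 → ∀ t, t * ip (ι g) * t⁻¹ ∉ W := by
  intro g hg hg1 t ht
  have hne : ι g ≠ 1 := fun e => hg1 (h.inj (by rw [e, map_one]))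
  obtain ⟨y, hy, p, rfl, hp⟩ := hW.fam (S := fun _ : Unit => ι g) (k₀ := ()) hne (fun _ => ht)
  exact h.gsep g hg hg1 p (RX_mono _ (by rintro _ ⟨k, rfl⟩; exact hvX k) (hp ()))

theorem wp_B (h : Good Gs D ι X) (hW : WP (RX (ι.comp D) (Set.range v)) W) (hvX : ∀ k, v k ∈ X)
    {u : Fin 3 → ix} (hu : Function.Injective u) (huX : ∀ k, u k ∈ X) {t : TT P J}
    (ht : ∀ k, t * ip (ι (D (FreeGroup.of (u k)))) * t⁻¹ ∈ W) : t ∈ W ∧ ∀ k, u k ∈ Set.range v := by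
  obtain ⟨y, hy, p, rfl, hp⟩ := hW.fam (k₀ := 0) (S := fun k => ι (D (FreeGroup.of (u k)))) (h.one_ne _) ht
  have := h.pm' (Y := Set.range v) (by rintro _ ⟨k, rfl⟩; exact hvX k) hu huX hp
  exact ⟨mul_mem hy ((hW.mem p).2 this.1), this.2⟩

theorem wp_P (hW : WP (RX (ι.comp D) (Set.range v)) W) (hvX : ∀ k, v k ∈ X)
    {S : Fin 3 → P} (hS : Prot (ι.comp D) X S) (t : TT P J) : ¬ ∀ k, t * ip (S k) * t⁻¹ ∈ W := by
  intro ht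
  obtain ⟨k₀, hk⟩ := hS.ne
  obtain ⟨y, hy, p, rfl, hp⟩ := hW.fam hk ht
  exact hS.2 p fun k => RX_mono _ (by rintro _ ⟨k, rfl⟩; exact hvX k) (hp k)
end wp

theorem range_tf {K Q : Type*} [Group Q] {w : FreeGroup K →* Q} (hw : Function.Injective w) :
    ∀ x ∈ w.range, IsOfFinOrder x → x = 1 := by
  rintro _ ⟨x, rfl⟩ hx
  have := hw.isOfFinOrder_iff.1 hx
  rw [(isOfFinOrder_iff_eq_one _).1 this, map_one]

theorem stage (h : Good Gs D ι X) (Sl : Set ix) (hSl : Sl ⊆ X) (m : ℕ × Option P → ix) (hm : Function.Injective m)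
    (hmS : ∀ a, m a ∈ Sl) {κ : Cardinal.{u}} (hκ : ℵ₀ ≤ κ) (hP : #P ≤ κ) :
    ∃ (P' : Type u) (_ : Group P') (f : P →* P'), Function.Injective f ∧ Good Gs D (f.comp ι) (X \ Sl) ∧
      #P' ≤ κ ∧
      (∀ S, Prot (ι.comp D) X S → Prot ((f.comp ι).comp D) (X \ Sl) (fun k => f (S k))) ∧
      (∀ a : P, ∃ (r1 r2 s : P') (u v u' v' : Fin 3 → ix) (x y : ix),
        Prot ((f.comp ι).comp D) (X \ Sl) (fun k => f (ι (D (FreeGroup.of (u k))))) ∧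
        Prot ((f.comp ι).comp D) (X \ Sl) (fun k => f (ι (D (FreeGroup.of (u' k))))) ∧
        (∀ k, r1 * f (ι (D (FreeGroup.of (u k)))) * r1⁻¹ = f (ι (D (FreeGroup.of (v k))))) ∧
        (∀ k, r2 * f (ι (D (FreeGroup.of (u' k)))) * r2⁻¹ = f (ι (D (FreeGroup.of (v' k))))) ∧
        r1 * f (ι (D (FreeGroup.of x))) * r1⁻¹ = s ∧
        r2 * f (ι (D (FreeGroup.of y))) * r2⁻¹ = f a * s) ∧
      (∀ a : P, a ∉ RX (ι.comp D) Sl → ∃ (r s : P') (i : ix),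
        r * f (ι (D (FreeGroup.of i))) * r⁻¹ = f a * s * (f a)⁻¹ * s⁻¹) := by
  let v : Fin 3 → ix := fun k => m (k, none)
  let v' : Fin 3 → ix := fun k => m (k + 3, none)
  have mi : ∀ a b, m a = m b ↔ a = b := fun a b => hm.eq_iff
  have hv : Function.Injective v := fun a b e => by
    have := hm e; simp at this; exact Fin.ext this
  have hv' : Function.Injective v' := fun a b e => by
    have := hm e; simp at this; exact Fin.ext this
  let ψ : FreeGroup (Fin 3) →* P := (ι.comp D).comp (FreeGroup.map v)
  let ψ' : FreeGroup (Fin 3) →* P := (ι.comp D).comp (FreeGroup.map v')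
  have hψ : Function.Injective ψ := (h.inj.comp h.injD).comp (FreeGroup.map_injective hv)
  have hψ' : Function.Injective ψ' := (h.inj.comp h.injD).comp (FreeGroup.map_injective hv')
  let e1 : Fin 3 ⊕ LL ψ → ix := Sum.elim (fun k => m (k + 6, none))
    (Sum.elim (fun a => m (0, some a)) (fun a => m (1, some a.1)))
  let e2 : Fin 3 ⊕ LL ψ' → ix := Sum.elim (fun k => m (k + 9, none))
    (Sum.elim (fun a => m (2, some a)) (fun a => m (3, some a.1)))
  have he1 : Function.Injective e1 := by
    rintro (a | a | a) (b | b | b) e <;> simp [e1, mi] at e ⊢ <;>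
      first | assumption | exact Fin.ext e | exact Subtype.ext e
  have he2 : Function.Injective e2 := by
    rintro (a | a | a) (b | b | b) e <;> simp [e2, mi] at e ⊢ <;>
      first | assumption | exact Fin.ext e | exact Subtype.ext e
  have hvX : ∀ k, v k ∈ X := fun k => hSl (hmS _)
  have hv'X : ∀ k, v' k ∈ X := fun k => hSl (hmS _)
  have he1X : ∀ k, e1 k ∈ Sl := by rintro (a | a | a) <;> exact hmS _
  have he2X : ∀ k, e2 k ∈ Sl := by rintro (a | a | a) <;> exact hmS _
  have dv1 : ∀ k a, v k ≠ e1 a := by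
    rintro k (a | a | a) <;> simp [v, e1, mi] <;> omega
  have dv'1 : ∀ k a, v' k ≠ e1 a := by
    rintro k (a | a | a) <;> simp [v', e1, mi] <;> omega
  have dv'2 : ∀ k a, v' k ≠ e2 a := by
    rintro k (a | a | a) <;> simp [v', e2, mi] <;> omega
  have dv2 : ∀ k a, v k ≠ e2 a := by
    rintro k (a | a | a) <;> simp [v, e2, mi] <;> omega
  have dvv' : ∀ k a, v k ≠ v' a := by
    rintro k a; simp [v, v', mi]; omega
  have d12 : ∀ k a, e1 k ≠ e2 a := by
    rintro (k | k | k) (a | a | a) <;> simp [e1, e2, mi] <;> omega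
  have hψr : ψ.range = RX (ι.comp D) (Set.range v) := range_RX _ _
  have hψ'r : ψ'.range = RX (ι.comp D) (Set.range v') := range_RX _ _
  have hW1 : WP (RX (ι.comp D) (Set.range v)) (w1 ψ).range := hψr ▸ w1_WP hψ
  have hW2 : WP (RX (ι.comp D) (Set.range v')) (w2 ψ').range := hψ'r ▸ w2_WP hψ'
  have gT : Good Gs D ((ip : P →* TT P P).comp ι) X := h.TT
  -- first HNN extension
  have st1 : Step Gs D ((ip : P →* TT P P).comp ι) X (Set.range v) (Set.range e1) (w1 ψ).range :=
    { good := gT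
      sub0 := by rintro _ ⟨k, rfl⟩; exact hvX k
      sub1 := by rintro _ ⟨k, rfl⟩; exact hSl (he1X k)
      disj := by
        rw [Set.disjoint_left]; rintro _ ⟨k, rfl⟩ ⟨a, e⟩; exact dv1 k a e.symm
      wtf := range_tf (w1_inj hψ)
      wA := wp_A h hW1 hvX
      wB := fun u hu huX t ht => (huX 0).2 ((wp_B h hW1 hvX hu (fun k => (huX k).1) ht).2 0) }
  obtain ⟨Z1, i1, f1, r1, hf1, hH1, hr1⟩ := hnn_of (((ip : P →* TT P P).comp ι).comp D) (gT.inj.comp gT.injD) e1 he1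
    (w1 ψ) (w1_inj hψ)
  have g1 := st1.goodZ hf1 hH1
  have hC1 : ∀ t, (∀ k, t * ((ip : P →* TT P P).comp ι) (D (FreeGroup.of (v k))) * t⁻¹ ∈ (w1 ψ).range) → t ∈ (w1 ψ).range :=
    fun t ht => (wp_B h hW1 hvX hv hvX ht).1
  let u1 : Fin 3 → ix := fun k => e1 (Sum.inl k)
  have hu1 : Function.Injective u1 := he1.comp Sum.inl_injective
  have hr1u : ∀ k, r1 * f1 (((ip : P →* TT P P).comp ι) (D (FreeGroup.of (u1 k)))) * r1⁻¹ =
      f1 (((ip : P →* TT P P).comp ι) (D (FreeGroup.of (v k)))) := by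
    intro k
    have := hr1 (FreeGroup.of (Sum.inl k))
    rw [w1_k] at this
    simpa [ψ] using this
  set X1 := X \ (Set.range v ∪ Set.range e1) with hX1
  have hv'1 : ∀ k, v' k ∈ X1 := fun k => ⟨hv'X k, by
    rintro (⟨a, e⟩ | ⟨a, e⟩)
    · exact dvv' _ _ e
    · exact dv'1 _ _ e.symm⟩
  have he21 : ∀ k, e2 k ∈ X1 := fun k => ⟨hSl (he2X k), by
    rintro (⟨a, e⟩ | ⟨a, e⟩)
    · exact dv2 _ _ e
    · exact d12 _ _ e⟩
  -- reduction from `Z1` to `T`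
  have redU : ∀ {u : Fin 3 → ix}, Function.Injective u → (∀ k, u k ∈ X1) → ∀ {t : Z1} {K : Subgroup (TT P P)},
      (∀ k, t * f1 (((ip : P →* TT P P).comp ι) (D (FreeGroup.of (u k)))) * t⁻¹ ∈ K.map f1) →
      ∃ s, t = f1 s ∧ ∀ k, s * ip (ι (D (FreeGroup.of (u k)))) * s⁻¹ ∈ K := by
    intro u hu huX t K ht
    exact hnn_mal hf1 hH1 (S := fun k => ((ip : P →* TT P P).comp ι) (D (FreeGroup.of (u k))))
      (fun t ht => (huX 0).2 (Or.inr ((gT.pm' st1.sub1 hu (fun k => (huX k).1) ht).2 0)))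
      (fun t ht => st1.wB u hu (fun k => ⟨(huX k).1, fun hh => (huX k).2 (Or.inl hh)⟩) t ht) ht
  have w2r : (f1.comp (w2 ψ')).range = (w2 ψ').range.map f1 := MonoidHom.range_comp _ _
  have st2 : Step Gs D (f1.comp ((ip : P →* TT P P).comp ι)) X1 (Set.range v') (Set.range e2) (f1.comp (w2 ψ')).range :=
    { good := g1
      sub0 := by rintro _ ⟨k, rfl⟩; exact hv'1 k
      sub1 := by rintro _ ⟨k, rfl⟩; exact he21 k
      disj := by
        rw [Set.disjoint_left]; rintro _ ⟨k, rfl⟩ ⟨a, e⟩; exact dv'2 k a e.symm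
      wtf := range_tf (hf1.comp (w2_inj hψ'))
      wA := by
        intro g hg hg1 t ht
        rw [w2r] at ht
        obtain ⟨s, rfl, hs⟩ := hnn_mal hf1 hH1 (S := fun _ : Unit => ip (ι g))
          (fun t ht => gT.gsep g hg hg1 t (RX_mono _ st1.sub1 (ht ())))
          (fun t ht => st1.wA g hg hg1 t (ht ())) (fun _ => ht)
        exact wp_A h hW2 hv'X g hg hg1 s (hs ())
      wB := by
        intro u hu huX t ht
        rw [w2r] at ht
        obtain ⟨s, rfl, hs⟩ := redU hu (fun k => (huX k).1) ht
        exact (huX 0).2 ((wp_B h hW2 hv'X hu (fun k => (huX k).1.1) hs).2 0) }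
  obtain ⟨Z2, i2, f2, r2, hf2, hH2, hr2⟩ := hnn_of ((f1.comp ((ip : P →* TT P P).comp ι)).comp D) (g1.inj.comp g1.injD) e2 he2
    (f1.comp (w2 ψ')) (hf1.comp (w2_inj hψ'))
  have g2 := st2.goodZ hf2 hH2
  have hC2 : ∀ t, (∀ k, t * (f1.comp ((ip : P →* TT P P).comp ι)) (D (FreeGroup.of (v' k))) * t⁻¹ ∈ (f1.comp (w2 ψ')).range) →
      t ∈ (f1.comp (w2 ψ')).range := by
    intro t ht
    rw [w2r] at ht ⊢
    obtain ⟨s, rfl, hs⟩ := redU hv' hv'1 ht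
    exact ⟨s, (wp_B h hW2 hv'X hv' hv'X hs).1, rfl⟩
  let u2 : Fin 3 → ix := fun k => e2 (Sum.inl k)
  have hu2 : Function.Injective u2 := he2.comp Sum.inl_injective
  have hr2u : ∀ k, r2 * f2 ((f1.comp ((ip : P →* TT P P).comp ι)) (D (FreeGroup.of (u2 k)))) * r2⁻¹ =
      f2 ((f1.comp ((ip : P →* TT P P).comp ι)) (D (FreeGroup.of (v' k)))) := by
    intro k
    have := hr2 (FreeGroup.of (Sum.inl k))
    rw [MonoidHom.comp_apply _ (w2 ψ'), w2_k] at this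
    simpa [ψ'] using this
  have hsub : X \ Sl ⊆ X1 \ (Set.range v' ∪ Set.range e2) := by
    rintro x ⟨hx, hxS⟩
    refine ⟨⟨hx, ?_⟩, ?_⟩
    · rintro (⟨a, rfl⟩ | ⟨a, rfl⟩)
      · exact hxS (hmS _)
      · exact hxS (he1X _)
    · rintro (⟨a, rfl⟩ | ⟨a, rfl⟩)
      · exact hxS (hmS _)
      · exact hxS (he2X _)
  have pa2 := (st2.prot_anchor hf2 hH2 hu2 hv' (fun k => ⟨_, rfl⟩) (fun k => ⟨_, rfl⟩) hr2u hC2).mono hsub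
  have pa1 := st1.prot_anchor hf1 hH1 hu1 hv (fun k => ⟨_, rfl⟩) (fun k => ⟨_, rfl⟩) hr1u hC1
  have pa1' := (st2.prot hf2 hH2 pa1 (by
    intro t ht
    rw [w2r] at ht
    rcases st1.anchor hf1 hH1 hu1 hv (fun k => ⟨_, rfl⟩) (fun k => ⟨_, rfl⟩) hr1u hC1 ht with
      ⟨s, rfl, hs⟩ | ⟨s, rfl, hs⟩
    · obtain ⟨a, e⟩ := (wp_B h hW2 hv'X hu1 (fun k => hSl (he1X _)) hs).2 0
      exact dv'1 _ _ e
    · obtain ⟨a, e⟩ := (wp_B h hW2 hv'X hv hvX hs).2 0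
      exact dvv' _ _ e.symm)).mono hsub
  refine ⟨Z2, i2, f2.comp (f1.comp ip), hf2.comp (hf1.comp ip_inj), g2.mono hsub,
    hnn_card hH2 hκ (hnn_card hH1 hκ (TT_card hκ hP hP)), ?_, ?_, ?_⟩
  · intro S hS
    have p1 := st1.prot hf1 hH1 hS.TT (wp_P hW1 hvX hS)
    have p2 := st2.prot hf2 hH2 p1 (by
      intro t ht
      rw [w2r] at ht
      obtain ⟨s, rfl, hs⟩ := hnn_mal hf1 hH1 (S := fun k => ip (S k)) (fun t ht => hS.TT.2 t fun k => RX_mono _ st1.sub1 (ht k))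
        (wp_P hW1 hvX hS) ht
      exact wp_P hW2 hv'X hS s hs)
    exact p2.mono hsub
  · intro a
    refine ⟨f2 r1, r2, f2 (f1 (sj a)), u1, v, u2, v', e1 (Sum.inr (Sum.inl a)), e2 (Sum.inr (Sum.inl a)),
      pa1', pa2, fun k => ?_, hr2u, ?_, ?_⟩
    · have := congrArg f2 (hr1u k)
      simpa using this
    · have := congrArg f2 (hr1 (FreeGroup.of (Sum.inr (Sum.inl a))))
      rw [w1_s] at this
      simpa using this
    · have := hr2 (FreeGroup.of (Sum.inr (Sum.inl a)))
      rw [MonoidHom.comp_apply _ (w2 ψ'), w2_s] at this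
      simpa using this
  · intro a ha
    have ha' : a ∉ ψ.range := by
      rw [hψr]
      intro hh
      exact ha (RX_mono _ (by rintro _ ⟨k, rfl⟩; exact hmS _) hh)
    refine ⟨f2 r1, f2 (f1 (sj a)), e1 (Sum.inr (Sum.inr ⟨a, ha'⟩)), ?_⟩
    have := congrArg f2 (hr1 (FreeGroup.of (Sum.inr (Sum.inr ⟨a, ha'⟩))))
    rw [w1_c] at this
    simpa using this
end Sg
end EmbThm

namespace EmbThm
universe u v
section Lm
open Cardinal

theorem tower (P : ℕ → Type u) [∀ n, Group (P n)] (f : ∀ n, P n →* P (n+1)) (hf : ∀ n, Function.Injective (f n)) :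
    ∃ (H : Type u) (_ : Group H) (g : ∀ n, P n →* H), (∀ n, Function.Injective (g n)) ∧
      (∀ n x, g (n+1) (f n x) = g n x) ∧ ∀ h, ∃ n x, g n x = h := by
  let F : ∀ i j, i ≤ j → (P i →* P j) := fun i j hij =>
    Nat.leRec (motive := fun m _ => P i →* P m) (MonoidHom.id _) (fun k _ g => (f k).comp g) hij
  have F0 : ∀ i, F i i le_rfl = MonoidHom.id _ := fun i => Nat.leRec_self _ _
  have FS : ∀ i j (h : i ≤ j), F i (j+1) (Nat.le_succ_of_le h) = (f j).comp (F i j h) := fun i j h =>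
    Nat.leRec_succ _ _ _
  have : DirectedSystem P (fun i j h => F i j h) :=
    { map_self := fun i x => by rw [F0]; rfl
      map_map := by
        intro k j i hij hjk x
        induction k, hjk using Nat.le_induction with
        | base => rw [F0]; rfl
        | succ k hk ih =>
          rw [FS j k hk, MonoidHom.comp_apply, ih, FS i k (hij.trans hk)]; rfl }
  have Finj : ∀ i j h, Function.Injective (F i j h) := by
    intro i j h
    induction j, h using Nat.le_induction with
    | base => rw [F0]; exact fun _ _ h => h
    | succ k hk ih => rw [FS i k hk]; exact (hf k).comp ih
  refine ⟨DirectLimit P F, inferInstance,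
    fun n => MonoidHom.mk' (fun x => (⟦⟨n, x⟩⟧ : DirectLimit P F)) (fun a b => (DirectLimit.mul_def n a b).symm), ?_, ?_, ?_⟩
  · intro n
    exact DirectLimit.mk_injective F Finj n
  · intro n x
    have h1 := DirectLimit.mk_apply (f := F) n (n+1) x (Nat.le_succ n)
    have h2 : F n (n+1) (Nat.le_succ n) x = f n x := by
      have := FS n n le_rfl
      rw [F0] at this
      exact DFunLike.congr_fun this x
    rw [h2] at h1
    exact h1
  · intro h
    obtain ⟨i, x, rfl⟩ := DirectLimit.exists_eq_mk F h
    exact ⟨i, x, rfl⟩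

theorem final_of {H : Type u} [Group H] [Nontrivial H] {ix : Type v} (δ : ix → H)
    (pin : ∀ a : H, ∃ (r1 r2 s : H) (u v u' v' : Fin 3 → ix) (x y : ix),
        (∀ t, (∀ k, t * δ (u k) * t⁻¹ = δ (u k)) → t = 1) ∧
        (∀ t, (∀ k, t * δ (u' k) * t⁻¹ = δ (u' k)) → t = 1) ∧
        (∀ k, r1 * δ (u k) * r1⁻¹ = δ (v k)) ∧
        (∀ k, r2 * δ (u' k) * r2⁻¹ = δ (v' k)) ∧
        r1 * δ x * r1⁻¹ = s ∧ r2 * δ y * r2⁻¹ = a * s)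
    (sim : ∀ a : H, a ≠ 1 → ∃ (r s : H) (i : ix), r * δ i * r⁻¹ = a * s * a⁻¹ * s⁻¹)
    (conj : ∀ i j, ∃ b, b * δ i * b⁻¹ = δ j)
    (rig : ∀ β : H →* H, Function.Injective β → ∃ h, ∀ i, β (δ i) = h * δ i * h⁻¹) :
    IsSimpleGroup H ∧ Subgroup.center H = ⊥ ∧
      (∀ φ : H ≃* H, ∃ h : H, ∀ x : H, φ x = h * x * h⁻¹) ∧
      (∀ β : H →* H, Function.Injective β → Function.Surjective β) := by
  have key : ∀ β : H →* H, Function.Injective β → ∃ h, ∀ x, β x = h * x * h⁻¹ := by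
    intro β hβ
    obtain ⟨h, hh⟩ := rig β hβ
    let γ : H →* H := (MulAut.conj h⁻¹).toMonoidHom.comp β
    have hγ : ∀ x, γ x = h⁻¹ * β x * h := fun x => by simp [γ]
    have hδ : ∀ i, γ (δ i) = δ i := fun i => by rw [hγ, hh]; group
    have fixr : ∀ (r : H) (u v : Fin 3 → ix), (∀ t, (∀ k, t * δ (u k) * t⁻¹ = δ (u k)) → t = 1) →
        (∀ k, r * δ (u k) * r⁻¹ = δ (v k)) → γ r = r := by
      intro r u v hc hr
      have : r⁻¹ * γ r = 1 := hc _ fun k => by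
        have h1 := congrArg γ (hr k)
        simp only [map_mul, map_inv, hδ] at h1
        have h2 := hr k
        rw [← h1] at h2
        calc r⁻¹ * γ r * δ (u k) * (r⁻¹ * γ r)⁻¹ = r⁻¹ * (γ r * δ (u k) * (γ r)⁻¹) * r := by group
          _ = _ := by rw [← h2]; group
      rw [inv_mul_eq_one] at this
      exact this.symm
    have fix : ∀ x, γ x = x := by
      intro a
      obtain ⟨r1, r2, s, u, v, u', v', x, y, c1, c2, h1, h2, h3, h4⟩ := pin a
      have e1 := fixr r1 u v c1 h1
      have e2 := fixr r2 u' v' c2 h2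
      have e3 : γ s = s := by rw [← h3]; simp [e1, hδ]
      have e4 : γ (a * s) = a * s := by rw [← h4]; simp [e2, hδ]
      rw [map_mul, e3] at e4
      exact mul_right_cancel e4
    refine ⟨h, fun x => ?_⟩
    have := fix x
    rw [hγ] at this
    calc β x = h * (h⁻¹ * β x * h) * h⁻¹ := by group
      _ = _ := by rw [this]
  refine ⟨?_, ?_, ?_, ?_⟩
  · refine { eq_bot_or_eq_top_of_normal := fun N hN => ?_ }
    by_cases hb : N = ⊥
    · exact Or.inl hb
    right
    obtain ⟨⟨a, ha⟩, ha0⟩ := Subgroup.ne_bot_iff_exists_ne_one.1 hb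
    have ha1 : a ≠ 1 := fun e => ha0 (Subtype.ext e)
    obtain ⟨r, s, i, e⟩ := sim a ha1
    have h1 : δ i ∈ N := by
      have : a * s * a⁻¹ * s⁻¹ ∈ N := by
        have := mul_mem ha (hN.conj_mem _ (inv_mem ha) s)
        convert this using 1; group
      rw [← e] at this
      have := hN.conj_mem _ this r⁻¹
      convert this using 1; group
    have h2 : ∀ j, δ j ∈ N := fun j => by
      obtain ⟨b, hb⟩ := conj i j
      rw [← hb]; exact hN.conj_mem _ h1 _
    rw [eq_top_iff]
    rintro a -
    obtain ⟨r1, r2, s, u, v, u', v', x, y, c1, c2, _, _, h3, h4⟩ := pin a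
    have h5 : s ∈ N := by rw [← h3]; exact hN.conj_mem _ (h2 _) _
    have h6 : a * s ∈ N := by rw [← h4]; exact hN.conj_mem _ (h2 _) _
    exact (Subgroup.mul_mem_cancel_right N h5).1 h6
  · rw [eq_bot_iff]
    intro z hz
    obtain ⟨r1, r2, s, u, v, u', v', x, y, c1, _⟩ := pin 1
    rw [Subgroup.mem_bot]
    refine c1 z fun k => ?_
    rw [← Subgroup.mem_center_iff.1 hz]; group
  · intro φ
    exact key φ.toMonoidHom φ.injective
  · intro β hβ y
    obtain ⟨h, hh⟩ := key β hβ
    exact ⟨h⁻¹ * y * h, by rw [hh]; group⟩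

variable {B : Type u} [Group B] {I : Type u}

def Xn (I : Type u) (n : ℕ) : Set (ℕ × I) := {a | n ≤ a.1}
def Sln (I : Type u) (n : ℕ) : Set (ℕ × I) := {a | a.1 = n}

structure Lev (Gs : Subgroup B) (D : FreeGroup (ℕ × I) →* B) (n : ℕ) : Type (u+1) where
  P : Type u
  grp : Group P
  ι : B →* P
  good : Good Gs D ι (Xn I n)
  card : #P ≤ #I

attribute [instance] Lev.grp

structure LStep {Gs : Subgroup B} {D : FreeGroup (ℕ × I) →* B} {n : ℕ} (L : Lev Gs D n) (L' : Lev Gs D (n+1))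
    (f : L.P →* L'.P) : Prop where
  inj : Function.Injective f
  comp : ∀ b, L'.ι b = f (L.ι b)
  prot : ∀ S, Prot (L.ι.comp D) (Xn I n) S → Prot (L'.ι.comp D) (Xn I (n+1)) (fun k => f (S k))
  pin : ∀ a : L.P, ∃ (r1 r2 s : L'.P) (u v u' v' : Fin 3 → ℕ × I) (x y : ℕ × I),
        Prot (L'.ι.comp D) (Xn I (n+1)) (fun k => L'.ι (D (FreeGroup.of (u k)))) ∧
        Prot (L'.ι.comp D) (Xn I (n+1)) (fun k => L'.ι (D (FreeGroup.of (u' k)))) ∧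
        (∀ k, r1 * L'.ι (D (FreeGroup.of (u k))) * r1⁻¹ = L'.ι (D (FreeGroup.of (v k)))) ∧
        (∀ k, r2 * L'.ι (D (FreeGroup.of (u' k))) * r2⁻¹ = L'.ι (D (FreeGroup.of (v' k)))) ∧
        r1 * L'.ι (D (FreeGroup.of x)) * r1⁻¹ = s ∧
        r2 * L'.ι (D (FreeGroup.of y)) * r2⁻¹ = f a * s
  sim : ∀ a : L.P, a ∉ RX (L.ι.comp D) (Sln I n) → ∃ (r s : L'.P) (i : ℕ × I),
        r * L'.ι (D (FreeGroup.of i)) * r⁻¹ = f a * s * (f a)⁻¹ * s⁻¹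

theorem lev_step {Gs : Subgroup B} {D : FreeGroup (ℕ × I) →* B} (hI : ℵ₀ ≤ #I) {n : ℕ} (L : Lev Gs D n) :
    ∃ (L' : Lev Gs D (n+1)) (f : L.P →* L'.P), LStep L L' f := by
  have hc : #(ℕ × Option L.P) ≤ #I := by
    rw [mk_prod, mk_option]
    simp only [mk_eq_aleph0, lift_aleph0, lift_id']
    exact mul_le_of_le hI hI (add_le_of_le hI L.card (one_le_aleph0.trans hI))
  obtain ⟨j⟩ := hc
  have hX : Xn I n \ Sln I n = Xn I (n+1) := by
    ext a; simp only [Xn, Sln, Set.mem_sdiff, Set.mem_ofPred_eq]; omega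
  obtain ⟨P', i', f, hf, hg, hcard, hprot, hpin, hsim⟩ := stage L.good (Sln I n) (fun a (ha : a.1 = n) => ha.ge)
    (fun a => (n, j a)) (fun a b e => j.injective (Prod.ext_iff.1 e).2) (fun a => rfl) hI L.card
  rw [hX] at hg hprot hpin
  exact ⟨⟨P', i', f.comp L.ι, hg, hcard⟩, f, hf, fun b => rfl, hprot, hpin, hsim⟩

theorem assembly (Gs : Subgroup B) (D : FreeGroup (ℕ × I) →* B) (hI : ℵ₀ ≤ #I) (hB : #B ≤ #I)
    (h0 : Good Gs D (MonoidHom.id B) Set.univ)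
    (conj : ∀ i j, ∃ b, b * D (FreeGroup.of i) * b⁻¹ = D (FreeGroup.of j))
    (rig : ∀ (H : Type u) [Group H] (ι : B →* H), Function.Injective ι →
      (∀ h : H, IsOfFinOrder h → ∃ k, k * h * k⁻¹ ∈ ι.range) →
      (∀ b : B, IsOfFinOrder b → b ≠ 1 → ∀ h, h * ι b * h⁻¹ ∈ ι.range → h ∈ ι.range) →
      (∀ g ∈ Gs, g ≠ 1 → ∀ h, h * ι g * h⁻¹ ∈ Gs.map ι → h ∈ Gs.map ι) →
      ∀ β : H →* H, Function.Injective β → ∃ h, ∀ i, β (ι (D (FreeGroup.of i))) = h * ι (D (FreeGroup.of i)) * h⁻¹) :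
    ∃ (H : Type u) (_ : Group H) (ι : B →* H), Function.Injective ι ∧
      IsSimpleGroup H ∧ Subgroup.center H = ⊥ ∧
      (∀ φ : H ≃* H, ∃ h : H, ∀ x : H, φ x = h * x * h⁻¹) ∧
      (∀ β : H →* H, Function.Injective β → Function.Surjective β) ∧
      (∀ g ∈ Gs, g ≠ 1 → ∀ h, h * ι g * h⁻¹ ∈ Gs.map ι → h ∈ Gs.map ι) := by
  choose nx fn hn using fun (n : ℕ) (L : Lev Gs D n) => lev_step hI L
  let L : ∀ n, Lev Gs D n := fun n => Nat.rec (motive := fun n => Lev Gs D n) ⟨B, inferInstance, MonoidHom.id B, h0.mono (Set.subset_univ _), hB⟩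
    (fun n l => nx n l) n
  let f : ∀ n : ℕ, (L n).P →* (L (n+1)).P := fun n => fn n (L n)
  have hL : ∀ n, LStep (L n) (L (n+1)) (f n) := fun n => hn n (L n)
  obtain ⟨H, iH, g, gi, gf, gs⟩ := tower (fun n => (L n).P) f (fun n => (hL n).inj)
  let J : B →* H := (g 0).comp (L 0).ι
  have gJ : ∀ n b, g n ((L n).ι b) = J b := by
    intro n b
    induction n with
    | zero => rfl
    | succ n ih => rw [(hL n).comp, gf, ih]
  have Ji : Function.Injective J := (gi 0).comp (L 0).good.inj
  -- every element lives in high levels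
  have gs' : ∀ h n, ∃ m, n ≤ m ∧ ∃ x, g m x = h := by
    intro h n
    obtain ⟨m, x, rfl⟩ := gs h
    have : ∀ k, ∃ y, g (m+k) y = g m x := by
      intro k
      induction k with
      | zero => exact ⟨x, rfl⟩
      | succ k ih => obtain ⟨y, hy⟩ := ih; exact ⟨f (m+k) y, (gf (m+k) y).trans hy⟩
    obtain ⟨y, hy⟩ := this n
    exact ⟨m+n, by omega, y, hy⟩
  have prot : ∀ n m, n ≤ m → ∀ S, Prot ((L n).ι.comp D) (Xn I n) S → ∃ S', (∀ k, g m (S' k) = g n (S k)) ∧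
      Prot ((L m).ι.comp D) (Xn I m) S' := by
    intro n m h S hS
    induction m, h using Nat.le_induction with
    | base => exact ⟨S, fun _ => rfl, hS⟩
    | succ m hm ih =>
      obtain ⟨S', h1, h2⟩ := ih
      exact ⟨_, fun k => by rw [gf, h1], (hL m).prot S' h2⟩
  have cent : ∀ n S, Prot ((L n).ι.comp D) (Xn I n) S → ∀ t, (∀ k, t * g n (S k) * t⁻¹ = g n (S k)) → t = 1 := by
    intro n S hS t ht
    obtain ⟨m, hm, y, rfl⟩ := gs' t n
    obtain ⟨S', h1, h2⟩ := prot n m hm S hS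
    have : y = 1 := h2.1 y fun k => gi m (by simpa [h1] using ht k)
    rw [this, map_one]
  have gmal : ∀ x ∈ Gs, x ≠ 1 → ∀ h, h * J x * h⁻¹ ∈ Gs.map J → h ∈ Gs.map J := by
    rintro x hx hx1 h ⟨x', hx', e⟩
    obtain ⟨n, y, rfl⟩ := gs h
    obtain ⟨z, hz, e2⟩ := (L n).good.gmal x hx hx1 y ⟨x', hx', gi n (by simpa [gJ] using e)⟩
    exact ⟨z, hz, by rw [← e2, ← gJ n]⟩
  have hII : Infinite I := infinite_iff.2 hI
  have hnt : Nontrivial H := by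
    obtain ⟨i⟩ : Nonempty I := inferInstance
    refine ⟨⟨J (D (FreeGroup.of (0, i))), 1, fun e => ?_⟩⟩
    have := h0.injD (Ji (e.trans (map_one _).symm) |>.trans (map_one _).symm)
    exact FreeGroup.of_ne_one _ this
  suffices hfin : IsSimpleGroup H ∧ Subgroup.center H = ⊥ ∧
      (∀ φ : H ≃* H, ∃ h : H, ∀ x : H, φ x = h * x * h⁻¹) ∧
      (∀ β : H →* H, Function.Injective β → Function.Surjective β) by
    obtain ⟨c1, c2, c3, c4⟩ := hfin
    exact ⟨H, iH, J, Ji, c1, c2, c3, c4, gmal⟩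
  refine final_of (fun i => J (D (FreeGroup.of i))) ?_ ?_ ?_ ?_
  · intro a
    obtain ⟨n, y, rfl⟩ := gs a
    obtain ⟨r1, r2, s, u, v, u', v', x, y', p1, p2, e1, e2, e3, e4⟩ := (hL n).pin y
    refine ⟨g _ r1, g _ r2, g _ s, u, v, u', v', x, y', fun t ht => cent _ _ p1 t ?_, fun t ht => cent _ _ p2 t ?_, fun k => ?_, fun k => ?_, ?_, ?_⟩
    · intro k; rw [gJ]; exact ht k
    · intro k; rw [gJ]; exact ht k
    · have := congrArg (g _) (e1 k); simpa [gJ] using this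
    · have := congrArg (g _) (e2 k); simpa [gJ] using this
    · have := congrArg (g _) e3; simpa [gJ] using this
    · have := congrArg (g _) e4; simpa [gJ, gf] using this
  · intro a ha
    have low : ∀ n (y : (L n).P), y ∉ RX ((L n).ι.comp D) (Sln I n) → ∃ (r s : H) (i : ℕ × I),
        r * J (D (FreeGroup.of i)) * r⁻¹ = g n y * s * (g n y)⁻¹ * s⁻¹ := by
      intro n y hy
      obtain ⟨r, s, i, e⟩ := (hL n).sim y hy
      refine ⟨g _ r, g _ s, i, ?_⟩
      have := congrArg (g _) e; simpa [gJ, gf] using this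
    obtain ⟨n, y, rfl⟩ := gs a
    by_cases hy : y ∈ RX ((L n).ι.comp D) (Sln I n)
    · rw [← gf]
      refine low (n+1) _ ?_
      obtain ⟨q, hq, rfl⟩ := hy
      intro hq2
      rw [MonoidHom.comp_apply, ← (hL n).comp] at hq2
      have h2 := mem_RX_of (L (n+1)).good.injD (L (n+1)).good.inj hq2
      have : q = 1 := FS_disj (by
        rw [Set.disjoint_left]
        rintro a (h1 : a.1 = n) (h2 : a.1 = n+1)
        omega) hq h2
      apply ha
      rw [this]; simp
    · exact low n y hy
  · intro i j
    obtain ⟨b, hb⟩ := conj i j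
    exact ⟨J b, by simp only [← hb, map_mul, map_inv]⟩
  · intro β hβ
    refine rig H J Ji ?_ ?_ gmal β hβ
    · intro h hh
      obtain ⟨n, y, rfl⟩ := gs h
      obtain ⟨k, b, e⟩ := (L n).good.tors y ((gi n).isOfFinOrder_iff.1 hh)
      exact ⟨g n k, b, by rw [← gJ n, e]; simp⟩
    · rintro b hb hb1 h ⟨b', e⟩
      obtain ⟨n, y, rfl⟩ := gs h
      obtain ⟨z, e2⟩ := (L n).good.tmal b hb hb1 y ⟨b', gi n (by simpa [gJ] using e)⟩
      exact ⟨z, by rw [← e2, gJ]⟩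
end Lm
end EmbThm

namespace EmbThm
universe u v w
section Pm
variable {P : Type u} [Group P] {ι : Type v} {E : Subgroup P} {A : ι → Subgroup P} {Q : Subgroup P}

theorem IsAmalg.fst_idx (H : IsAmalg E A Q) {i j k l : ι} {n m : ℕ} {x : P} (hx : RP E A i j n x)
    (hy : RP E A k l m x) : i = k := by
  by_contra h
  have := H.red _ _ _ _ (hx.inv.mul hy h)
  simp at this

/-- admissible tails after a syllable of index `i` -/
def Tail (E : Subgroup P) (A : ι → Subgroup P) (i : ι) (y : P) : Prop :=
  y ∈ E ∨ ∃ k l n, k ≠ i ∧ RP E A k l n y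

theorem Tail.of {i k l : ι} {n : ℕ} {y : P} (h : RP E A k l n y) (hk : k ≠ i) : Tail E A i y :=
  Or.inr ⟨k, l, n, hk, h⟩

theorem Tail.rp (hE : ∀ i, E ≤ A i) {i : ι} {y a : P} (h : Tail E A i y) (ha : a ∈ A i) (haE : a ∉ E) :
    ∃ l n, RP E A i l n (a * y) := by
  rcases h with h | ⟨k, l, n, hk, h⟩
  · exact ⟨i, 1, (RP.single ha haE).mulE' hE h⟩
  · exact ⟨l, n+1, RP.cons ha haE hk.symm h⟩

theorem IsAmalg.cmp (H : IsAmalg E A Q) {i : ι} {a a' y y' : P} (ha : a ∈ A i) (ha' : a' ∈ A i)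
    (hy : Tail E A i y) (hy' : Tail E A i y') (h : a * y = a' * y') : a⁻¹ * a' ∈ E := by
  by_contra hn
  obtain ⟨l, n, h1⟩ := hy'.rp H.le (mul_mem (inv_mem ha) ha') hn
  have : a⁻¹ * a' * y' = y := by rw [mul_assoc, ← h]; group
  rw [this] at h1
  rcases hy with h2 | ⟨k, l', m, hk, h2⟩
  · exact H.red _ _ _ _ h1 h2
  · exact hk (H.fst_idx h2 h1)

/-- words in blocks -/
inductive RW {ix : Type w} (d : ix → P) : ix → P → Prop
  | one (k : ix) (m : ℤ) : m ≠ 0 → RW d k (d k ^ m)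
  | cons (k : ix) (m : ℤ) (l : ix) (r : P) : m ≠ 0 → k ≠ l → RW d l r → RW d k (d k ^ m * r)

theorem RW.mul_step {ix : Type w} {d : ix → P} {k : ix} {x : P} (h : RW d k x) (i : ix) (m : ℤ) :
    d i ^ m * x = 1 ∨ ∃ l, RW d l (d i ^ m * x) := by
  by_cases hm : m = 0
  · subst hm; right; exact ⟨k, by simpa using h⟩
  by_cases hik : i = k
  · subst hik
    cases h with
    | one _ m' hm' =>
      rw [← zpow_add]
      by_cases h0 : m + m' = 0
      · left; rw [h0, zpow_zero]
      · right; exact ⟨i, RW.one i _ h0⟩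
    | cons _ m' l r hm' hkl hr =>
      rw [← mul_assoc, ← zpow_add]
      right
      by_cases h0 : m + m' = 0
      · exact ⟨l, by simpa [h0] using hr⟩
      · exact ⟨i, RW.cons i _ l r h0 hkl hr⟩
  · right; exact ⟨i, RW.cons i m k x hm hik h⟩

theorem RW.cover {ix : Type w} {d : ix → P} {x : P} (h : x ∈ Subgroup.closure (Set.range d)) :
    x = 1 ∨ ∃ k, RW d k x := by
  have key : ∀ i (m : ℤ), m ≠ 0 → ∀ y, (y = 1 ∨ ∃ k, RW d k y) → (d i ^ m * y = 1 ∨ ∃ k, RW d k (d i ^ m * y)) := by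
    rintro i m hm y (rfl | ⟨k, hk⟩)
    · right; rw [mul_one]; exact ⟨i, RW.one i m hm⟩
    · exact hk.mul_step i m
  induction h using Subgroup.closure_induction_left with
  | one => exact Or.inl rfl
  | mul_left x hx y hy ih =>
    obtain ⟨i, rfl⟩ := hx
    simpa using key i 1 one_ne_zero y ih
  | inv_mul_cancel x hx y hy ih =>
    obtain ⟨i, rfl⟩ := hx
    simpa using key i (-1) (by norm_num) y ih

theorem RW.map {ix : Type w} {d : ix → P} {k : ix} {x : P} (h : RW d k x) {P' : Type*} [Group P'] (f : P →* P') :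
    RW (fun i => f (d i)) k (f x) := by
  induction h with
  | one k m hm => rw [map_zpow]; exact RW.one k m hm
  | cons k m l r hm hkl _ ih => rw [map_mul, map_zpow]; exact RW.cons k m l _ hm hkl ih

theorem RW.mem {ix : Type w} {d : ix → P} {k : ix} {x : P} (h : RW d k x) : x ∈ Subgroup.closure (Set.range d) := by
  induction h with
  | one k m hm => exact zpow_mem (Subgroup.subset_closure (Set.mem_range_self k)) _
  | cons k m l r hm hkl _ ih => exact mul_mem (zpow_mem (Subgroup.subset_closure (Set.mem_range_self k)) _) ih

end Pm

section Pm2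
variable {P : Type u} [Group P] {E : Subgroup P} {A : Bool → Subgroup P} {Q : Subgroup P} {ix : Type v}

/-- `A true` plays the abelian vertex group, `A false` the other -/
structure Blk (E : Subgroup P) (A : Bool → Subgroup P) (Q : Subgroup P) (v : ix → P) (c : P) : Prop where
  am : IsAmalg E A Q
  cm : c ∈ A false
  cpow : ∀ m : ℤ, m ≠ 0 → c ^ m ∉ E
  vm : ∀ i, v i ∈ A true
  vE : ∀ i, v i ∉ E
  vv : ∀ i j, i ≠ j → (v i)⁻¹ * v j ∉ E
  cconj : ∀ y ∈ A false, y * c * y⁻¹ ∉ E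
  v3 : ∀ u : Fin 3 → ix, Function.Injective u → ∀ k : Fin 3 → ix, ∀ x ∈ A true,
    (∀ l, (v (k l))⁻¹ * (x * v (u l)) ∈ E) → x ∈ E
  comm : ∀ x ∈ A true, ∀ y ∈ A true, x * y = y * x
  cE : ∀ e ∈ E, ∀ m : ℤ, e * c * e⁻¹ = c ^ m → e = 1

abbrev RRs (v : ix → P) (c : P) : Subgroup P := Subgroup.closure (Set.range (fun i => v i * c * (v i)⁻¹))

namespace Blk
variable {v : ix → P} {c : P} (K : Blk E A Q v c)
include K


theorem rw_form {k : ix} {r : P} (h : RW (fun i => v i * c * (v i)⁻¹) k r) : ∃ (m : ℤ) (z : P) (n : ℕ), m ≠ 0 ∧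
    (v k)⁻¹ * r = c ^ m * z ∧ RP E A true true n z ∧ (z ∈ A true → r = v k * c ^ m * (v k)⁻¹ ∧ z = (v k)⁻¹) := by
  induction h with
  | one k m hm =>
    refine ⟨m, (v k)⁻¹, 1, hm, ?_, RP.single (inv_mem (K.vm k)) (by simpa using K.vE k), fun _ => ⟨?_, rfl⟩⟩
    · rw [conj_zpow]; group
    · rw [conj_zpow]
  | cons k m l r hm hkl hr ih =>
    obtain ⟨m', z', n, hm', e, hz', _⟩ := ih
    have h1 : RP E A false true (n+1) (c ^ m' * z') :=
      RP.cons (zpow_mem K.cm _) (K.cpow _ hm') (by simp) hz'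
    have h2 : RP E A true true (n+1+1) ((v k)⁻¹ * v l * (c ^ m' * z')) :=
      RP.cons (mul_mem (inv_mem (K.vm k)) (K.vm l)) (K.vv _ _ hkl) (by simp) h1
    refine ⟨m, _, _, hm, ?_, h2, fun hz => absurd hz (K.am.not_mem h2 (by omega))⟩
    rw [← e, conj_zpow]; group

theorem rw_rp {k : ix} {r : P} (h : RW (fun i => v i * c * (v i)⁻¹) k r) : ∃ n, RP E A false true n ((v k)⁻¹ * r) := by
  obtain ⟨m, z, n, hm, e, hz, _⟩ := K.rw_form h
  exact ⟨n+1, by rw [e]; exact RP.cons (zpow_mem K.cm _) (K.cpow _ hm) (by simp) hz⟩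

theorem rw_rp' {k : ix} {r : P} (h : RW (fun i => v i * c * (v i)⁻¹) k r) {x : P} (hx : x ∈ A true)
    (hxv : x * v k ∉ E) : ∃ n, RP E A true true n (x * r) := by
  obtain ⟨n, hn⟩ := K.rw_rp h
  refine ⟨n+1, ?_⟩
  have : x * r = (x * v k) * ((v k)⁻¹ * r) := by group
  rw [this]
  exact RP.cons (mul_mem hx (K.vm k)) hxv (by simp) hn

theorem rw_ne {k : ix} {r : P} (h : RW (fun i => v i * c * (v i)⁻¹) k r) : r ∉ A false := by
  obtain ⟨n, hn⟩ := K.rw_rp' h (one_mem _) (by simpa using K.vE k)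
  rw [one_mul] at hn
  exact K.am.not_mem' hn (by simp)

theorem injD : Function.Injective (FreeGroup.lift (fun i => v i * c * (v i)⁻¹)) := by
  rw [injective_iff_map_eq_one]
  intro w hw
  have : w ∈ Subgroup.closure (Set.range (FreeGroup.of : ix → _)) := by
    rw [FreeGroup.closure_range_of]; trivial
  rcases RW.cover this with h | ⟨k, hk⟩
  · exact h
  · exfalso
    have := hk.map (FreeGroup.lift (fun i => v i * c * (v i)⁻¹))
    simp only [FreeGroup.lift_apply_of, hw] at this
    exact K.rw_ne this (one_mem _)

/-- `s` in the abelian vertex group -/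
theorem sV {s y : P} (hs : s ∈ A true) (hy : y ∈ A false) (hyE : y ∉ E)
    (h : s * y * s⁻¹ ∈ RRs v c) : ∃ k, (v k)⁻¹ * s ∈ E := by
  rcases RW.cover h with h | ⟨k, hk⟩
  · exfalso; apply hyE
    have : y = 1 := by simpa using h
    rw [this]; exact one_mem _
  refine ⟨k, ?_⟩
  by_contra hn
  have hn' : s⁻¹ * v k ∉ E := fun h => hn (by simpa using inv_mem h)
  obtain ⟨n, hr⟩ := K.rw_rp' hk (inv_mem hs) hn'
  have e : s⁻¹ * (s * y * s⁻¹) = y * s⁻¹ := by group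
  rw [e] at hr
  have : Tail E A false s⁻¹ := by
    by_cases hsE : s⁻¹ ∈ E
    · exact Or.inl hsE
    · exact Tail.of (RP.single (inv_mem hs) hsE) (by simp)
  obtain ⟨l, n', h2⟩ := this.rp K.am.le hy hyE
  simpa using K.am.fst_idx hr h2

/-- peeling off the first two syllables -/
theorem sP {v0 y0 s'' y : P} {n : ℕ} (hv : v0 ∈ A true) (hvE : v0 ∉ E) (hy0 : y0 ∈ A false) (hy0E : y0 ∉ E)
    (hs : RP E A true true n s'') (hy : y ∈ A false) (hyE : y ∉ E)
    (h : (v0 * y0 * s'') * y * (v0 * y0 * s'')⁻¹ ∈ RRs v c) :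
    ∃ k e', (v k)⁻¹ * v0 ∈ E ∧ e' ∈ E ∧ ∃ ρ ∈ RRs v c, ρ * (v0 * y0 * s'') = v k * e' * s'' := by
  have hs1 : RP E A false true (n+1) (y0 * s'') := RP.cons hy0 hy0E (by simp) hs
  have hs2 : RP E A true true (n+1+1) (v0 * (y0 * s'')) := RP.cons hv hvE (by simp) hs1
  have htail : RP E A true true _ (s'' * y * (v0 * (y0 * s''))⁻¹) :=
    (hs.mul (RP.single hy hyE) (by simp)).mul hs2.inv (by simp)
  rcases RW.cover h with h1 | ⟨k, hk⟩
  · exfalso; apply hyE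
    have : y = 1 := conj_eq_one_iff.1 h1
    rw [this]; exact one_mem _
  have hkE : (v k)⁻¹ * v0 ∈ E := by
    by_contra hn
    have hn' : v0⁻¹ * v k ∉ E := fun h => hn (by simpa using inv_mem h)
    obtain ⟨n, hr⟩ := K.rw_rp' hk (inv_mem hv) hn'
    have e : v0⁻¹ * ((v0 * y0 * s'') * y * (v0 * y0 * s'')⁻¹) = y0 * (s'' * y * (v0 * (y0 * s''))⁻¹) := by group
    rw [e] at hr
    have := RP.cons hy0 hy0E (by simp) htail
    simpa using K.am.fst_idx hr this
  obtain ⟨m, z, n', hm, e, hz, _⟩ := K.rw_form hk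
  have e2 : c ^ m * z = ((v k)⁻¹ * v0 * y0) * (s'' * y * (v0 * (y0 * s''))⁻¹) := by
    rw [← e]; group
  have h3 := K.am.cmp (zpow_mem K.cm m) (mul_mem (K.am.le _ hkE) hy0) (Tail.of hz (by simp)) (Tail.of htail (by simp)) e2
  refine ⟨k, _, hkE, h3, (v k * c * (v k)⁻¹) ^ (-m), zpow_mem (Subgroup.subset_closure (Set.mem_range_self k)) _, ?_⟩
  rw [conj_zpow]; group

theorem sY {s y : P} (hs : s ∈ A false) (hy : y ∈ A false) (hyE : y ∉ E) (h : s * y * s⁻¹ ∈ RRs v c) : False := by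
  rcases RW.cover h with h1 | ⟨k, hk⟩
  · apply hyE
    have : y = 1 := conj_eq_one_iff.1 h1
    rw [this]; exact one_mem _
  · exact K.rw_ne hk (mul_mem (mul_mem hs hy) (inv_mem hs))

theorem vmul {x s : P} {n : ℕ} {j : Bool} (hx : x ∈ A true) (hs : RP E A true j n s) :
    x * s ∈ E ∨ ∃ i m, m ≤ n ∧ RP E A i j m (x * s) := by
  cases hs with
  | single h1 h2 =>
    by_cases h : x * s ∈ E
    · exact Or.inl h
    · exact Or.inr ⟨_, 1, le_rfl, RP.single (mul_mem hx h1) h⟩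
  | @cons _ j' _ n a b h1 h2 h3 h4 =>
    right
    by_cases h : x * a ∈ E
    · exact ⟨_, n, by omega, by rw [← mul_assoc]; exact h4.mulE K.am.le h⟩
    · exact ⟨_, n+1, le_rfl, by rw [← mul_assoc]; exact RP.cons (mul_mem hx h1) h h3 h4⟩

theorem main1 (n : ℕ) : ∀ (s y : P) (i : Bool), RP E A i true n s → y ∈ A false → y ∉ E → s * y * s⁻¹ ∈ RRs v c →
    ∃ ρ ∈ RRs v c, ∃ k, (v k)⁻¹ * (ρ * s) ∈ A false := by
  induction n using Nat.strong_induction_on with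
  | _ n ih =>
  intro s y i hs hy hyE h
  cases hs with
  | single h1 h2 =>
    obtain ⟨k, hk⟩ := K.sV h1 hy hyE h
    exact ⟨1, one_mem _, k, by rw [one_mul]; exact K.am.le _ hk⟩
  | @cons _ j _ n a s' h1 h2 h3 h4 =>
    cases i with
    | false =>
      exfalso
      have h5 := RP.cons h1 h2 h3 h4
      have h6 : RP E A false false _ (a * s' * y * (a * s')⁻¹) := (h5.mul (RP.single hy hyE) (by simp)).mul h5.inv (by simp)
      rcases RW.cover h with h7 | ⟨k, hk⟩
      · exact K.am.red _ _ _ _ h6 (by rw [h7]; exact one_mem _)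
      · obtain ⟨n, hn⟩ := K.rw_rp' hk (one_mem _) (by simpa using K.vE k)
        rw [one_mul] at hn
        simpa using K.am.fst_idx hn h6
    | true =>
      obtain rfl : j = false := by simpa using h3.symm
      cases h4 with
      | @cons _ j' _ n y0 s'' h5 h6 h7 h8 =>
        obtain rfl : j' = true := by simpa using h7.symm
        rw [← mul_assoc] at h
        obtain ⟨k, e', hk, he', ρ, hρ, e⟩ := K.sP h1 h2 h5 h6 h8 hy hyE h
        have h9 : (v k * e' * s'') * y * (v k * e' * s'')⁻¹ ∈ RRs v c := by
          rw [← e]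
          have := mul_mem (mul_mem hρ h) (inv_mem hρ)
          convert this using 1; group
        rcases K.vmul (mul_mem (K.vm k) (K.am.le _ he')) h8 with h10 | ⟨i', m, hm, h10⟩
        · exact (K.sY (K.am.le _ h10) hy hyE h9).elim
        · obtain ⟨ρ', hρ', k', hk'⟩ := ih m (by omega) _ y i' h10 hy hyE h9
          refine ⟨ρ' * ρ, mul_mem hρ' hρ, k', ?_⟩
          rw [← mul_assoc a, mul_assoc ρ', e]
          exact hk'

theorem main2 {s : P} (hs : s ∈ Q) (h : s * c * s⁻¹ ∈ RRs v c) : ∃ ρ ∈ RRs v c, ∃ k, (v k)⁻¹ * (ρ * s) ∈ A false := by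
  have hcE : c ∉ E := by simpa using K.cpow 1 one_ne_zero
  rcases K.am.dich hs with h1 | ⟨i, j, n, h1⟩
  · exact (K.sY (K.am.le _ h1) K.cm hcE h).elim
  cases j with
  | true => exact K.main1 n s c i h1 K.cm hcE h
  | false =>
    rcases h1.snoc_cases with ⟨_, _, h2, _⟩ | ⟨k, m, s', a, rfl, _, hs', hk, ha, _⟩
    · exact (K.sY h2 K.cm hcE h).elim
    · obtain rfl : k = true := by simpa using hk
      obtain ⟨ρ, hρ, k, hk⟩ := K.main1 m s' (a * c * a⁻¹) i hs' (mul_mem (mul_mem ha K.cm) (inv_mem ha)) (K.cconj a ha)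
        (by convert h using 1; group)
      refine ⟨ρ, hρ, k, ?_⟩
      have := mul_mem hk ha
      simpa [mul_assoc] using this

theorem pmQ {t : P} (ht : t ∈ Q) (u : Fin 3 → ix) (hu : Function.Injective u)
    (h : ∀ k, t * (v (u k) * c * (v (u k))⁻¹) * t⁻¹ ∈ RRs v c) : t ∈ RRs v c := by
  have hcE : c ∉ E := by simpa using K.cpow 1 one_ne_zero
  have conj : ∀ {ρ : P}, ρ ∈ RRs v c → (∀ k, (ρ * t) * (v (u k) * c * (v (u k))⁻¹) * (ρ * t)⁻¹ ∈ RRs v c) := by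
    intro ρ hρ k
    have := mul_mem (mul_mem hρ (h k)) (inv_mem hρ)
    convert this using 1; group
  -- reduce to the abelian vertex group
  have stepV : ∃ ρ ∈ RRs v c, ρ * t ∈ A true := by
    obtain ⟨ρ, hρ, k, hk⟩ := K.main2 (s := t * v (u 0)) (mul_mem ht (K.am.leQ _ (K.vm _)))
      (by convert h 0 using 1; group)
    set y0 := (v k)⁻¹ * (ρ * (t * v (u 0))) with hy0
    have e0 : ρ * t = v k * y0 * (v (u 0))⁻¹ := by rw [hy0]; group
    by_cases hy : y0 ∈ E
    · exact ⟨ρ, hρ, by rw [e0]; exact mul_mem (mul_mem (K.vm k) (K.am.le _ hy)) (inv_mem (K.vm _))⟩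
    have h01 : (v (u 0))⁻¹ * v (u 1) ∉ E := K.vv _ _ (fun e => by simpa using hu e)
    have hs'' : RP E A true true 1 ((v (u 0))⁻¹ * v (u 1)) :=
      RP.single (mul_mem (inv_mem (K.vm _)) (K.vm _)) h01
    obtain ⟨k', e', hk', he', ρ', hρ', e⟩ := K.sP (K.vm k) (K.vE k) hk hy hs'' K.cm hcE (by
      have := conj hρ 1
      rw [e0] at this
      convert this using 1; group)
    refine ⟨ρ' * ρ, mul_mem hρ' hρ, ?_⟩
    have : ρ' * ρ * t = v k' * e' * (v (u 0))⁻¹ := by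
      rw [mul_assoc, e0]
      calc _ = ρ' * (v k * y0 * ((v (u 0))⁻¹ * v (u 1))) * (v (u 1))⁻¹ := by group
        _ = _ := by rw [e]; group
    rw [this]
    exact mul_mem (mul_mem (K.vm _) (K.am.le _ he')) (inv_mem (K.vm _))
  obtain ⟨ρ, hρ, hx⟩ := stepV
  set x := ρ * t with hxdef
  have h2 : ∀ l, x * v (u l) * c * (x * v (u l))⁻¹ ∈ RRs v c := fun l => by
    have := conj hρ l; rw [← hxdef] at this; convert this using 1; group
  have h3 : ∀ l, ∃ k, (v k)⁻¹ * (x * v (u l)) ∈ E := fun l =>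
    K.sV (mul_mem hx (K.vm _)) K.cm hcE (h2 l)
  choose k hk using h3
  have hxE : x ∈ E := K.v3 u hu k x hx hk
  have hx1 : x = 1 := by
    have h4 := h2 0
    rw [K.comm x hx _ (K.vm _)] at h4
    have hxc : x * c * x⁻¹ ∉ E := K.cconj x (K.am.le _ hxE)
    have hxcm : x * c * x⁻¹ ∈ A false := mul_mem (mul_mem (K.am.le _ hxE) K.cm) (inv_mem (K.am.le _ hxE))
    rcases RW.cover h4 with h5 | ⟨k, hk⟩
    · have : c = 1 := conj_eq_one_iff.1 h5
      exact (hcE (this ▸ one_mem _)).elim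
    have hkk : k = u 0 := by
      by_contra hne
      obtain ⟨n, hr⟩ := K.rw_rp' hk (inv_mem (K.vm (u 0))) (K.vv _ _ (Ne.symm hne))
      have e : (v (u 0))⁻¹ * (v (u 0) * x * c * (v (u 0) * x)⁻¹) = x * c * x⁻¹ * (v (u 0))⁻¹ := by group
      rw [e] at hr
      have := K.am.fst_idx hr (RP.cons hxcm hxc (by simp) (RP.single (inv_mem (K.vm (u 0))) (by simpa using K.vE (u 0))) : RP E A false true 2 _)
      simp at this
    subst hkk
    obtain ⟨m, z, n, hm, e, hz, hz2⟩ := K.rw_form hk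
    have e2 : c ^ m * z = x * c * x⁻¹ * (v (u 0))⁻¹ := by rw [← e]; group
    have hv1 : RP E A true true 1 (v (u 0))⁻¹ := RP.single (inv_mem (K.vm (u 0))) (by simpa using K.vE (u 0))
    have h6 := K.am.cmp (zpow_mem K.cm m) hxcm (Tail.of hz (by simp)) (Tail.of hv1 (by simp)) e2
    have h7 : z ∈ A true := by
      have : z = (c ^ m)⁻¹ * (x * c * x⁻¹) * (v (u 0))⁻¹ := by rw [mul_assoc, ← e2]; group
      rw [this]; exact mul_mem (K.am.le _ h6) (inv_mem (K.vm _))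
    obtain ⟨h8, h9⟩ := hz2 h7
    rw [h9] at e2
    exact K.cE x hxE m (mul_right_cancel e2).symm
  have : t = ρ⁻¹ := by
    rw [hxdef, mul_eq_one_iff_inv_eq] at hx1; exact hx1.symm
  rw [this]; exact inv_mem hρ

end Blk
end Pm2
end EmbThm

namespace EmbThm
universe u v w
section Rg

theorem dih_half {q : ℕ} (hq : q.Prime) (h2 : q ≠ 2) (k : ZMod q) : ∃ i : ZMod q, 2 * i = k := by
  have : Fact q.Prime := ⟨hq⟩
  have h : (2 : ZMod q) ≠ 0 := by
    intro h
    have : ((2 : ℕ) : ZMod q) = 0 := by exact_mod_cast h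
    rw [ZMod.natCast_eq_zero_iff] at this
    have h4 := (Nat.prime_dvd_prime_iff_eq hq Nat.prime_two).1 this
    exact h2 h4
  exact ⟨2⁻¹ * k, by rw [← mul_assoc, mul_inv_cancel₀ h, one_mul]⟩

theorem dih_refl_conj {q : ℕ} (hq : q.Prime) (h2 : q ≠ 2) (k : ZMod q) :
    ∃ y : DihedralGroup q, y * DihedralGroup.sr k * y⁻¹ = DihedralGroup.sr 0 := by
  obtain ⟨i, hi⟩ := dih_half hq h2 k
  refine ⟨DihedralGroup.r i, ?_⟩
  simp only [DihedralGroup.inv_r, DihedralGroup.r_mul_sr, DihedralGroup.sr_mul_r]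
  congr 1
  rw [← hi]; ring

theorem dih_invol {q : ℕ} (hq : q.Prime) (h2 : q ≠ 2) {x : DihedralGroup q} (hx : x * x = 1) (hx1 : x ≠ 1) :
    ∃ k, x = DihedralGroup.sr k := by
  cases x with
  | sr k => exact ⟨k, rfl⟩
  | r k =>
    exfalso
    rw [DihedralGroup.r_mul_r, DihedralGroup.one_def, DihedralGroup.r.injEq] at hx
    apply hx1
    obtain ⟨i, hi⟩ := dih_half hq h2 1
    have : k = 0 := by
      calc k = (2 * i) * k := by rw [hi, one_mul]
        _ = i * (k + k) := by ring
        _ = 0 := by rw [hx, mul_zero]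
    rw [this]; rfl

theorem dih_ord {q p : ℕ} (hq : q.Prime) (hp : p.Prime) (h2 : p ≠ 2) {x : DihedralGroup q} (hx : orderOf x = p) :
    p = q ∧ ∃ m, m ≠ 0 ∧ x = DihedralGroup.r m := by
  cases x with
  | sr k => rw [DihedralGroup.orderOf_sr] at hx; exact absurd hx.symm h2
  | r k =>
    have h1 : orderOf (DihedralGroup.r k) ∣ q := by
      apply orderOf_dvd_of_pow_eq_one
      rw [DihedralGroup.r_pow]
      simp
    rw [hx] at h1
    refine ⟨(Nat.prime_dvd_prime_iff_eq hp hq).1 h1, k, ?_, rfl⟩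
    rintro rfl
    have : orderOf (1 : DihedralGroup q) = p := hx
    rw [orderOf_one] at this
    exact hp.one_lt.ne this

structure RigData {B : Type u} [Group B] (V Gs : Subgroup B) {Λ : Type v} (p : Λ → ℕ)
    (δ : ∀ j, DihedralGroup (p j) →* B) : Prop where
  vc : ∀ x ∈ V, ∀ y ∈ V, x * y = y * x
  v2 : ∀ x ∈ V, x * x = 1
  vmal : ∀ x ∈ V, x ≠ 1 → ∀ h, h * x * h⁻¹ ∈ V → h ∈ V
  vne : ∃ x ∈ V, x ≠ 1
  gV : ∀ g ∈ Gs, g ≠ 1 → ∀ h, h * g * h⁻¹ ∉ V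
  card : ∀ f : V → Gs, ¬ Function.Injective f
  pp : ∀ j, (p j).Prime
  p2 : ∀ j, p j ≠ 2
  δi : ∀ j, Function.Injective (δ j)
  δv : ∀ j, δ j (DihedralGroup.sr 0) ∈ V
  dmal : ∀ j k, k ≠ 0 → ∀ h, h * δ j (DihedralGroup.r k) * h⁻¹ ∈ (δ j).range → h ∈ (δ j).range
  tors : ∀ b : B, IsOfFinOrder b → ∃ h, h * b * h⁻¹ ∈ V ∨ h * b * h⁻¹ ∈ Gs ∨ ∃ j, h * b * h⁻¹ ∈ (δ j).range

theorem RigData.main {B : Type u} [Group B] {V Gs : Subgroup B} {Λ : Type v} {p : Λ → ℕ}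
    {δ : ∀ j, DihedralGroup (p j) →* B} (R : RigData V Gs p δ) (H : Type w) [Group H] (ι : B →* H) (ιi : Function.Injective ι)
    (htors : ∀ h : H, IsOfFinOrder h → ∃ k, k * h * k⁻¹ ∈ ι.range)
    (tmal : ∀ b : B, IsOfFinOrder b → b ≠ 1 → ∀ h, h * ι b * h⁻¹ ∈ ι.range → h ∈ ι.range)
    (gmal : ∀ g ∈ Gs, g ≠ 1 → ∀ h, h * ι g * h⁻¹ ∈ Gs.map ι → h ∈ Gs.map ι)
    (β : H →* H) (hβ : Function.Injective β) :
    ∃ h : H, (∀ v ∈ V, ∃ w ∈ V, β (ι v) = h * ι w * h⁻¹) ∧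
      ∀ j, ∃ j', p j' = p j ∧ β (ι (δ j (DihedralGroup.sr 0))) = h * ι (δ j' (DihedralGroup.sr 0)) * h⁻¹ ∧
        ∃ x ∈ V, ∃ m, m ≠ 0 ∧ β (ι (δ j (DihedralGroup.r 1))) = h * ι (x * δ j' (DihedralGroup.r m) * x⁻¹) * h⁻¹ := by
  have vfin : ∀ v ∈ V, IsOfFinOrder v := fun v hv =>
    isOfFinOrder_iff_pow_eq_one.2 ⟨2, by norm_num, by rw [pow_two]; exact R.v2 v hv⟩
  have vmalH : ∀ v ∈ V, v ≠ 1 → ∀ h, h * ι v * h⁻¹ ∈ V.map ι → h ∈ V.map ι := by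
    rintro v hv hv1 h ⟨w, hw, e⟩
    obtain ⟨h', rfl⟩ := tmal v (vfin v hv) hv1 h ⟨w, e⟩
    have : w = h' * v * h'⁻¹ := ιi (by simpa using e)
    exact ⟨h', R.vmal v hv hv1 h' (this ▸ hw), rfl⟩
  -- images of `V` under conjugates of `β` avoid `Gs`
  have noG : ∀ v ∈ V, v ≠ 1 → ∀ k, k * β (ι v) * k⁻¹ ∉ Gs.map ι := by
    rintro v hv hv1 k ⟨g, hg, e⟩
    have hg1 : g ≠ 1 := by
      rintro rfl
      rw [map_one, eq_comm, conj_eq_one_iff] at e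
      exact hv1 (ιi (hβ (by rw [e, map_one, map_one])))
    have h1 : ∀ w ∈ V, ∃ g' ∈ Gs, ι g' = k * β (ι w) * k⁻¹ := by
      intro w hw
      have : k * β (ι w) * k⁻¹ ∈ Gs.map ι := by
        refine gmal g hg hg1 _ ?_
        have h2 : k * β (ι w) * k⁻¹ * ι g * (k * β (ι w) * k⁻¹)⁻¹ = ι g := by
          rw [e]
          calc _ = k * (β (ι w) * β (ι v) * (β (ι w))⁻¹) * k⁻¹ := by group
            _ = _ := by
              rw [← map_mul, ← map_mul, R.vc w hw v hv, map_mul, map_mul, mul_inv_cancel_right]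
        rw [h2]; exact ⟨g, hg, rfl⟩
      exact this
    choose f hf1 hf2 using h1
    refine R.card (fun w => ⟨f w.1 w.2, hf1 w.1 w.2⟩) fun a b hab => ?_
    have h3 : f a.1 a.2 = f b.1 b.2 := congrArg Subtype.val hab
    have h4 := congrArg ι h3
    rw [hf2, hf2, mul_left_inj, mul_right_inj] at h4
    exact Subtype.ext (ιi (hβ h4))
  have toV : ∀ v ∈ V, v ≠ 1 → ∃ k, k * β (ι v) * k⁻¹ ∈ V.map ι := by
    intro v hv hv1
    obtain ⟨k, b, e⟩ := htors (β (ι v)) (β.isOfFinOrder (ι.isOfFinOrder (vfin v hv)))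
    have hb2 : b * b = 1 := ιi (by
      rw [map_mul, e, map_one]
      calc _ = k * (β (ι v) * β (ι v)) * k⁻¹ := by group
        _ = 1 := by rw [← map_mul, ← map_mul, R.v2 v hv]; simp)
    have hb1 : b ≠ 1 := by
      rintro rfl
      rw [map_one, eq_comm, conj_eq_one_iff] at e
      exact hv1 (ιi (hβ (by rw [e, map_one, map_one])))
    obtain ⟨h, hh⟩ := R.tors b (isOfFinOrder_iff_pow_eq_one.2 ⟨2, by norm_num, by rw [pow_two]; exact hb2⟩)
    have conjE : ∀ h : B, ι (h * b * h⁻¹) = (ι h * k) * β (ι v) * (ι h * k)⁻¹ := by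
      intro h; rw [map_mul, map_mul, e, map_inv]; group
    rcases hh with hh | hh | ⟨j, z, hz⟩
    · exact ⟨ι h * k, _, hh, conjE h⟩
    · exact (noG v hv hv1 (ι h * k) ⟨_, hh, conjE h⟩).elim
    · have hz2 : z * z = 1 := R.δi j (by
        rw [map_mul, hz, map_one]
        calc _ = h * (b * b) * h⁻¹ := by group
          _ = 1 := by rw [hb2]; simp)
      have hz1 : z ≠ 1 := by
        rintro rfl
        rw [map_one, eq_comm, conj_eq_one_iff] at hz
        exact hb1 hz
      obtain ⟨i, rfl⟩ := dih_invol (R.pp j) (R.p2 j) hz2 hz1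
      obtain ⟨y, hy⟩ := dih_refl_conj (R.pp j) (R.p2 j) i
      refine ⟨ι (δ j y * h) * k, _, R.δv j, ?_⟩
      rw [← conjE, ← hy]
      congr 1
      simp only [map_mul, map_inv, hz]; group
  obtain ⟨v1, hv1, hv11⟩ := R.vne
  obtain ⟨k, w1, hw1, e1⟩ := toV v1 hv1 hv11
  have hw11 : w1 ≠ 1 := by
    rintro rfl
    rw [map_one, eq_comm, conj_eq_one_iff] at e1
    exact hv11 (ιi (hβ (by rw [e1, map_one, map_one])))
  have allV : ∀ v ∈ V, ∃ w ∈ V, ι w = k * β (ι v) * k⁻¹ := by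
    intro v hv
    refine vmalH w1 hw1 hw11 _ ?_
    have h2 : k * β (ι v) * k⁻¹ * ι w1 * (k * β (ι v) * k⁻¹)⁻¹ = ι w1 := by
      rw [e1]
      calc _ = k * (β (ι v) * β (ι v1) * (β (ι v))⁻¹) * k⁻¹ := by group
        _ = _ := by
          rw [← map_mul, ← map_mul, R.vc v hv v1 hv1, map_mul, map_mul, mul_inv_cancel_right]
    rw [h2]; exact ⟨w1, hw1, rfl⟩
  refine ⟨k⁻¹, fun v hv => ?_, fun j => ?_⟩
  · obtain ⟨w, hw, e⟩ := allV v hv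
    exact ⟨w, hw, by rw [e]; group⟩
  have hsr : (DihedralGroup.sr 0 : DihedralGroup (p j)) ≠ 1 := by
    rw [DihedralGroup.one_def]; intro h; cases h
  have hv0 : δ j (DihedralGroup.sr 0) ≠ 1 := fun e => hsr (R.δi j (e.trans (map_one _).symm))
  obtain ⟨w, hw, ew⟩ := allV _ (R.δv j)
  have hw0 : w ≠ 1 := by
    rintro rfl
    rw [map_one, eq_comm, conj_eq_one_iff] at ew
    exact hv0 (ιi (hβ (by rw [ew, map_one, map_one])))
  set ρ := δ j (DihedralGroup.r 1) with hρ
  have hord : orderOf (k * β (ι ρ) * k⁻¹) = p j := by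
    have h1 : orderOf ((MulAut.conj k) (β (ι ρ))) = orderOf ρ := by
      rw [(MulAut.conj k).orderOf_eq, orderOf_injective β hβ, orderOf_injective ι ιi]
    rw [MulAut.conj_apply] at h1
    rw [h1, hρ, orderOf_injective (δ j) (R.δi j), DihedralGroup.orderOf_r_one]
  have hpos : 0 < p j := (R.pp j).pos
  obtain ⟨k2, b, eb⟩ := htors (k * β (ι ρ) * k⁻¹) (orderOf_pos_iff.1 (by rw [hord]; exact hpos))
  have hbord : orderOf b = p j := by
    rw [← orderOf_injective ι ιi, eb, ← MulAut.conj_apply, (MulAut.conj k2).orderOf_eq, hord]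
  have hbfin : IsOfFinOrder b := orderOf_pos_iff.1 (by rw [hbord]; exact hpos)
  obtain ⟨h, hh⟩ := R.tors b hbfin
  set b' := h * b * h⁻¹ with hb'
  have hb'ord : orderOf b' = p j := by
    rw [hb', ← MulAut.conj_apply, (MulAut.conj h).orderOf_eq, hbord]
  have hb'1 : b' ≠ 1 := by
    intro e; rw [e, orderOf_one] at hb'ord; exact (R.pp j).one_lt.ne hb'ord
  set K := ι h * k2 with hK
  have eb' : ι b' = K * (k * β (ι ρ) * k⁻¹) * K⁻¹ := by
    rw [hb', map_mul, map_mul, eb, map_inv, hK]; group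
  -- the image of the reflection inverts `b'`
  have hrefl : DihedralGroup.sr 0 * DihedralGroup.r 1 * (DihedralGroup.sr 0)⁻¹ = (DihedralGroup.r 1 : DihedralGroup (p j))⁻¹ := by
    simp [DihedralGroup.sr_mul_r, DihedralGroup.inv_sr, DihedralGroup.sr_mul_sr, DihedralGroup.inv_r]
  have hinv : (K * ι w * K⁻¹) * ι b' * (K * ι w * K⁻¹)⁻¹ = ι b'⁻¹ := by
    have h1 := congrArg (fun z => β (ι (δ j z))) hrefl
    simp only [map_mul, map_inv] at h1
    rw [map_inv, eb', ew]
    calc _ = K * (k * (β (ι (δ j (DihedralGroup.sr 0))) * β (ι (δ j (DihedralGroup.r 1))) * (β (ι (δ j (DihedralGroup.sr 0))))⁻¹) * k⁻¹) * K⁻¹ := by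
            rw [hρ]; group
      _ = _ := by rw [h1, hρ]; group
  rcases hh with hh | hh | ⟨j', z, hz⟩
  · exfalso
    have h1 : orderOf b' ∣ 2 := orderOf_dvd_of_pow_eq_one (by rw [pow_two]; exact R.v2 _ hh)
    rw [hb'ord] at h1
    exact R.p2 j ((Nat.prime_dvd_prime_iff_eq (R.pp j) Nat.prime_two).1 h1)
  · exfalso
    obtain ⟨g, hg, eg⟩ := gmal b' hh hb'1 (K * ι w * K⁻¹) (by rw [hinv]; exact ⟨_, inv_mem hh, rfl⟩)
    refine noG _ (R.δv j) hv0 (K * k) ⟨g, hg, ?_⟩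
    rw [eg, ew]; group
  · have hzord : orderOf z = p j := by rw [← orderOf_injective (δ j') (R.δi j'), hz, hb'ord]
    obtain ⟨hpp, m, hm, rfl⟩ := dih_ord (R.pp j') (R.pp j) (R.p2 j) hzord
    have hb'fin : IsOfFinOrder b' := orderOf_pos_iff.1 (by rw [hb'ord]; exact hpos)
    obtain ⟨s, hs⟩ := tmal b' hb'fin hb'1 _ (by rw [hinv]; exact ⟨_, rfl⟩)
    have hs1 : s * b' * s⁻¹ = b'⁻¹ := ιi (by rw [map_mul, map_mul, map_inv, hs]; exact hinv)
    obtain ⟨z', rfl⟩ := R.dmal j' m hm s (by rw [hz, hs1, ← hz]; exact inv_mem ⟨_, rfl⟩)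
    have hz'2 : z' * z' = 1 := R.δi j' (ιi (by
      rw [map_mul, map_mul, hs, map_one, map_one]
      calc _ = K * (ι w * ι w) * K⁻¹ := by group
        _ = 1 := by rw [← map_mul, R.v2 w hw]; simp))
    have hz'1 : z' ≠ 1 := by
      rintro rfl
      rw [map_one, map_one, eq_comm, conj_eq_one_iff] at hs
      exact hw0 (ιi (hs.trans (map_one _).symm))
    obtain ⟨i, rfl⟩ := dih_invol (R.pp j') (R.p2 j') hz'2 hz'1
    obtain ⟨y, hy⟩ := dih_refl_conj (R.pp j') (R.p2 j') i
    set X := ι (δ j' y) * K with hX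
    have hXw : X * ι w * X⁻¹ = ι (δ j' (DihedralGroup.sr 0)) := by
      rw [← hy]
      simp only [map_mul, map_inv, hs, hX]; group
    obtain ⟨x, hx, ex⟩ := vmalH w hw hw0 X (by rw [hXw]; exact ⟨_, R.δv j', rfl⟩)
    have hwe : w = δ j' (DihedralGroup.sr 0) := by
      apply ιi
      rw [← hXw, ← ex, ← map_mul, R.vc x hx w hw, map_mul, mul_inv_cancel_right]
    refine ⟨j', hpp.symm, by rw [← hwe, ew]; group, x⁻¹, inv_mem hx, ?_⟩
    -- conjugating a rotation by y
    have hyr : ∃ m', m' ≠ 0 ∧ y * DihedralGroup.r m * y⁻¹ = DihedralGroup.r m' := by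
      cases y with
      | r t => exact ⟨m, hm, by simp [DihedralGroup.inv_r, DihedralGroup.r_mul_r]⟩
      | sr t => exact ⟨-m, neg_ne_zero.2 hm, by simp [DihedralGroup.inv_sr, DihedralGroup.sr_mul_r, DihedralGroup.sr_mul_sr]⟩
    obtain ⟨m', hm', ey⟩ := hyr
    refine ⟨m', hm', ?_⟩
    rw [← ey]
    simp only [map_mul, map_inv, ex, hz, eb', hX, hρ]
    group

end Rg
end EmbThm

namespace EmbThm
universe u v w
section Sr
open Cardinal

structure Leaf (V : Type u) [Group V] : Type (u+1) where
  K : Type u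
  L : Type u
  gK : Group K
  gL : Group L
  f : K →* V
  g : K →* L
  fi : Function.Injective f
  gi : Function.Injective g
  mal : ∀ x : L, ∀ k, k ≠ 1 → x * g k * x⁻¹ ∈ g.range → x ∈ g.range

attribute [instance] Leaf.gK Leaf.gL

structure Star {V : Type u} [CommGroup V] {J : Type u} (Lf : J → Leaf V) {B : Type u} [Group B] (b : V →* B)
    (l : ∀ j, (Lf j).L →* B) (Q : J → Subgroup B) : Prop where
  bi : Function.Injective b
  li : ∀ j, Function.Injective (l j)
  bl : ∀ j k, b ((Lf j).f k) = l j ((Lf j).g k)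
  big : IsAmalg b.range Q ⊤
  small : ∀ j, IsAmalg (b.comp (Lf j).f).range (fun t : Bool => bif t then b.range else (l j).range) (Q j)

theorem exists_star {V : Type u} [CommGroup V] {J : Type u} (Lf : J → Leaf V) :
    ∃ (B : Type u) (_ : Group B) (b : V →* B) (l : ∀ j, (Lf j).L →* B) (Q : J → Subgroup B), Star Lf b l Q := by
  choose P iP a b ha hb hab hA using fun j => exists_amalg2 (Lf j).f (Lf j).g (Lf j).fi (Lf j).gi
  obtain ⟨B, iB, β, F, hβ, hF, hFa, hBig⟩ := exists_amalg a ha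
  have e : ∀ j, (F j).comp (a j) = β := fun j => MonoidHom.ext fun x => hFa j x
  refine ⟨B, iB, β, fun j => (F j).comp (b j), fun j => (F j).range, hβ, fun j => (hF j).comp (hb j), ?_, hBig, ?_⟩
  · intro j k
    rw [← hFa j, hab]; rfl
  · intro j
    have := (hA j).map (F j) (hF j)
    convert this using 1
    · rw [← MonoidHom.range_comp, ← MonoidHom.comp_assoc, e]
    · funext t
      cases t
      · exact MonoidHom.range_comp _ _
      · rw [← e j]; exact MonoidHom.range_comp _ _
    · exact MonoidHom.range_eq_map _

namespace Star
variable {V : Type u} [CommGroup V] {J : Type u} {Lf : J → Leaf V} {B : Type u} [Group B] {b : V →* B}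
    {l : ∀ j, (Lf j).L →* B} {Q : J → Subgroup B} (S : Star Lf b l Q)
include S

theorem card {κ : Cardinal.{u}} (hκ : ℵ₀ ≤ κ) (hV : #V ≤ κ) (hJ : #J ≤ κ) (hL : ∀ j, #(Lf j).L ≤ κ) : #B ≤ κ := by
  let g : FreeGroup (V ⊕ Σ j, (Lf j).L) →* B := FreeGroup.lift (fun o => Sum.elim b (fun x => l x.1 x.2) o)
  have hb : b.range ≤ g.range := by
    rintro _ ⟨z, rfl⟩; exact ⟨FreeGroup.of (Sum.inl z), by simp [g]⟩
  have : g.range = ⊤ := by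
    rw [eq_top_iff]
    refine S.big.gen _ hb fun j => (S.small j).gen _ ?_ ?_
    · rintro _ ⟨z, rfl⟩; exact hb ⟨_, rfl⟩
    · intro t
      cases t
      · rintro _ ⟨z, rfl⟩; exact ⟨FreeGroup.of (Sum.inr ⟨j, z⟩), by simp [g]⟩
      · exact hb
  refine (mk_le_of_surjective (MonoidHom.range_eq_top.1 this)).trans ?_
  have : Nonempty (V ⊕ Σ j, (Lf j).L) := ⟨Sum.inl 1⟩
  rw [mk_freeGroup, mk_sum, lift_id, lift_id, mk_sigma]
  refine max_le (add_le_of_le hκ hV ?_) hκ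
  refine (sum_le_sum _ (fun _ => κ) hL).trans ?_
  rw [sum_const, lift_id, lift_id]
  exact mul_le_of_le hκ hJ le_rfl

theorem vmal {v : V} (hv : v ≠ 1) {h : B} (hh : h * b v * h⁻¹ ∈ b.range) : h ∈ b.range := by
  have hbv : b v ≠ 1 := fun e => hv (S.bi (e.trans (map_one b).symm))
  refine S.big.base ?_ trivial ⟨v, rfl⟩ hbv hh
  intro j a ha e he he1 hae
  refine (S.small j).abel (i₀ := true) ?_ ?_ ha he he1 hae
  · rintro _ ⟨x, rfl⟩ _ ⟨y, rfl⟩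
    rw [← map_mul, mul_comm, map_mul]
  · intro i hi a ha e he he1 hae
    obtain rfl : i = false := by simpa using hi
    obtain ⟨x, rfl⟩ := ha
    obtain ⟨k, rfl⟩ := he
    obtain ⟨k', hk'⟩ := hae
    simp only [MonoidHom.comp_apply, S.bl] at hk' he1
    rw [← map_mul, ← map_inv, ← map_mul] at hk'
    obtain ⟨z, hz⟩ := (Lf j).mal x k (fun e => he1 (by rw [e, map_one, map_one])) ⟨k', S.li j hk'⟩
    exact ⟨z, by rw [← hz, MonoidHom.comp_apply, S.bl]⟩

theorem vconj {v w : V} {h : B} (hh : h * b v * h⁻¹ = b w) : v = w := by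
  by_cases hv : v = 1
  · subst hv
    rw [map_one, mul_one, mul_inv_cancel] at hh
    exact S.bi ((map_one b).trans hh)
  · obtain ⟨x, rfl⟩ := S.vmal hv ⟨w, hh.symm⟩
    rw [← map_mul, mul_comm, map_mul, mul_inv_cancel_right] at hh
    exact S.bi hh

theorem tors [Nonempty J] {x : B} (hx : IsOfFinOrder x) :
    ∃ h, h * x * h⁻¹ ∈ b.range ∨ ∃ j, h * x * h⁻¹ ∈ (l j).range := by
  obtain ⟨h, -, j, hj⟩ := S.big.tors trivial hx
  have hf : IsOfFinOrder (h * x * h⁻¹) := by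
    have := (MulAut.conj h).toMonoidHom.isOfFinOrder hx
    simpa using this
  obtain ⟨h', -, t, ht⟩ := (S.small j).tors hj hf
  refine ⟨h' * h, ?_⟩
  have e : h' * h * x * (h' * h)⁻¹ = h' * (h * x * h⁻¹) * h'⁻¹ := by group
  rw [e]
  cases t
  · exact Or.inr ⟨j, ht⟩
  · exact Or.inl ht

theorem notQV {j : J} {x : (Lf j).L} (hx : ∀ y, y * x * y⁻¹ ∉ (Lf j).g.range) {h : B} (hQ : h ∈ Q j) :
    h * l j x * h⁻¹ ∉ b.range := by
  intro hh
  have := ((S.small j).fac (i := false) (j := true) (x := l j x) ⟨x, rfl⟩ ?_ hQ hh).1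
  · simp at this
  · rintro _ ⟨y, rfl⟩ ⟨k, hk⟩
    refine hx y ⟨k, S.li j ?_⟩
    rw [← S.bl]
    simpa using hk

theorem lmQ (j : J) (x : (Lf j).L) : l j x ∈ Q j := (S.small j).leQ false ⟨x, rfl⟩

theorem qfac {j j' : J} {x : (Lf j).L} (hx : ∀ y, y * x * y⁻¹ ∉ (Lf j).g.range) {h : B}
    (hh : h * l j x * h⁻¹ ∈ Q j') : j = j' ∧ h ∈ Q j :=
  S.big.fac (S.lmQ j x) (fun _ ha => S.notQV hx ha) trivial hh

theorem notV {j : J} {x : (Lf j).L} (hx : ∀ y, y * x * y⁻¹ ∉ (Lf j).g.range) {h : B} :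
    h * l j x * h⁻¹ ∉ b.range := by
  intro hh
  obtain ⟨_, h2⟩ := S.qfac (j' := j) hx (S.big.le j hh)
  exact S.notQV hx h2 hh

theorem lmal {j j' : J} {x : (Lf j).L} (hx : ∀ y, y * x * y⁻¹ ∉ (Lf j).g.range) {h : B}
    (hh : h * l j x * h⁻¹ ∈ (l j').range) : j = j' ∧ h ∈ (l j).range := by
  obtain ⟨rfl, h2⟩ := S.qfac hx ((S.small j').leQ false hh)
  refine ⟨rfl, ((S.small j).fac (i := false) (j := false) (x := l j x) ⟨x, rfl⟩ ?_ h2 hh).2⟩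
  rintro _ ⟨y, rfl⟩ ⟨k, hk⟩
  refine hx y ⟨k, S.li j ?_⟩
  rw [← S.bl]
  simpa using hk

end Star
end Sr
end EmbThm

namespace EmbThm
universe u v w
section Ld
open Cardinal

theorem exists_kappa (G : Type u) : ∃ (κ : Type u) (_ : LinearOrder κ) (_ : WellFoundedLT κ),
    (∀ s : ℕ → κ, ∃ b, ∀ n, s n ≤ b) ∧ #G < #κ ∧ ℵ₀ ≤ #κ := by
  let lam : Cardinal.{u} := Order.succ (max #G ℵ₀)
  have hreg : lam.IsRegular := isRegular_succ (le_max_right _ _)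
  have hlt : max #G ℵ₀ < lam := Order.lt_succ _
  refine ⟨lam.ord.ToType, inferInstance, inferInstance, ?_, ?_, ?_⟩
  · intro s
    by_contra hc
    push Not at hc
    have hcof : IsCofinal (Set.range s) := fun b => by
      obtain ⟨n, hn⟩ := hc b
      exact ⟨s n, ⟨n, rfl⟩, hn.le⟩
    have h1 := Order.cof_le hcof
    rw [Ordinal.cof_toType, hreg.cof_ord] at h1
    have h2 : #(Set.range s) ≤ ℵ₀ := mk_le_aleph0_iff.2 (Set.countable_range s).to_subtype
    exact absurd (((le_max_right _ _).trans_lt hlt).trans_le (h1.trans h2)) (lt_irrefl _)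
  · rw [mk_ord_toType]; exact (le_max_left _ _).trans_lt hlt
  · rw [mk_ord_toType]; exact (le_max_right _ _).trans hlt.le

theorem ladder (κ : Type u) [LinearOrder κ] [WellFoundedLT κ] (hb : ∀ s : ℕ → κ, ∃ b, ∀ n, s n ≤ b) :
    ∃ c : κ → κ → ℕ, ∀ f : κ → κ, StrictMono f → (∀ i j, i < j → c (f i) (f j) = c i j) → ∀ i, f i = i := by
  classical
  let Lim : κ → Prop := fun δ => ∃ s : ℕ → κ, StrictMono s ∧ IsLUB (Set.range s) δ
  have hex : ∀ δ, ∃ s : ℕ → κ, Lim δ → StrictMono s ∧ IsLUB (Set.range s) δ := by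
    intro δ
    by_cases h : Lim δ
    · obtain ⟨s, hs⟩ := h; exact ⟨s, fun _ => hs⟩
    · exact ⟨fun _ => δ, fun h' => absurd h' h⟩
  choose η hη using hex
  let c : κ → κ → ℕ := fun i δ => if h : Lim δ ∧ ∃ n, η δ n = i then h.2.choose + 1 else 0
  have c1 : ∀ δ, Lim δ → ∀ n, c (η δ n) δ = n + 1 := by
    intro δ hδ n
    have h : Lim δ ∧ ∃ m, η δ m = η δ n := ⟨hδ, n, rfl⟩
    simp only [c, dif_pos h]
    have := (hη δ hδ).1.injective h.2.choose_spec
    rw [this]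
  have c2 : ∀ i δ n, c i δ = n + 1 → Lim δ ∧ η δ n = i := by
    intro i δ n h
    by_cases h' : Lim δ ∧ ∃ m, η δ m = i
    · simp only [c, dif_pos h'] at h
      have h3 := h'.2.choose_spec
      have h4 : h'.2.choose = n := by omega
      rw [h4] at h3
      exact ⟨h'.1, h3⟩
    · simp only [c, dif_neg h'] at h
      omega
  refine ⟨c, fun f hf hc i => ?_⟩
  by_contra hne
  have hi : i < f i := lt_of_le_of_ne hf.le_apply (Ne.symm hne)
  let s : ℕ → κ := fun n => f^[n] i
  have hs1 : ∀ n, s (n+1) = f (s n) := fun n => Function.iterate_succ_apply' f n i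
  have hs : StrictMono s := by
    apply strictMono_nat_of_lt_succ
    intro n
    induction n with
    | zero => exact hi
    | succ n ih => rw [hs1, hs1 (n+1)]; exact hf ih
  have hub : (upperBounds (Set.range s)).Nonempty := by
    obtain ⟨b, hb⟩ := hb s
    exact ⟨b, by rintro _ ⟨n, rfl⟩; exact hb n⟩
  let δ := (wellFounded_lt (α := κ)).min _ hub
  have hδ : IsLUB (Set.range s) δ :=
    ⟨WellFounded.min_mem _ _ hub, fun x hx => le_of_not_gt (WellFounded.not_lt_min _ _ hx)⟩
  have hLim : Lim δ := ⟨s, hs, hδ⟩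
  obtain ⟨hηm, hηl⟩ := hη δ hLim
  have hηlt : ∀ n, η δ n < δ := fun n => (hηm (Nat.lt_succ_self n)).trans_le (hηl.1 ⟨_, rfl⟩)
  have hcf : ∀ n, c (f (η δ n)) (f δ) = n + 1 := fun n => by rw [hc _ _ (hηlt n), c1 δ hLim]
  have hLf : Lim (f δ) := (c2 _ _ _ (hcf 0)).1
  have hηf : ∀ n, η (f δ) n = f (η δ n) := fun n => (c2 _ _ _ (hcf n)).2
  have hle : f δ ≤ δ := by
    refine (hη _ hLf).2.2 ?_
    rintro _ ⟨n, rfl⟩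
    rw [hηf]
    obtain ⟨_, ⟨m, rfl⟩, hm⟩ := (lt_isLUB_iff hδ).1 (hηlt n)
    have := hf hm
    rw [← hs1] at this
    exact this.le.trans (hδ.1 ⟨_, rfl⟩)
  have hfδ : f δ = δ := le_antisymm hle hf.le_apply
  rw [hfδ] at hηf
  have hiδ : i < δ := hi.trans_le (hδ.1 ⟨1, rfl⟩)
  obtain ⟨_, ⟨n, rfl⟩, hn⟩ := (lt_isLUB_iff hηl).1 hiδ
  have hall : ∀ m, s m < η δ n := by
    intro m
    induction m with
    | zero => exact hn
    | succ m ih => rw [hs1, hηf n]; exact hf ih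
  have : δ ≤ η δ n := hδ.2 (by rintro _ ⟨m, rfl⟩; exact (hall m).le)
  exact absurd (hηlt n) (not_lt.2 this)

variable (κ : Type u)

/-- the elementary abelian vertex group -/
abbrev VV : Type u := Multiplicative (Option (κ ⊕ κ) →₀ ZMod 2)
variable {κ}
noncomputable def vec (s : Option (κ ⊕ κ)) : VV κ := Multiplicative.ofAdd (Finsupp.single s 1)
noncomputable def ev (s : Option (κ ⊕ κ)) : VV κ →* Multiplicative (ZMod 2) := AddMonoidHom.toMultiplicative (Finsupp.applyAddHom s)

open Classical in
theorem ev_vec (s t : Option (κ ⊕ κ)) : ev s (vec t) = if t = s then Multiplicative.ofAdd 1 else 1 := by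
  have : ev s (vec t) = Multiplicative.ofAdd ((Finsupp.single t (1 : ZMod 2)) s) := rfl
  rw [this, Finsupp.single_apply]
  split_ifs <;> rfl

theorem VV_sq (x : VV κ) : x * x = 1 := by
  apply Multiplicative.toAdd.injective
  apply Finsupp.ext
  intro s
  change (Multiplicative.toAdd x) s + (Multiplicative.toAdd x) s = 0
  exact CharTwo.add_self_eq_zero _

theorem o_ne : (Multiplicative.ofAdd (1 : ZMod 2)) ≠ 1 := by decide

theorem vec_ne (s : Option (κ ⊕ κ)) : vec s ≠ 1 := by
  intro h
  have := congrArg (ev s) h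
  rw [ev_vec, if_pos rfl] at this
  exact o_ne (this.trans (map_one (ev s)))

theorem vec_inj : Function.Injective (vec (κ := κ)) := by
  intro s t h
  have := congrArg (ev s) h
  rw [ev_vec, ev_vec, if_pos rfl] at this
  split_ifs at this with h
  · exact h.symm
  · exact (o_ne this).elim

/-- labels -/
abbrev Lam (κ : Type u) [LinearOrder κ] : Type u := Option (κ ⊕ κ ⊕ {q : κ × κ // q.1 ≤ q.2})

variable [LinearOrder κ]

noncomputable def el : Lam κ → VV κ
  | none => vec none
  | some (Sum.inl i) => vec (some (Sum.inl i))
  | some (Sum.inr (Sum.inl i)) => vec (some (Sum.inr i))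
  | some (Sum.inr (Sum.inr q)) => vec (some (Sum.inl q.1.1)) * vec (some (Sum.inr q.1.2))

open Classical in
noncomputable def num (c : κ → κ → ℕ) : Lam κ → ℕ
  | none => 0
  | some (Sum.inl _) => 1
  | some (Sum.inr (Sum.inl _)) => 2
  | some (Sum.inr (Sum.inr q)) => if q.1.1 = q.1.2 then 3 else c q.1.1 q.1.2 + 4

theorem el_ne (j : Lam κ) : el j ≠ 1 := by
  rcases j with _ | i | i | q
  · exact vec_ne _
  · exact vec_ne _
  · exact vec_ne _
  · intro h
    have h1 := eq_inv_of_mul_eq_one_left h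
    rw [inv_eq_of_mul_eq_one_left (VV_sq _)] at h1
    simpa using vec_inj h1

theorem pair_inj {i j i' j' : κ} (h : vec (some (Sum.inl i)) * vec (some (Sum.inr j)) =
    vec (some (Sum.inl i')) * vec (some (Sum.inr j'))) : i = i' ∧ j = j' := by
  have h1 := congrArg (ev (some (Sum.inl i))) h
  have h2 := congrArg (ev (some (Sum.inr j))) h
  simp only [map_mul, ev_vec] at h1 h2
  simp at h1 h2
  exact ⟨h1.symm, h2.symm⟩

theorem label_rigid {c : κ → κ → ℕ}
    (hc : ∀ f : κ → κ, StrictMono f → (∀ i j, i < j → c (f i) (f j) = c i j) → ∀ i, f i = i)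
    (γ : VV κ → VV κ) (hγ : ∀ x y, γ (x * y) = γ x * γ y)
    (hl : ∀ j, ∃ j', num c j' = num c j ∧ γ (el j) = el j') :
    ∀ s, γ (vec s) = vec s := by
  have h0 : γ (vec none) = vec none := by
    obtain ⟨j', h1, h2⟩ := hl none
    rcases j' with _ | i | i | q
    · exact h2
    · simp [num] at h1
    · simp [num] at h1
    · exfalso; simp only [num] at h1; split_ifs at h1
  have hA : ∀ i, ∃ i', γ (vec (some (Sum.inl i))) = vec (some (Sum.inl i')) := by
    intro i
    obtain ⟨j', h1, h2⟩ := hl (some (Sum.inl i))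
    rcases j' with _ | i' | i' | q
    · simp [num] at h1
    · exact ⟨i', h2⟩
    · simp [num] at h1
    · exfalso; simp only [num] at h1; split_ifs at h1 <;> omega
  have hB : ∀ i, ∃ i', γ (vec (some (Sum.inr i))) = vec (some (Sum.inr i')) := by
    intro i
    obtain ⟨j', h1, h2⟩ := hl (some (Sum.inr (Sum.inl i)))
    rcases j' with _ | i' | i' | q
    · simp [num] at h1
    · simp [num] at h1
    · exact ⟨i', h2⟩
    · exfalso; simp only [num] at h1; split_ifs at h1 <;> omega
  choose f hf using hA
  choose g hg using hB
  have hP : ∀ q : {q : κ × κ // q.1 ≤ q.2}, ∃ q' : {q : κ × κ // q.1 ≤ q.2}, f q.1.1 = q'.1.1 ∧ g q.1.2 = q'.1.2 ∧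
      num c (some (Sum.inr (Sum.inr q'))) = num c (some (Sum.inr (Sum.inr q))) := by
    intro q
    obtain ⟨j', h1, h2⟩ := hl (some (Sum.inr (Sum.inr q)))
    have h3 : 3 ≤ num c (some (Sum.inr (Sum.inr q))) := by
      simp only [num]; split_ifs <;> omega
    rcases j' with _ | i' | i' | q'
    · rw [← h1] at h3; simp [num] at h3
    · rw [← h1] at h3; simp [num] at h3
    · rw [← h1] at h3; simp [num] at h3
    · simp only [el] at h2
      rw [hγ, hf, hg] at h2
      exact ⟨q', (pair_inj h2).1, (pair_inj h2).2, h1⟩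
  have hfg : ∀ i, f i = g i := by
    intro i
    obtain ⟨q', h1, h2, h3⟩ := hP ⟨(i, i), le_rfl⟩
    simp only [num, if_true] at h3
    by_cases h : q'.1.1 = q'.1.2
    · rw [← h1, ← h2] at h; exact h
    · rw [if_neg h] at h3; omega
  have hlt : ∀ i j, i < j → f i < f j ∧ c (f i) (f j) = c i j := by
    intro i j hij
    obtain ⟨q', h1, h2, h3⟩ := hP ⟨(i, j), hij.le⟩
    simp only [num, if_neg hij.ne] at h3
    rw [← hfg] at h2
    dsimp only at h1 h2
    by_cases h : q'.1.1 = q'.1.2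
    · rw [if_pos h] at h3; omega
    · rw [if_neg h] at h3
      rw [h1, h2]
      exact ⟨lt_of_le_of_ne q'.2 h, by omega⟩
  have hid := hc f (fun i j h => (hlt i j h).1) (fun i j h => (hlt i j h).2)
  intro s
  rcases s with _ | i | i
  · exact h0
  · rw [hf, hid]
  · rw [hg, ← hfg, hid]

end Ld
end EmbThm

namespace EmbThm
universe u v w
section By
open Function

theorem dih_double {q : ℕ} (hq : q.Prime) (h2 : q ≠ 2) {i : ZMod q} (h : i + i = 0) : i = 0 := by
  obtain ⟨j, hj⟩ := dih_half hq h2 1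
  calc i = i * (2 * j) := by rw [hj, mul_one]
    _ = (i + i) * j := by ring
    _ = 0 := by rw [h, zero_mul]

theorem dih_mal {q : ℕ} (hq : q.Prime) (h2 : q ≠ 2) {x : DihedralGroup q}
    (h : x * DihedralGroup.sr 0 * x⁻¹ = DihedralGroup.sr 0) : x = 1 ∨ x = DihedralGroup.sr 0 := by
  cases x with
  | r i =>
    simp only [DihedralGroup.inv_r, DihedralGroup.r_mul_sr, DihedralGroup.sr_mul_r, DihedralGroup.sr.injEq] at h
    left
    have : i = 0 := dih_double hq h2 (by linear_combination -h)
    rw [this]; rfl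
  | sr i =>
    simp only [DihedralGroup.inv_sr, DihedralGroup.sr_mul_sr, DihedralGroup.r_mul_sr, DihedralGroup.sr.injEq] at h
    right
    have : i = 0 := dih_double hq h2 (by linear_combination h)
    rw [this]

abbrev C2 : Type u := ULift.{u} (Multiplicative (ZMod 2))
def oo : C2.{u} := ULift.up (Multiplicative.ofAdd 1)
theorem C2_cases (x : C2.{u}) : x = 1 ∨ x = oo := by
  rcases x with ⟨x⟩
  have : ∀ x : Multiplicative (ZMod 2), x = 1 ∨ x = Multiplicative.ofAdd 1 := by decide
  rcases this x with rfl | rfl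
  · exact Or.inl rfl
  · exact Or.inr rfl
theorem oo_ne : oo.{u} ≠ 1 := by
  intro h
  have := congrArg ULift.down h
  revert this
  change (Multiplicative.ofAdd (1 : ZMod 2)) = 1 → False
  decide
theorem oo_sq : oo.{u} * oo = 1 := rfl

open Classical in
noncomputable def invol {M : Type*} [Group M] (x : M) (hx : x * x = 1) : C2.{u} →* M where
  toFun y := if y = 1 then 1 else x
  map_one' := if_pos rfl
  map_mul' y z := by
    rcases C2_cases y with rfl | rfl <;> rcases C2_cases z with rfl | rfl
    · simp
    · simp [oo_ne]
    · simp [oo_ne]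
    · simp [oo_ne, oo_sq, hx]

theorem invol_oo {M : Type*} [Group M] (x : M) (hx : x * x = 1) : invol.{u} x hx oo = x := by
  classical
  change (if oo.{u} = 1 then 1 else x) = x
  rw [if_neg oo_ne]

theorem invol_inj {M : Type*} [Group M] {x : M} (hx : x * x = 1) (h1 : x ≠ 1) : Injective (invol.{u} x hx) := by
  rw [injective_iff_map_eq_one]
  intro y hy
  rcases C2_cases y with rfl | rfl
  · rfl
  · rw [invol_oo] at hy; exact absurd hy h1

theorem invol_range {M : Type*} [Group M] {x : M} (hx : x * x = 1) {y : M} :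
    y ∈ (invol.{u} x hx).range ↔ y = 1 ∨ y = x := by
  constructor
  · rintro ⟨z, rfl⟩
    rcases C2_cases z with rfl | rfl
    · left; exact map_one _
    · right; exact invol_oo _ _
  · rintro (rfl | rfl)
    · exact one_mem _
    · exact ⟨oo, invol_oo _ _⟩

abbrev DH (q : ℕ) : Type u := ULift.{u} (DihedralGroup q)
def upD (q : ℕ) : DihedralGroup q →* DH.{u} q := MulEquiv.ulift.symm.toMonoidHom
theorem upD_bij (q : ℕ) : Bijective (upD.{u} q) := MulEquiv.ulift.symm.bijective

theorem sr_sq (q : ℕ) : upD.{u} q (DihedralGroup.sr 0) * upD.{u} q (DihedralGroup.sr 0) = 1 := by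
  rw [← map_mul, DihedralGroup.sr_mul_self, map_one]

theorem sr_ne (q : ℕ) : upD.{u} q (DihedralGroup.sr 0) ≠ 1 := by
  intro h
  have := (upD_bij q).1 (h.trans (map_one _).symm)
  rw [DihedralGroup.one_def] at this
  cases this

noncomputable def gD (q : ℕ) : C2.{u} →* DH.{u} q := invol _ (sr_sq q)
theorem gD_inj (q : ℕ) : Injective (gD.{u} q) := invol_inj _ (sr_ne q)
theorem gD_oo (q : ℕ) : gD.{u} q oo = upD q (DihedralGroup.sr 0) := invol_oo _ _

theorem gD_mal {q : ℕ} (hq : q.Prime) (h2 : q ≠ 2) (x : DH.{u} q) (k : C2.{u}) (hk : k ≠ 1)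
    (h : x * gD q k * x⁻¹ ∈ (gD q).range) : x ∈ (gD.{u} q).range := by
  obtain rfl : k = oo := (C2_cases k).resolve_left hk
  obtain ⟨x, rfl⟩ := (upD_bij q).2 x
  rw [gD_oo] at h
  unfold gD at *
  rw [invol_range] at h ⊢
  rcases h with h | h
  · exfalso
    refine sr_ne.{u} q ?_
    have h3 : upD.{u} q (DihedralGroup.sr 0) = (upD q x)⁻¹ * (upD q x * upD q (DihedralGroup.sr 0) * (upD q x)⁻¹) * upD q x := by
      group
    rw [h3, h]; group
  · rw [← map_mul, ← map_inv, ← map_mul] at h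
    rcases dih_mal hq h2 ((upD_bij q).1 h) with rfl | rfl
    · left; exact map_one _
    · right; rfl

theorem gD_r {q : ℕ} {k : ZMod q} (hk : k ≠ 0) (y : DH.{u} q) :
    y * upD q (DihedralGroup.r k) * y⁻¹ ∉ (gD.{u} q).range := by
  obtain ⟨y, rfl⟩ := (upD_bij q).2 y
  rw [← map_mul, ← map_inv, ← map_mul]
  unfold gD
  rw [invol_range]
  rintro (h | h)
  · have := (upD_bij q).1 (h.trans (map_one _).symm)
    rw [conj_eq_one_iff, DihedralGroup.one_def, DihedralGroup.r.injEq] at this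
    exact hk this
  · have := (upD_bij q).1 h
    cases y <;> simp at this

section word
variable {P : Type u} [Group P] {E : Subgroup P} {A : Bool → Subgroup P} {Q : Subgroup P}

theorem cword (H : IsAmalg E A Q) {σ a τ : P} (hσ : σ ∈ A false) (hσE : σ ∉ E) (ha : a ∈ A true) (haE : a ∉ E)
    (a2 : a * a = 1) (hτ : τ ∈ E) (t2 : τ * τ = 1) (hta : τ * a = a * τ) (hστ : σ⁻¹ * τ * σ ∉ E) (hσσ : σ * σ ∉ E)
    (c : P) (hc : c = σ * (a * (σ * (a * (σ⁻¹ * a))))) :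
    RP E A false true 6 c ∧ (∀ m : ℤ, τ * c * τ⁻¹ ≠ c ^ m) ∧ (∀ m : ℤ, a * c * a⁻¹ ≠ c ^ m) ∧
    (∀ m : ℤ, (τ * a) * c * (τ * a)⁻¹ ≠ c ^ m) := by
  have ft : false ≠ true := Bool.false_ne_true
  have hσi : σ⁻¹ ∈ A false := inv_mem hσ
  have hσiE : σ⁻¹ ∉ E := by simpa using hσE
  have ai : a⁻¹ = a := inv_eq_of_mul_eq_one_left a2
  have ti : τ⁻¹ = τ := inv_eq_of_mul_eq_one_left t2
  have r1 : RP E A true true 1 a := RP.single ha haE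
  have r2 : RP E A false true 2 (σ⁻¹ * a) := RP.cons hσi hσiE ft r1
  have r3 : RP E A true true 3 (a * (σ⁻¹ * a)) := RP.cons ha haE ft.symm r2
  have r4 : RP E A false true 4 (σ * (a * (σ⁻¹ * a))) := RP.cons hσ hσE ft r3
  have r5 : RP E A true true 5 (a * (σ * (a * (σ⁻¹ * a)))) := RP.cons ha haE ft.symm r4
  have r6 : RP E A false true 6 c := hc ▸ RP.cons hσ hσE ft r5
  have hpos : ∀ n : ℕ, RP E A false true ((n+1)*6) (c ^ (n+1)) := H.pow_RP r6 ft
  have hneg : ∀ n : ℕ, RP E A true false ((n+1)*6) (c⁻¹ ^ (n+1)) := H.pow_RP r6.inv ft.symm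
  have hc1 : c ≠ 1 := fun h => H.red _ _ _ _ r6 (h ▸ one_mem _)
  -- trichotomy on exponents
  have tri : ∀ m : ℤ, c ^ m = 1 ∨ (∃ n : ℕ, c ^ m = c ^ (n+1)) ∨ ∃ n : ℕ, c ^ m = c⁻¹ ^ (n+1) := by
    intro m
    rcases m with (_ | n) | n
    · left; simp
    · right; left; exact ⟨n, by rw [Int.ofNat_eq_natCast, zpow_natCast]⟩
    · right; right; exact ⟨n, by rw [zpow_negSucc, inv_pow]⟩
  have conj1 : ∀ g : P, g * c * g⁻¹ = 1 → False := fun g h => hc1 (conj_eq_one_iff.1 h)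
  have tp : ∀ n : ℕ, Tail E A false (a * (σ * (a * (σ⁻¹ * a))) * c ^ n) := by
    intro n
    cases n with
    | zero => rw [pow_zero, mul_one]; exact Tail.of r5 ft.symm
    | succ n => exact Tail.of (r5.mul (hpos n) ft.symm) ft.symm
  have q1 : RP E A false false 1 σ⁻¹ := RP.single hσi hσiE
  have q2 : RP E A true false 2 (a * σ⁻¹) := RP.cons ha haE ft.symm q1
  have q3 : RP E A false false 3 (σ⁻¹ * (a * σ⁻¹)) := RP.cons hσi hσiE ft q2
  have q4 : RP E A true false 4 (a * (σ⁻¹ * (a * σ⁻¹))) := RP.cons ha haE ft.symm q3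
  have tn2 : ∀ n : ℕ, Tail E A false ((a * σ⁻¹) * c⁻¹ ^ n) := by
    intro n
    cases n with
    | zero => rw [pow_zero, mul_one]; exact Tail.of q2 ft.symm
    | succ n => exact Tail.of (q2.mul (hneg n) ft) ft.symm
  have tn4 : ∀ n : ℕ, Tail E A false ((a * (σ⁻¹ * (a * σ⁻¹))) * c⁻¹ ^ n) := by
    intro n
    cases n with
    | zero => rw [pow_zero, mul_one]; exact Tail.of q4 ft.symm
    | succ n => exact Tail.of (q4.mul (hneg n) ft) ft.symm
  have ci : c⁻¹ = a * σ * (a * (σ⁻¹ * (a * σ⁻¹))) := by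
    rw [hc]; simp only [mul_inv_rev, inv_inv, ai]; simp only [mul_assoc]
  have hτσ : τ * σ ∈ A false := mul_mem (H.le _ hτ) hσ
  have kk : (τ * σ)⁻¹ * σ ∉ E := by rw [mul_inv_rev, ti]; exact hστ
  have kk' : σ⁻¹ * (τ * σ) ∉ E := by rw [← mul_assoc]; exact hστ
  refine ⟨r6, ?_, ?_, ?_⟩
  · intro m h
    have hl : RP E A false true 6 (τ * c * τ⁻¹) := (r6.mulE H.le hτ).mulE' H.le (inv_mem hτ)
    rcases tri m with h1 | ⟨n, h1⟩ | ⟨n, h1⟩ <;> rw [h1] at h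
    · exact conj1 _ h
    · refine kk (H.cmp hτσ hσ (y := a * (σ * (a * (σ⁻¹ * a))) * τ⁻¹) (Tail.of (r5.mulE' H.le (inv_mem hτ)) ft.symm) (tp n) ?_)
      rw [pow_succ'] at h
      conv_lhs at h => rw [hc]
      have e1 : σ * (a * (σ * (a * (σ⁻¹ * a))) * c ^ n) = c * c ^ n := by
        conv_rhs => rw [hc]
        rw [← mul_assoc σ]
        conv_rhs => rw [← hc]
        rw [← hc]
      rw [e1, ← h]
      simp only [mul_assoc]
    · rw [h] at hl
      exact ft (H.fst_idx hl (hneg n))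
  · intro m h
    have e : a * c * a⁻¹ = a * (σ * (a * (σ * (a * σ⁻¹)))) := by
      rw [hc]; simp only [mul_assoc, mul_inv_cancel, mul_one]
    have p4 : RP E A false false 3 (σ * (a * σ⁻¹)) := RP.cons hσ hσE ft q2
    have hl : RP E A true false 6 (a * c * a⁻¹) := by
      rw [e]
      exact RP.cons ha haE ft.symm (RP.cons hσ hσE ft (RP.cons ha haE ft.symm p4))
    rcases tri m with h1 | ⟨n, h1⟩ | ⟨n, h1⟩ <;> rw [h1] at h
    · exact conj1 _ h
    · rw [h] at hl
      exact ft (H.fst_idx (hpos n) hl)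
    · have := H.cmp hσ hσi (Tail.of q2 ft.symm) (tn2 n) ?_
      · rw [← mul_inv_rev] at this
        exact hσσ (inv_mem_iff.1 this)
      · rw [e, pow_succ', ci] at h
        have h2 : a * σ * a * (σ * (a * σ⁻¹)) = a * σ * a * (σ⁻¹ * (a * σ⁻¹ * c⁻¹ ^ n)) := by
          rw [ci]; simpa only [mul_assoc] using h
        exact mul_left_cancel h2
  · intro m h
    have e : (τ * a) * c * (τ * a)⁻¹ = (a * (τ * σ)) * (a * (σ * (a * (σ⁻¹ * τ⁻¹)))) := by
      rw [hta, hc, ← hta, mul_inv_rev, hta]; simp only [mul_assoc, mul_inv_cancel_left]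
    have hτE : τ * σ ∉ E := by rwa [Subgroup.mul_mem_cancel_left _ hτ]
    have s1 : RP E A false false 1 (σ⁻¹ * τ⁻¹) := q1.mulE' H.le (inv_mem hτ)
    have s4 : RP E A true false 4 (a * (σ * (a * (σ⁻¹ * τ⁻¹)))) := 
      RP.cons ha haE ft.symm (RP.cons hσ hσE ft (RP.cons ha haE ft.symm s1))
    have hl : RP E A true false 6 ((τ * a) * c * (τ * a)⁻¹) := by
      rw [e, mul_assoc]
      exact RP.cons ha haE ft.symm (RP.cons hτσ hτE ft s4)
    rcases tri m with h1 | ⟨n, h1⟩ | ⟨n, h1⟩ <;> rw [h1] at h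
    · exact conj1 _ h
    · rw [h] at hl
      exact ft (H.fst_idx (hpos n) hl)
    · refine kk (H.cmp hτσ hσ (Tail.of s4 ft.symm) (tn4 n) ?_)
      rw [e, pow_succ', ci] at h
      have h2 : a * ((τ * σ) * (a * (σ * (a * (σ⁻¹ * τ⁻¹))))) = a * (σ * (a * (σ⁻¹ * (a * σ⁻¹)) * c⁻¹ ^ n)) := by
        rw [ci]; simpa only [mul_assoc] using h
      exact mul_left_cancel h2

end word

abbrev K4 : Type u := C2.{u} × C2.{u}

structure YData {Y : Type u} [Group Y] (g : K4.{u} →* Y) (s : DihedralGroup 3 →* Y) (c : Y) : Prop where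
  gi : Injective g
  si : Injective s
  gs : g (oo, 1) = s (DihedralGroup.sr 0)
  hc : c = s (DihedralGroup.r 1) * (g (1, oo) * (s (DihedralGroup.r 1) * (g (1, oo) * ((s (DihedralGroup.r 1))⁻¹ * g (1, oo)))))
  mal : ∀ x : Y, ∀ k, k ≠ 1 → x * g k * x⁻¹ ∈ g.range → x ∈ g.range
  cinf : ¬ IsOfFinOrder c
  cE : ∀ k, ∀ m : ℤ, g k * c * (g k)⁻¹ = c ^ m → k = 1
  tors : ∀ y : Y, IsOfFinOrder y → ∃ h, h * y * h⁻¹ ∈ g.range ∨ h * y * h⁻¹ ∈ s.range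
  rg : ∀ k, k ≠ 0 → ∀ h, h * s (DihedralGroup.r k) * h⁻¹ ∉ g.range
  cnt : Cardinal.mk Y ≤ Cardinal.aleph0
  rs : ∀ k, k ≠ 0 → ∀ h, h * s (DihedralGroup.r k) * h⁻¹ ∈ s.range → h ∈ s.range

theorem exists_Y : ∃ (Y : Type u) (_ : Group Y) (g : K4.{u} →* Y) (s : DihedralGroup 3 →* Y) (c : Y), YData g s c := by
  obtain ⟨Y, _, g, b, gi, bi, hgb, H⟩ := exists_amalg2 (MonoidHom.inl C2.{u} C2.{u}) (gD.{u} 3)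
    (fun x y h => congrArg Prod.fst h) (gD_inj 3)
  let s : DihedralGroup 3 →* Y := b.comp (upD 3)
  have si : Injective s := bi.comp (upD_bij 3).1
  have gs : g (oo, 1) = s (DihedralGroup.sr 0) := by
    have := hgb oo
    rw [gD_oo] at this
    exact this
  have srange : s.range = b.range := by
    ext y
    constructor
    · rintro ⟨z, rfl⟩; exact ⟨_, rfl⟩
    · rintro ⟨z, rfl⟩
      obtain ⟨z, rfl⟩ := (upD_bij 3).2 z
      exact ⟨z, rfl⟩
  have hE : ∀ y, y ∈ (g.comp (MonoidHom.inl C2.{u} C2.{u})).range ↔ y = 1 ∨ y = g (oo, 1) := by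
    intro y
    constructor
    · rintro ⟨z, rfl⟩
      rcases C2_cases z with rfl | rfl
      · left; exact map_one _
      · right; rfl
    · rintro (rfl | rfl)
      · exact one_mem _
      · exact ⟨oo, rfl⟩
  have hEs : ∀ x : DihedralGroup 3, s x ∈ (g.comp (MonoidHom.inl C2.{u} C2.{u})).range → x = 1 ∨ x = DihedralGroup.sr 0 := by
    intro x hx
    rw [hE, gs] at hx
    rcases hx with h | h
    · left; exact si (h.trans (map_one s).symm)
    · right; exact si h
  have K2 : ∀ k : K4.{u}, k * k = 1 := by
    rintro ⟨x, y⟩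
    rcases C2_cases x with rfl | rfl <;> rcases C2_cases y with rfl | rfl <;> rfl
  have kc : ∀ k k' : K4.{u}, k * k' = k' * k := fun k k' => mul_comm _ _
  obtain ⟨W1, W2, W3, W4⟩ := cword H (σ := s (DihedralGroup.r 1)) (a := g (1, oo)) (τ := g (oo, 1)) 
    ⟨upD 3 (DihedralGroup.r 1), rfl⟩ (fun h => absurd (hEs _ h) (by decide)) ⟨_, rfl⟩
    (fun h => by
      rw [hE] at h
      rcases h with h | h
      · have := congrArg Prod.snd (gi (h.trans (map_one g).symm))
        exact oo_ne this
      · have := congrArg Prod.snd (gi h)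
        exact oo_ne this) (by rw [← map_mul, K2, map_one]) ((hE _).2 (Or.inr rfl)) (by rw [← map_mul, K2, map_one])
    (by rw [← map_mul, kc, map_mul])
    (fun h => by
      rw [gs, ← map_inv, ← map_mul, ← map_mul] at h
      exact absurd (hEs _ h) (by decide))
    (fun h => by
      rw [← map_mul] at h
      exact absurd (hEs _ h) (by decide)) _ rfl
  have hrE : ∀ k, k ≠ 0 → ∀ a ∈ b.range, a * s (DihedralGroup.r k) * a⁻¹ ∉ (g.comp (MonoidHom.inl C2.{u} C2.{u})).range := by
    intro k hk a ha h
    rw [← srange] at ha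
    obtain ⟨a, rfl⟩ := ha
    rw [← map_inv, ← map_mul, ← map_mul] at h
    have := hEs _ h
    clear h
    revert this hk
    revert k a
    decide
  refine ⟨Y, _, g, s, _, gi, si, gs, rfl, ?_, ?_, ?_, ?_, ?_, ?_, ?_⟩
  · intro x k hk hx
    refine H.abel (i₀ := true) ?_ ?_ trivial (x := g k) ⟨k, rfl⟩ (fun h => hk (gi (h.trans (map_one g).symm))) hx
    · rintro _ ⟨x, rfl⟩ _ ⟨y, rfl⟩
      rw [← map_mul, kc, map_mul]
    · intro i hi a ha e he he1 hae
      obtain rfl : i = false := by simpa using hi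
      change a ∈ b.range at ha
      rw [← srange] at ha
      obtain ⟨a, rfl⟩ := ha
      obtain rfl := ((hE e).1 he).resolve_left he1
      rw [gs, ← map_inv, ← map_mul, ← map_mul] at hae
      have h3 : a = 1 ∨ a = DihedralGroup.sr 0 := by
        have := hEs _ hae
        clear hae
        revert this
        revert a
        decide
      rw [hE, gs]
      rcases h3 with rfl | rfl
      · left; exact map_one _
      · right; rfl
  · intro h
    obtain ⟨m, hm, h1⟩ := isOfFinOrder_iff_pow_eq_one.1 h
    have := H.pow_RP W1 Bool.false_ne_true (m-1)
    rw [Nat.sub_add_cancel hm, h1] at this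
    exact H.red _ _ _ _ this (one_mem _)
  · rintro ⟨x, y⟩ m h
    rcases C2_cases x with rfl | rfl <;> rcases C2_cases y with rfl | rfl
    · rfl
    · exact absurd h (W3 m)
    · exact absurd h (W2 m)
    · have e : ((oo, oo) : K4.{u}) = (oo, 1) * (1, oo) := rfl
      rw [e, map_mul] at h
      exact absurd h (W4 m)
  · intro y hy
    obtain ⟨h, -, t, ht⟩ := H.tors trivial hy
    refine ⟨h, ?_⟩
    cases t
    · right; rw [srange]; exact ht
    · left; exact ht
  · intro k hk h hh
    have := (H.fac (i := false) (j := true) ⟨upD 3 (DihedralGroup.r k), rfl⟩ (hrE k hk) trivial hh).1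
    simp at this
  · let F : FreeGroup (K4.{u} ⊕ DihedralGroup 3) →* Y := FreeGroup.lift (fun o => Sum.elim g s o)
    have hF : F.range = ⊤ := by
      rw [eq_top_iff]
      refine H.gen _ ?_ ?_
      · rintro _ ⟨z, rfl⟩; exact ⟨FreeGroup.of (Sum.inl (z, 1)), by simp [F]⟩
      · intro t
        cases t
        · rw [cond_false, ← srange]
          rintro _ ⟨z, rfl⟩; exact ⟨FreeGroup.of (Sum.inr z), by simp [F]⟩
        · rintro _ ⟨z, rfl⟩; exact ⟨FreeGroup.of (Sum.inl z), by simp [F]⟩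
    refine (Cardinal.mk_le_of_surjective (MonoidHom.range_eq_top.1 hF)).trans ?_
    have : Nonempty (K4.{u} ⊕ DihedralGroup 3) := ⟨Sum.inl 1⟩
    rw [Cardinal.mk_freeGroup]
    exact max_le (Cardinal.mk_le_aleph0_iff.2 (Finite.to_countable)) le_rfl
  · intro k hk h hh
    rw [srange] at hh ⊢
    exact (H.fac (i := false) (j := false) ⟨upD 3 (DihedralGroup.r k), rfl⟩ (hrE k hk) trivial hh).2

end By
end EmbThm

namespace EmbThm
universe u v w
section Bs
open Function Cardinal

variable {κ : Type u}

noncomputable def f4 (i0 : κ) : K4.{u} →* VV κ :=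
  (invol (vec none) (VV_sq _)).coprod (invol (vec (some (Sum.inr i0))) (VV_sq _))

theorem f4_τ (i0 : κ) : f4 i0 (oo, 1) = vec none := by
  unfold f4
  rw [MonoidHom.coprod_apply, invol_oo, map_one, mul_one]

theorem f4_a (i0 : κ) : f4 i0 (1, oo) = vec (some (Sum.inr i0)) := by
  unfold f4
  rw [MonoidHom.coprod_apply, invol_oo, map_one, one_mul]

theorem f4_inj (i0 : κ) : Injective (f4 i0) := by
  rw [injective_iff_map_eq_one]
  rintro ⟨x, y⟩ h
  rcases C2_cases x with rfl | rfl <;> rcases C2_cases y with rfl | rfl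
  · rfl
  · rw [f4_a] at h; exact absurd h (vec_ne _)
  · rw [f4_τ] at h; exact absurd h (vec_ne _)
  · exfalso
    have e : ((oo, oo) : K4.{u}) = (oo, 1) * (1, oo) := rfl
    rw [e, map_mul, f4_a, f4_τ] at h
    have h1 := eq_inv_of_mul_eq_one_left h
    rw [inv_eq_of_mul_eq_one_left (VV_sq _)] at h1
    simpa using vec_inj h1

theorem f4_ev (i0 : κ) (k : K4.{u}) (i : κ) : ev (some (Sum.inl i)) (f4 i0 k) = 1 := by
  have h : f4 i0 k = (invol (vec none) (VV_sq _)) k.1 * (invol (vec (some (Sum.inr i0))) (VV_sq _)) k.2 := rfl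
  rw [h, map_mul]
  rcases C2_cases k.1 with h1 | h1 <;> rcases C2_cases k.2 with h2 | h2 <;> rw [h1, h2] <;>
    simp [invol_oo, ev_vec]

variable [LinearOrder κ]

noncomputable def pr (c : κ → κ → ℕ) : Lam κ → ℕ
  | none => 3
  | some q => Nat.nth Nat.Prime (num c (some q) + 1)

theorem pr_eq (c : κ → κ → ℕ) (j : Lam κ) : pr c j = Nat.nth Nat.Prime (num c j + 1) := by
  cases j with
  | none => exact Nat.nth_prime_one_eq_three.symm
  | some q => rfl

theorem pr_prime (c : κ → κ → ℕ) (j : Lam κ) : (pr c j).Prime := by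
  rw [pr_eq]; exact Nat.prime_nth_prime _

theorem pr_two (c : κ → κ → ℕ) (j : Lam κ) : pr c j ≠ 2 := by
  rw [pr_eq, ← Nat.nth_prime_zero_eq_two]
  intro h
  have := Nat.nth_injective Nat.infinite_setOfPred_prime h
  omega

theorem pr_inj {c : κ → κ → ℕ} {j j' : Lam κ} (h : pr c j = pr c j') : num c j = num c j' := by
  rw [pr_eq, pr_eq] at h
  have := Nat.nth_injective Nat.infinite_setOfPred_prime h
  omega

def leafG (V : Type u) [Group V] (G : Type u) [Group G] : Leaf V where
  K := PUnit
  L := G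
  gK := inferInstance
  gL := inferInstance
  f := 1
  g := 1
  fi := fun _ _ _ => rfl
  gi := fun _ _ _ => rfl
  mal := fun _ k hk _ => absurd rfl hk

noncomputable def leafY (i0 : κ) {Y : Type u} [Group Y] {g : K4.{u} →* Y} {s : DihedralGroup 3 →* Y} {c : Y}
    (D : YData g s c) : Leaf (VV κ) where
  K := K4.{u}
  L := Y
  gK := inferInstance
  gL := inferInstance
  f := f4 i0
  g := g
  fi := f4_inj i0
  gi := D.gi
  mal := D.mal

noncomputable def leafD (c : κ → κ → ℕ) (j : Lam κ) : Leaf (VV κ) where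
  K := C2.{u}
  L := DH.{u} (pr c j)
  gK := inferInstance
  gL := inferInstance
  f := invol (el j) (VV_sq _)
  g := gD (pr c j)
  fi := invol_inj _ (el_ne j)
  gi := gD_inj _
  mal := gD_mal (pr_prime c j) (pr_two c j)

noncomputable def leaves (c : κ → κ → ℕ) (i0 : κ) (G : Type u) [Group G] {Y : Type u} [Group Y] {g : K4.{u} →* Y}
    {s : DihedralGroup 3 →* Y} {c0 : Y} (D : YData g s c0) : Option (Lam κ) → Leaf (VV κ)
  | none => leafG _ G
  | some none => leafY i0 D
  | some (some q) => leafD c (some q)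

structure BD (c : κ → κ → ℕ) (i0 : κ) {G : Type u} [Group G] {Y : Type u} [Group Y] (g : K4.{u} →* Y)
    {B : Type u} [Group B] (b : VV κ →* B) (lG : G →* B) (lY : Y →* B)
    (δ : ∀ q : κ ⊕ κ ⊕ {q : κ × κ // q.1 ≤ q.2}, DihedralGroup (pr c (some q)) →* B) (Q : Subgroup B) : Prop where
  bi : Injective b
  lGi : Injective lG
  lYi : Injective lY
  δi : ∀ q, Injective (δ q)
  bY : ∀ k, b (f4 i0 k) = lY (g k)
  bD : ∀ q, b (el (some q)) = δ q (DihedralGroup.sr 0)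
  card : #B ≤ #κ
  vmal : ∀ v, v ≠ 1 → ∀ h, h * b v * h⁻¹ ∈ b.range → h ∈ b.range
  tors : ∀ x : B, IsOfFinOrder x → ∃ h, h * x * h⁻¹ ∈ b.range ∨ h * x * h⁻¹ ∈ lG.range ∨ h * x * h⁻¹ ∈ lY.range ∨
    ∃ q, h * x * h⁻¹ ∈ (δ q).range
  gmal : ∀ x, x ≠ 1 → ∀ h, h * lG x * h⁻¹ ∈ lG.range → h ∈ lG.range
  gV : ∀ x, x ≠ 1 → ∀ h, h * lG x * h⁻¹ ∉ b.range
  δmal : ∀ q k, k ≠ 0 → ∀ h, h * δ q (DihedralGroup.r k) * h⁻¹ ∈ (δ q).range → h ∈ (δ q).range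
  Ymal : ∀ y, (∀ z, z * y * z⁻¹ ∉ g.range) → ∀ h, h * lY y * h⁻¹ ∈ lY.range → h ∈ lY.range
  QA : IsAmalg (b.comp (f4 i0)).range (fun t : Bool => bif t then b.range else lY.range) Q
  Qfac : ∀ y, (∀ z, z * y * z⁻¹ ∉ g.range) → ∀ h, h * lY y * h⁻¹ ∈ Q → h ∈ Q
  Qg : ∀ x, x ≠ 1 → ∀ h, h * lG x * h⁻¹ ∉ Q

theorem exists_BD (hκ : ℵ₀ ≤ #κ) (c : κ → κ → ℕ) (i0 : κ) (G : Type u) [Group G] (hG : #G ≤ #κ) {Y : Type u} [Group Y]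
    {g : K4.{u} →* Y} {s : DihedralGroup 3 →* Y} {c0 : Y} (D : YData g s c0) (hY : #Y ≤ #κ) :
    ∃ (B : Type u) (_ : Group B) (b : VV κ →* B) (lG : G →* B) (lY : Y →* B)
    (δ : ∀ q : κ ⊕ κ ⊕ {q : κ × κ // q.1 ≤ q.2}, DihedralGroup (pr c (some q)) →* B) (Q : Subgroup B),
    BD c i0 g b lG lY δ Q := by
  obtain ⟨B, iB, b, l, Q, S⟩ := exists_star (leaves c i0 G D)
  let lG : G →* B := l none
  let lY : Y →* B := l (some none)
  let lD : ∀ q : κ ⊕ κ ⊕ {q : κ × κ // q.1 ≤ q.2}, DH.{u} (pr c (some q)) →* B := fun q => l (some (some q))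
  have gnc : ∀ x : (leaves c i0 G D none).L, x ≠ 1 → ∀ y, y * x * y⁻¹ ∉ (leaves c i0 G D none).g.range := by
    rintro x hx y ⟨z, hz⟩
    exact hx (conj_eq_one_iff.1 hz.symm)
  have drange : ∀ q, ((lD q).comp (upD _)).range = (lD q).range := by
    intro q
    ext y
    constructor
    · rintro ⟨z, rfl⟩; exact ⟨_, rfl⟩
    · rintro ⟨z, rfl⟩
      obtain ⟨z, rfl⟩ := (upD_bij _).2 z
      exact ⟨z, rfl⟩
  have cV : #(VV κ) ≤ #κ := by
    have : Infinite κ := infinite_iff.2 hκ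
    have h1 : #(VV κ) = #(Option (κ ⊕ κ) →₀ ZMod 2) := mk_congr Multiplicative.toAdd
    have h2 : #(Option (κ ⊕ κ)) ≤ #κ := by
      rw [mk_option, mk_sum, lift_id, add_eq_self hκ, add_one_eq hκ]
    have h3 : lift.{u} #(ZMod 2) ≤ ℵ₀ := by
      rw [lift_le_aleph0]; exact mk_le_aleph0_iff.2 Finite.to_countable
    rw [h1, mk_finsupp_lift_of_infinite, lift_uzero]
    exact max_le h2 (h3.trans hκ)
  have cJ : #(Option (Lam κ)) ≤ #κ := by
    have h1 : #{q : κ × κ // q.1 ≤ q.2} ≤ #κ := by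
      refine (mk_subtype_le _).trans ?_
      rw [mk_prod, lift_id, mul_eq_self hκ]
    have h2 : #(κ ⊕ κ ⊕ {q : κ × κ // q.1 ≤ q.2}) ≤ #κ := by
      rw [mk_sum, mk_sum, lift_id, lift_id, lift_id]
      exact add_le_of_le hκ le_rfl (add_le_of_le hκ le_rfl h1)
    have h3 : (1 : Cardinal.{u}) ≤ #κ := one_le_aleph0.trans hκ
    rw [mk_option, mk_option]
    exact add_le_of_le hκ (add_le_of_le hκ h2 h3) h3
  have cD : ∀ j, #(DH.{u} (pr c j)) ≤ #κ := by
    intro j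
    have : NeZero (pr c j) := ⟨(pr_prime c j).ne_zero⟩
    exact (mk_lt_aleph0 (α := DH.{u} (pr c j))).le.trans hκ
  refine ⟨B, iB, b, lG, lY, fun q => (lD q).comp (upD _), Q (some none), ?_⟩
  refine ⟨S.bi, S.li none, S.li (some none), fun q => (S.li (some (some q))).comp (upD_bij _).1, S.bl (some none), ?_, ?_, ?_, ?_, ?_, ?_, ?_, ?_, S.small (some none), ?_, ?_⟩
  · intro q
    have h1 : b (invol (el (some q)) (VV_sq _) oo) = lD q (gD.{u} _ oo) := S.bl (some (some q)) oo
    rw [invol_oo, gD_oo] at h1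
    exact h1
  · refine S.card hκ cV cJ ?_
    rintro (_ | _ | q)
    · exact hG
    · exact hY
    · exact cD (some q)
  · intro v hv h hh
    exact S.vmal hv hh
  · intro x hx
    obtain ⟨h, h1 | ⟨(_ | _ | q), h1⟩⟩ := S.tors hx
    · exact ⟨h, Or.inl h1⟩
    · exact ⟨h, Or.inr (Or.inl h1)⟩
    · exact ⟨h, Or.inr (Or.inr (Or.inl h1))⟩
    · refine ⟨h, Or.inr (Or.inr (Or.inr ⟨q, ?_⟩))⟩
      rw [drange]; exact h1
  · intro x hx h hh
    exact (S.lmal (j := none) (gnc x hx) hh).2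
  · intro x hx h
    exact S.notV (j := none) (gnc x hx)
  · intro q k hk h hh
    rw [drange] at hh ⊢
    exact (S.lmal (j := some (some q)) (x := upD.{u} _ (DihedralGroup.r k)) (gD_r hk) hh).2
  · intro y hy h hh
    exact (S.lmal (j := some none) hy hh).2
  · intro y hy h hh
    exact (S.qfac (j := some none) hy hh).2
  · intro x hx h hh
    have := (S.qfac (j := none) (gnc x hx) hh).1
    cases this

end Bs
end EmbThm

namespace EmbThm
universe u v w
section Fn
open Function Cardinal

variable {κ : Type u} [LinearOrder κ] {c : κ → κ → ℕ} {i0 : κ} {G : Type u} [Group G] {Y : Type u} [Group Y]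
    {g : K4.{u} →* Y} {s : DihedralGroup 3 →* Y} {c0 : Y} (D : YData g s c0)
    {B : Type u} [Group B] {b : VV κ →* B} {lG : G →* B} {lY : Y →* B}
    {δ : ∀ q : κ ⊕ κ ⊕ {q : κ × κ // q.1 ≤ q.2}, DihedralGroup (pr c (some q)) →* B} {Q : Subgroup B}
    (T : BD c i0 g b lG lY δ Q)

include D in
theorem YData.sq_ne {m : ℤ} (hm : m ≠ 0) : c0 ^ m * c0 ^ m ≠ 1 := by
  intro h
  rw [← zpow_add] at h
  exact D.cinf (isOfFinOrder_iff_zpow_eq_one.2 ⟨m + m, by omega, h⟩)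

include D T in
theorem BD.blk {ix : Type u} (e : ix → κ) (he : Injective e) :
    Blk (b.comp (f4 i0)).range (fun t : Bool => bif t then b.range else lY.range) Q
      (fun i => b (vec (some (Sum.inl (e i))))) (lY c0) := by
  classical
  have E2 : ∀ x ∈ (b.comp (f4 i0)).range, x * x = 1 := by
    rintro _ ⟨k, rfl⟩
    rw [MonoidHom.comp_apply, ← map_mul, VV_sq, map_one]
  have mem : ∀ w, b w ∈ (b.comp (f4 i0)).range → ∃ k, f4 i0 k = w := by
    rintro w ⟨k, hk⟩
    exact ⟨k, T.bi hk⟩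
  have vinv : ∀ w : VV κ, w⁻¹ = w := fun w => inv_eq_of_mul_eq_one_left (VV_sq w)
  have evv : ∀ i j, ev (some (Sum.inl (e j))) (vec (some (Sum.inl (e i)))) =
      if i = j then Multiplicative.ofAdd 1 else 1 := by
    intro i j
    rw [ev_vec]
    congr 1
    simp [he.eq_iff]
  refine ⟨T.QA, ⟨_, rfl⟩, ?_, fun i => ⟨_, rfl⟩, ?_, ?_, ?_, ?_, ?_, ?_⟩
  · intro m hm h
    have := E2 _ h
    rw [← map_zpow, ← map_mul] at this
    exact D.sq_ne hm (T.lYi (this.trans (map_one _).symm))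
  · intro i h
    obtain ⟨k, hk⟩ := mem _ h
    have := congrArg (ev (some (Sum.inl (e i)))) hk
    rw [f4_ev, evv, if_pos rfl] at this
    exact o_ne this.symm
  · intro i j hij h
    rw [← map_inv, ← map_mul] at h
    obtain ⟨k, hk⟩ := mem _ h
    have := congrArg (ev (some (Sum.inl (e i)))) hk
    rw [f4_ev, map_mul, vinv, evv, evv, if_pos rfl, if_neg (Ne.symm hij), mul_one] at this
    exact o_ne this.symm
  · rintro _ ⟨y, rfl⟩ h
    have := E2 _ h
    rw [← map_inv, ← map_mul, ← map_mul, ← map_mul] at this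
    have h2 := T.lYi (this.trans (map_one _).symm)
    have h3 : y * c0 * y⁻¹ * (y * c0 * y⁻¹) = y * (c0 * c0) * y⁻¹ := by group
    rw [h3, conj_eq_one_iff] at h2
    have := D.sq_ne (m := 1) one_ne_zero
    rw [zpow_one] at this
    exact this h2
  · rintro u hu k _ ⟨w, rfl⟩ h
    have h1 : ∀ l, ∃ z, w = f4 i0 z * vec (some (Sum.inl (e (k l)))) * vec (some (Sum.inl (e (u l)))) := by
      intro l
      have := h l
      rw [← map_inv, ← map_mul, ← map_mul] at this
      obtain ⟨z, hz⟩ := mem _ this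
      refine ⟨z, ?_⟩
      rw [hz, vinv]
      calc w = (vec (some (Sum.inl (e (k l)))) * vec (some (Sum.inl (e (k l))))) * w * (vec (some (Sum.inl (e (u l)))) * vec (some (Sum.inl (e (u l))))) := by
            rw [VV_sq, VV_sq, one_mul, mul_one]
        _ = _ := by
            generalize vec (some (Sum.inl (e (k l)))) = K
            generalize vec (some (Sum.inl (e (u l)))) = U
            ac_rfl
    choose z hz using h1
    by_cases hc : ∃ l, k l = u l
    · obtain ⟨l, hl⟩ := hc
      refine ⟨z l, ?_⟩
      rw [hz l, hl, mul_assoc, VV_sq, mul_one, MonoidHom.comp_apply]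
    · exfalso
      push Not at hc
      have h2 : ∀ l j, ev (some (Sum.inl (e j))) w = (if k l = j then Multiplicative.ofAdd 1 else 1) *
          (if u l = j then Multiplicative.ofAdd 1 else 1) := by
        intro l j
        rw [hz l, map_mul, map_mul, f4_ev, one_mul, evv, evv]
      have h3 : ∀ l, l ≠ 0 → u l = k 0 := by
        intro l hl
        have h4 := h2 l (u l)
        rw [if_neg (hc l), if_pos rfl, one_mul, h2 0 (u l), if_neg (fun h => hl (hu h).symm), mul_one] at h4
        by_contra hne
        rw [if_neg (Ne.symm hne)] at h4
        exact o_ne h4.symm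
      have := hu ((h3 1 (by decide)).trans (h3 2 (by decide)).symm)
      exact absurd this (by decide)
  · rintro _ ⟨x, rfl⟩ _ ⟨y, rfl⟩
    rw [← map_mul, mul_comm, map_mul]
  · rintro _ ⟨k, rfl⟩ m h
    rw [MonoidHom.comp_apply, T.bY, ← map_zpow, ← map_inv, ← map_mul, ← map_mul] at h
    rw [D.cE k m (T.lYi h), map_one]

/-- all the dihedral subgroups -/
noncomputable def dih (s : DihedralGroup 3 →* Y) (lY : Y →* B)
    (δ : ∀ q : κ ⊕ κ ⊕ {q : κ × κ // q.1 ≤ q.2}, DihedralGroup (pr c (some q)) →* B) :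
    ∀ j : Lam κ, DihedralGroup (pr c j) →* B
  | none => lY.comp s
  | some q => δ q

include D T in
theorem BD.dih_sr (j : Lam κ) : dih s lY δ j (DihedralGroup.sr 0) = b (el j) := by
  cases j with
  | none =>
    change lY (s (DihedralGroup.sr 0)) = b (vec none)
    rw [← D.gs, ← T.bY, f4_τ]
  | some q => exact (T.bD q).symm

include D T in
theorem BD.rig (hG : #G < #κ) : RigData b.range lG.range (pr c) (dih s lY δ) where
  vc := by
    rintro _ ⟨x, rfl⟩ _ ⟨y, rfl⟩
    rw [← map_mul, mul_comm, map_mul]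
  v2 := by
    rintro _ ⟨x, rfl⟩
    rw [← map_mul, VV_sq, map_one]
  vmal := by
    rintro _ ⟨x, rfl⟩ hx h hh
    exact T.vmal x (fun e => hx (by rw [e, map_one])) h hh
  vne := ⟨b (vec none), ⟨_, rfl⟩, fun e => vec_ne none (T.bi (e.trans (map_one _).symm))⟩
  gV := by
    rintro _ ⟨x, rfl⟩ hx h
    exact T.gV x (fun e => hx (by rw [e, map_one])) h
  card := by
    intro f hf
    have h1 : #b.range ≤ #lG.range := mk_le_of_injective hf
    have h2 : #lG.range ≤ #G := mk_le_of_surjective lG.rangeRestrict_surjective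
    have h3 : #κ ≤ #b.range := by
      refine mk_le_of_injective (f := fun i => ⟨b (vec (some (Sum.inl i))), ⟨_, rfl⟩⟩) ?_
      intro i j h
      have := vec_inj (T.bi (congrArg Subtype.val h))
      simpa using this
    exact absurd (h3.trans (h1.trans h2)) (not_le.2 hG)
  pp := pr_prime c
  p2 := pr_two c
  δi := by
    rintro (_ | q)
    · exact T.lYi.comp D.si
    · exact T.δi q
  δv := by
    intro j
    rw [T.dih_sr D]
    exact ⟨_, rfl⟩
  dmal := by
    rintro (_ | q) k hk h hh
    · change h * lY (s (DihedralGroup.r k)) * h⁻¹ ∈ (lY.comp s).range at hh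
      change h ∈ (lY.comp s).range
      obtain ⟨z, hz⟩ := hh
      obtain ⟨y, rfl⟩ := T.Ymal (s (DihedralGroup.r k)) (D.rg k hk) h ⟨s z, hz⟩
      rw [← map_inv, ← map_mul, ← map_mul] at hz
      obtain ⟨x, rfl⟩ := D.rs k hk y ⟨z, T.lYi hz⟩
      exact ⟨x, rfl⟩
    · exact T.δmal q k hk h hh
  tors := by
    intro x hx
    obtain ⟨h, h1 | h1 | ⟨y, hy⟩ | ⟨q, h1⟩⟩ := T.tors x hx
    · exact ⟨h, Or.inl h1⟩
    · exact ⟨h, Or.inr (Or.inl h1)⟩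
    · have hf : IsOfFinOrder y := by
        have h2 := (MulAut.conj h).toMonoidHom.isOfFinOrder hx
        rw [← T.lYi.isOfFinOrder_iff, hy]
        exact h2
      obtain ⟨k, hk⟩ := D.tors y hf
      refine ⟨lY k * h, ?_⟩
      have e : lY k * h * x * (lY k * h)⁻¹ = lY (k * y * k⁻¹) := by
        rw [map_mul, map_mul, map_inv, hy]; group
      rw [e]
      rcases hk with ⟨z, hz⟩ | ⟨z, hz⟩
      · left
        rw [← hz, ← T.bY]
        exact ⟨_, rfl⟩
      · right; right
        refine ⟨none, z, ?_⟩
        rw [← hz]; rfl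
    · exact ⟨h, Or.inr (Or.inr ⟨some q, h1⟩)⟩

include D T in
theorem BD.rigid (hG : #G < #κ)
    (hc : ∀ f : κ → κ, StrictMono f → (∀ i j, i < j → c (f i) (f j) = c i j) → ∀ i, f i = i)
    (H : Type u) [Group H] (ι : B →* H) (ιi : Injective ι)
    (htors : ∀ h : H, IsOfFinOrder h → ∃ k, k * h * k⁻¹ ∈ ι.range)
    (tmal : ∀ b : B, IsOfFinOrder b → b ≠ 1 → ∀ h, h * ι b * h⁻¹ ∈ ι.range → h ∈ ι.range)
    (gmal : ∀ g ∈ lG.range, g ≠ 1 → ∀ h, h * ι g * h⁻¹ ∈ lG.range.map ι → h ∈ lG.range.map ι)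
    (β : H →* H) (hβ : Injective β) :
    ∃ h, ∀ i : κ, β (ι (b (vec (some (Sum.inl i))) * lY c0 * (b (vec (some (Sum.inl i))))⁻¹)) =
      h * ι (b (vec (some (Sum.inl i))) * lY c0 * (b (vec (some (Sum.inl i))))⁻¹) * h⁻¹ := by
  obtain ⟨h, hv, hj⟩ := (T.rig D hG).main H ι ιi htors tmal gmal β hβ
  have hv' : ∀ x, ∃ y, β (ι (b x)) = h * ι (b y) * h⁻¹ := by
    intro x
    obtain ⟨_, ⟨y, rfl⟩, hy⟩ := hv (b x) ⟨x, rfl⟩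
    exact ⟨y, hy⟩
  choose γ hγ using hv'
  have inj : ∀ x y, h * ι (b x) * h⁻¹ = h * ι (b y) * h⁻¹ → x = y := by
    intro x y hxy
    exact T.bi (ιi (mul_left_cancel (mul_right_cancel hxy)))
  have hfix := label_rigid hc γ (by
    intro x y
    apply inj
    rw [← hγ, map_mul, map_mul, map_mul, hγ, hγ, map_mul, map_mul]
    group) (by
    intro j
    obtain ⟨j', h1, h2, -⟩ := hj j
    rw [T.dih_sr D, T.dih_sr D, hγ] at h2
    exact ⟨j', pr_inj h1, inj _ _ h2⟩)
  obtain ⟨j', h1, -, x, ⟨x, rfl⟩, m, hm, h2⟩ := hj none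
  have h3 : num c j' = 0 := pr_inj h1
  obtain rfl : j' = none := by
    rcases j' with _ | i | i | q
    · rfl
    · simp [num] at h3
    · simp [num] at h3
    · simp only [num] at h3
      split_ifs at h3
  have h4 : ∃ x : VV κ, β (ι (lY (s (DihedralGroup.r 1)))) =
      h * ι (b x) * ι (lY (s (DihedralGroup.r 1))) * (h * ι (b x))⁻¹ := by
    change ZMod 3 at m
    change β (ι (lY (s (DihedralGroup.r 1)))) = h * ι (b x * lY (s (DihedralGroup.r m)) * (b x)⁻¹) * h⁻¹ at h2
    have hm2 : m = 1 ∨ m = 2 := by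
      have : ∀ m : ZMod 3, m ≠ 0 → m = 1 ∨ m = 2 := by decide
      exact this m hm
    rcases hm2 with rfl | rfl
    · refine ⟨x, ?_⟩
      rw [h2, map_mul, map_mul, map_inv]; group
    · refine ⟨x * vec none, ?_⟩
      have e : (DihedralGroup.r 2 : DihedralGroup 3) = DihedralGroup.sr 0 * DihedralGroup.r 1 * (DihedralGroup.sr 0)⁻¹ := by
        decide
      have e2 : lY (s (DihedralGroup.sr 0)) = b (vec none) := T.dih_sr D none
      rw [h2, e, map_mul s, map_mul s, map_inv s, map_mul lY, map_mul lY, map_inv lY, e2]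
      simp only [map_mul, map_inv]
      group
  obtain ⟨x, hx⟩ := h4
  let ψ : B →* H := (MulAut.conj (h * ι (b x))).toMonoidHom.comp ι
  let φ : B →* H := β.comp ι
  have mv : ∀ t, b (vec t) ∈ φ.eqLocus ψ := by
    intro t
    change β (ι (b (vec t))) = (h * ι (b x)) * ι (b (vec t)) * (h * ι (b x))⁻¹
    rw [hγ, hfix]
    have : h * ι (b x) * ι (b (vec t)) * (h * ι (b x))⁻¹ = h * (ι (b x) * ι (b (vec t)) * (ι (b x))⁻¹) * h⁻¹ := by group
    rw [this, ← map_mul ι, ← map_mul b, mul_comm x, map_mul b, map_mul ι, mul_inv_cancel_right]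
  have ms : lY (s (DihedralGroup.r 1)) ∈ φ.eqLocus ψ := hx
  have ma : lY (g (1, oo)) ∈ φ.eqLocus ψ := by
    rw [← T.bY, f4_a]; exact mv _
  have mc : lY c0 ∈ φ.eqLocus ψ := by
    rw [D.hc]
    simp only [map_mul, map_inv]
    exact mul_mem ms (mul_mem ma (mul_mem ms (mul_mem ma (mul_mem (inv_mem ms) ma))))
  exact ⟨h * ι (b x), fun i => mul_mem (mul_mem (mv _) mc) (inv_mem (mv _))⟩

include D T in
theorem BD.good {ix : Type u} (e : ix → κ) (he : Injective e) :
    Good lG.range (FreeGroup.lift (fun i => b (vec (some (Sum.inl (e i)))) * lY c0 * (b (vec (some (Sum.inl (e i)))))⁻¹))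
      (MonoidHom.id B) Set.univ := by
  have K := T.blk D e he
  have hR : RX ((MonoidHom.id B).comp (FreeGroup.lift (fun i => b (vec (some (Sum.inl (e i)))) * lY c0 * (b (vec (some (Sum.inl (e i)))))⁻¹)))
      Set.univ = RRs (fun i => b (vec (some (Sum.inl (e i))))) (lY c0) := by
    unfold RX FS RRs
    rw [MonoidHom.map_closure]
    congr 1
    ext y
    simp
  have cn : ∀ z, z * c0 * z⁻¹ ∉ g.range := by
    rintro z ⟨k, hk⟩
    have k2 : k * k = 1 := f4_inj i0 (by rw [map_mul, VV_sq, map_one])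
    have h2 : g k * g k = 1 := by rw [← map_mul, k2, map_one]
    rw [hk] at h2
    have h3 : z * c0 * z⁻¹ * (z * c0 * z⁻¹) = z * (c0 * c0) * z⁻¹ := by group
    rw [h3, conj_eq_one_iff] at h2
    have := D.sq_ne (m := 1) one_ne_zero
    rw [zpow_one] at this
    exact this h2
  have RQ : RRs (fun i => b (vec (some (Sum.inl (e i))))) (lY c0) ≤ Q := by
    rw [Subgroup.closure_le]
    rintro _ ⟨i, rfl⟩
    have h1 : b (vec (some (Sum.inl (e i)))) ∈ Q := T.QA.leQ true ⟨_, rfl⟩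
    have h2 : lY c0 ∈ Q := T.QA.leQ false ⟨_, rfl⟩
    exact mul_mem (mul_mem h1 h2) (inv_mem h1)
  refine ⟨injective_id, K.injD, ?_, ?_, ?_, ?_, ?_⟩
  · intro h _
    exact ⟨1, _, rfl⟩
  · intro _ _ _ h _
    exact ⟨h, rfl⟩
  · rintro _ ⟨x, rfl⟩ hx h hh
    rw [Subgroup.map_id] at hh ⊢
    exact T.gmal x (fun e => hx (by rw [e, map_one])) h hh
  · rintro _ ⟨x, rfl⟩ hx h hh
    rw [hR] at hh
    exact T.Qg x (fun e => hx (by rw [e, map_one])) h (RQ hh)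
  · intro u hu _ t ht
    rw [hR] at ht ⊢
    simp only [MonoidHom.id_apply, FreeGroup.lift_apply_of] at ht
    refine K.pmQ ?_ u hu ht
    have h1 := RQ (ht 0)
    have hv : b (vec (some (Sum.inl (e (u 0))))) ∈ Q := T.QA.leQ true ⟨_, rfl⟩
    have h2 := T.Qfac c0 cn (t * b (vec (some (Sum.inl (e (u 0)))))) (by
      convert h1 using 1; group)
    exact (Subgroup.mul_mem_cancel_right _ hv).1 h2

theorem main_thm (G : Type u) [Group G] :
    ∃ (H : Type u) (_ : Group H) (ι : G →* H), Injective ι ∧ IsSimpleGroup H ∧ Subgroup.center H = ⊥ ∧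
      (∀ φ : H ≃* H, ∃ h : H, ∀ x : H, φ x = h * x * h⁻¹) ∧
      (∀ β : H →* H, Injective β → Surjective β) ∧
      (∀ h ∉ ι.range, ∀ g ∈ ι.range, h * g * h⁻¹ ∈ ι.range → g = 1) := by
  obtain ⟨κ, _, _, hb, hG, hκ⟩ := exists_kappa G
  obtain ⟨c, hc⟩ := ladder κ hb
  obtain ⟨i0⟩ : Nonempty κ := by
    rw [← mk_ne_zero_iff]
    exact (aleph0_pos.trans_le hκ).ne'
  obtain ⟨Y, _, g, s, c0, D⟩ := exists_Y.{u}
  obtain ⟨B, _, b, lG, lY, δ, Q, T⟩ := exists_BD hκ c i0 G hG.le D (D.cnt.trans hκ)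
  obtain ⟨⟨e, he⟩⟩ : Nonempty (ℕ × κ ↪ κ) := by
    rw [← Cardinal.le_def, mk_prod, lift_uzero, mk_nat, lift_aleph0]
    exact mul_le_of_le hκ hκ le_rfl
  obtain ⟨H, iH, ι, ιi, h1, h2, h3, h4, h5⟩ := assembly lG.range _ hκ T.card (T.good D e he) (by
    intro i j
    simp only [FreeGroup.lift_apply_of]
    refine ⟨b (vec (some (Sum.inl (e j)))) * (b (vec (some (Sum.inl (e i)))))⁻¹, ?_⟩
    group) (by
    intro H _ ι ιi ht tm gm β hβ
    obtain ⟨h, hh⟩ := T.rigid D hG hc H ι ιi ht tm gm β hβ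
    refine ⟨h, fun i => ?_⟩
    simp only [FreeGroup.lift_apply_of]
    exact hh (e i))
  refine ⟨H, iH, ι.comp lG, ιi.comp T.lGi, h1, h2, h3, h4, ?_⟩
  intro h hh x hx hx2
  rw [MonoidHom.range_comp] at hh hx hx2
  obtain ⟨y, hy, rfl⟩ := hx
  by_contra hne
  exact hh (h5 y hy (fun e => hne (by rw [e, map_one])) h hx2)

end Fn
end EmbThm


/-- Every group `G` embeds into a group `H` such that `H` is simple, complete
(trivial centre and all automorphisms inner) and co-Hopfian (injective endomorphisms
are surjective), and the image of `G` is malnormal in `H`. -/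
theorem embedding_theorem (G : Type u) [Group G] :
    ∃ (H : Type u) (_ : Group H) (ι : G →* H), Function.Injective ι ∧
      IsSimpleGroup H ∧
      Subgroup.center H = ⊥ ∧
      (∀ φ : H ≃* H, ∃ h : H, ∀ x : H, φ x = h * x * h⁻¹) ∧
      (∀ β : H →* H, Function.Injective β → Function.Surjective β) ∧
      (∀ h : H, h ∉ ι.range → ∀ g ∈ ι.range, h * g * h⁻¹ ∈ ι.range → g = 1) := by
  exact EmbThm.main_thm G
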